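/- Let n ≥ 2 be an integer and p > 0 real with p ≠ 1 and (p,n) ≠ (1/2,2). Then the automorphisms of 𝔼_{p,n} are exactly the maps φ_I(z₁, z₂, …, z_n) = (ζz₁, ζ²z₂, …, ζⁿz_n) for ζ ∈ 𝕋. -/

import Mathlib

open Finset

/-- The symmetrization map `π_n : ℂⁿ → ℂⁿ`, whose `k`-th component is the
`(k+1)`-st elementary symmetric polynomial of the coordinates. -/
noncomputable def piMap (n : ℕ) (z : Fin n → ℂ) : Fin n → ℂ :=
  fun k => ∑ s ∈ Finset.powersetCard (k.1 + 1) Finset.univ, ∏ j ∈ s, z j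

/-- The generalized complex ellipsoid `𝔹_{p,n} = {z : ∑ |z_j|^(2p) < 1}`. -/
noncomputable def ellipsoid (p : ℝ) (n : ℕ) : Set (Fin n → ℂ) :=
  {z | ∑ j, ‖z j‖ ^ (2 * p) < 1}

/-- The symmetrized `(p,n)`-ellipsoid `𝔼_{p,n} = π_n(𝔹_{p,n})`. -/
noncomputable def symEllipsoid (p : ℝ) (n : ℕ) : Set (Fin n → ℂ) :=
  piMap n '' ellipsoid p n

/-- The Euclidean unit ball in `ℂⁿ`. -/
def unitBall (n : ℕ) : Set (Fin n → ℂ) :=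
  {z | ∑ j, ‖z j‖ ^ 2 < 1}

/-- `f` is a proper holomorphic map from the domain `D` onto (into) the domain `G`:
it is holomorphic on `D`, maps `D` into `G`, and preimages of compact subsets of `G`
are compact. -/
def IsProperHolomorphic {n : ℕ} (f : (Fin n → ℂ) → (Fin n → ℂ))
    (D G : Set (Fin n → ℂ)) : Prop :=
  DifferentiableOn ℂ f D ∧ Set.MapsTo f D G ∧
    ∀ K : Set (Fin n → ℂ), K ⊆ G → IsCompact K → IsCompact (D ∩ f ⁻¹' K)

/-- `φ` is an automorphism of the domain `D`: a holomorphic bijection of `D` onto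
itself with holomorphic inverse. -/
def IsAutomorphismOf {n : ℕ} (φ : (Fin n → ℂ) → (Fin n → ℂ))
    (D : Set (Fin n → ℂ)) : Prop :=
  DifferentiableOn ℂ φ D ∧ Set.BijOn φ D D ∧
    ∃ ψ : (Fin n → ℂ) → (Fin n → ℂ), DifferentiableOn ℂ ψ D ∧ Set.InvOn ψ φ D D

/-- `f : ℂⁿ → ℂⁿ` is a polynomial mapping. -/
def IsPolynomialMap {n : ℕ} (f : (Fin n → ℂ) → (Fin n → ℂ)) : Prop :=
  ∃ P : Fin n → MvPolynomial (Fin n) ℂ, ∀ z k, f z k = MvPolynomial.eval z (P k)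

section SCV
variable {E : Type*} [NormedAddCommGroup E] [NormedSpace ℂ E]

/-- kernel of the Cauchy formula for the first derivative -/
noncomputable def cauchyKer (ε θ : ℝ) : ℂ :=
  (2 * Real.pi * Complex.I)⁻¹ * (deriv (circleMap 0 ε) θ * ((circleMap 0 ε θ) ^ 2)⁻¹)

lemma continuous_cauchyKer {ε : ℝ} (hε : 0 < ε) : Continuous (cauchyKer ε) := by
  unfold cauchyKer
  refine continuous_const.mul (Continuous.mul ?_ ?_)
  · have : deriv (circleMap 0 ε) = fun θ => circleMap 0 ε θ * Complex.I := by
      ext θ; simp [deriv_circleMap]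
    rw [this]; fun_prop
  · refine Continuous.inv₀ (by fun_prop) fun x => ?_
    exact pow_ne_zero _ (circleMap_ne_center hε.ne')

lemma slice_open {U : Set E} (hU : IsOpen U) (z v : E) :
    IsOpen {ζ : ℂ | z + ζ • v ∈ U} := hU.preimage (by fun_prop)

lemma slice_diff {U : Set E} {f : E → ℂ} (hf : DifferentiableOn ℂ f U) (z v : E) :
    DifferentiableOn ℂ (fun ζ : ℂ => f (z + ζ • v)) {ζ : ℂ | z + ζ • v ∈ U} :=
  hf.comp (by fun_prop) (fun _ h => h)

lemma fderiv_apply_eq_deriv {f : E → ℂ} {z : E} (hf : DifferentiableAt ℂ f z) (v : E) :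
    fderiv ℂ f z v = deriv (fun ζ : ℂ => f (z + ζ • v)) 0 := by
  have h1 : HasFDerivAt f (fderiv ℂ f z) (z + (0:ℂ) • v) := by simpa using hf.hasFDerivAt
  have h2 : HasDerivAt (fun ζ : ℂ => z + ζ • v) v 0 := by
    simpa using ((hasDerivAt_id (0:ℂ)).smul_const v).const_add z
  exact (h1.comp_hasDerivAt (0:ℂ) h2).deriv.symm

lemma fderiv_eq_cauchy {U : Set E} (hU : IsOpen U) {f : E → ℂ} (hf : DifferentiableOn ℂ f U)
    {z v : E} {ε : ℝ} (hε : 0 < ε) (h : ∀ ζ : ℂ, ‖ζ‖ ≤ ε → z + ζ • v ∈ U) :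
    fderiv ℂ f z v = ∫ θ in (0:ℝ)..(2 * Real.pi), cauchyKer ε θ * f (z + circleMap 0 ε θ • v) := by
  have hz : z ∈ U := by simpa using h 0 (by simpa using hε.le)
  rw [fderiv_apply_eq_deriv (hf.differentiableAt (hU.mem_nhds hz)) v]
  rw [← Complex.cderiv_eq_deriv (slice_open hU z v) (slice_diff hf z v) hε
    (fun ζ hζ => h ζ (by simpa using hζ))]
  unfold Complex.cderiv circleIntegral
  rw [← intervalIntegral.integral_smul]
  congr 1; ext θ
  simp [cauchyKer]; ring

lemma exists_radius {U : Set E} (hU : IsOpen U) {z : E} (hz : z ∈ U) (v : E) :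
    ∃ r > 0, ∃ ε > 0, ∀ y ∈ Metric.ball z r, ∀ ζ : ℂ, ‖ζ‖ ≤ ε → y + ζ • v ∈ U := by
  obtain ⟨r, hr, hrU⟩ := Metric.isOpen_iff.1 hU z hz
  refine ⟨r / 2, by positivity, r / 2 / (‖v‖ + 1), by positivity, fun y hy ζ hζ => hrU ?_⟩
  rw [Metric.mem_ball, dist_eq_norm] at hy ⊢
  have : ‖ζ • v‖ < r / 2 := by
    rw [norm_smul]
    calc ‖ζ‖ * ‖v‖ ≤ r / 2 / (‖v‖ + 1) * ‖v‖ := by gcongr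
      _ < r / 2 := by
        rw [div_mul_eq_mul_div, div_lt_iff₀ (by positivity)]
        nlinarith [norm_nonneg v]
  calc ‖y + ζ • v - z‖ = ‖(y - z) + ζ • v‖ := by congr 1; abel
    _ ≤ ‖y - z‖ + ‖ζ • v‖ := norm_add_le _ _
    _ < r := by linarith

lemma continuousOn_param_fderiv_apply {T : Type*} [TopologicalSpace T] {U : Set E} (hU : IsOpen U)
    {G : T → E → ℂ} (hc : ContinuousOn (fun x : T × E => G x.1 x.2) (Set.univ ×ˢ U))
    (hd : ∀ t, DifferentiableOn ℂ (G t) U) (v : E) :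
    ContinuousOn (fun x : T × E => fderiv ℂ (G x.1) x.2 v) (Set.univ ×ˢ U) := by
  rintro ⟨t0, z0⟩ ⟨-, hz0⟩
  obtain ⟨r, hr, ε, hε, h⟩ := exists_radius hU hz0 v
  refine ContinuousAt.continuousWithinAt ?_
  have hopen : IsOpen (Set.univ ×ˢ Metric.ball z0 r : Set (T × E)) :=
    isOpen_univ.prod Metric.isOpen_ball
  refine ContinuousOn.continuousAt (s := Set.univ ×ˢ Metric.ball z0 r) ?_
    (hopen.mem_nhds ⟨trivial, Metric.mem_ball_self hr⟩)
  have : Set.EqOn (fun x : T × E => fderiv ℂ (G x.1) x.2 v) (fun x => ∫ θ in (0:ℝ)..(2 * Real.pi),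
      cauchyKer ε θ * G x.1 (x.2 + circleMap 0 ε θ • v)) (Set.univ ×ˢ Metric.ball z0 r) := by
    rintro ⟨t, z⟩ ⟨-, hz⟩
    exact fderiv_eq_cauchy hU (hd t) hε (h z hz)
  refine ContinuousOn.congr ?_ this
  rw [continuousOn_iff_continuous_domRestrict]
  refine intervalIntegral.continuous_parametric_intervalIntegral_of_continuous'
    (f := fun (x : (Set.univ ×ˢ Metric.ball z0 r : Set (T × E))) θ =>
      cauchyKer ε θ * G x.1.1 (x.1.2 + circleMap 0 ε θ • v)) ?_ _ _
  refine Continuous.mul ((continuous_cauchyKer hε).comp continuous_snd) ?_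
  refine hc.comp_continuous (f := fun q : (Set.univ ×ˢ Metric.ball z0 r : Set (T × E)) × ℝ =>
    (q.1.1.1, q.1.1.2 + circleMap 0 ε q.2 • v)) ?_ ?_
  · have : Continuous (circleMap 0 ε) := continuous_circleMap 0 ε
    fun_prop
  · rintro ⟨⟨⟨t, z⟩, ⟨-, hz⟩⟩, θ⟩
    exact ⟨trivial, h z hz _ (by simp [abs_of_pos hε])⟩

lemma norm_fderiv_le_of_bound {U : Set E} (hU : IsOpen U) {f : E → ℂ}
    (hf : DifferentiableOn ℂ f U) {z : E} {r C : ℝ} (hr : 0 < r) (hC : 0 ≤ C)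
    (hz : Metric.closedBall z r ⊆ U) (hb : ∀ y ∈ U, ‖f y‖ ≤ C) :
    ‖fderiv ℂ f z‖ ≤ C / r := by
  refine ContinuousLinearMap.opNorm_le_bound _ (by positivity) fun v => ?_
  by_cases hv : v = 0
  · simp [hv]
  have hv' : 0 < ‖v‖ := norm_pos_iff.2 hv
  have hzU : z ∈ U := hz (Metric.mem_closedBall_self hr.le)
  rw [fderiv_apply_eq_deriv (hf.differentiableAt (hU.mem_nhds hzU)) v]
  have hin : ∀ ζ ∈ Metric.closedBall (0:ℂ) (r / ‖v‖), z + ζ • v ∈ U := by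
    intro ζ hζ
    apply hz
    rw [mem_closedBall_zero_iff, le_div_iff₀ hv'] at hζ
    simpa [norm_smul] using hζ
  have h1 : DiffContOnCl ℂ (fun ζ : ℂ => f (z + ζ • v)) (Metric.ball 0 (r / ‖v‖)) :=
    ((slice_diff hf z v).mono hin).diffContOnCl_ball subset_rfl
  have := Complex.norm_deriv_le_of_forall_mem_sphere_norm_le (by positivity) h1
    (C := C) (fun ζ hζ => hb _ (hin ζ (Metric.sphere_subset_closedBall hζ)))
  calc _ ≤ _ := this
    _ = C / r * ‖v‖ := by field_simp

/-- identity theorem -/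
lemma identity_holo {U : Set E} (hU : IsOpen U) (hc : IsPreconnected U) {f : E → ℂ}
    (hf : DifferentiableOn ℂ f U) {z0 : E} (hz0 : z0 ∈ U) (h0 : ∀ᶠ z in nhds z0, f z = 0) :
    ∀ z ∈ U, f z = 0 := by
  set V : Set E := {z | ∀ᶠ y in nhds z, f y = 0} with hV
  have hVo : IsOpen V := isOpen_setOfPred_eventually_nhds
  have : U ⊆ V := by
    refine hc.subset_of_closure_inter_subset hVo ⟨z0, hz0, h0⟩ ?_
    rintro z ⟨hzV, hzU⟩
    obtain ⟨r, hr, hrU⟩ := Metric.isOpen_iff.1 hU z hzU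
    obtain ⟨y, hyV, hyz⟩ := Metric.mem_closure_iff.1 hzV r hr
    have hy : y ∈ Metric.ball z r := by rwa [Metric.mem_ball, dist_comm]
    refine Filter.eventually_of_mem (Metric.ball_mem_nhds z hr) fun x hx => ?_
    have ho := slice_open (Metric.isOpen_ball (x := z) (ε := r)) y (x - y)
    have hcv : IsPreconnected {ζ : ℂ | y + ζ • (x - y) ∈ Metric.ball z r} := by
      refine Convex.isPreconnected ?_
      intro a ha b hb s t hs ht hst
      have := convex_ball z r ha hb hs ht hst
      simp only [Set.mem_ofPred_eq] at this ⊢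
      convert this using 1
      have hst' : (s : ℂ) + t = 1 := by exact_mod_cast hst
      have : y = (s : ℂ) • y + (t : ℂ) • y := by rw [← add_smul, hst', one_smul]
      nth_rewrite 1 [this]
      simp only [smul_add, add_smul, smul_smul, Complex.real_smul]
      simp only [← Complex.coe_smul, smul_smul]
      abel
    have := (slice_diff (hf.mono hrU) y (x - y)).analyticOnNhd ho
    have h2 := this.eqOn_zero_of_preconnected_of_eventuallyEq_zero hcv (z₀ := 0)
      (by simpa using hy) (by
        have hcont : Filter.Tendsto (fun ζ : ℂ => y + ζ • (x - y)) (nhds 0) (nhds y) := by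
          have : Continuous (fun ζ : ℂ => y + ζ • (x - y)) := by fun_prop
          simpa using this.tendsto 0
        exact hcont.eventually hyV)
    have := h2 (x := 1) (by simpa using hx)
    simpa using this
  intro z hz
  exact (this hz).self_of_nhds

variable [FiniteDimensional ℂ E]

lemma continuousOn_param_fderiv {T : Type*} [TopologicalSpace T] {U : Set E} (hU : IsOpen U)
    {G : T → E → ℂ} (hc : ContinuousOn (fun x : T × E => G x.1 x.2) (Set.univ ×ˢ U))
    (hd : ∀ t, DifferentiableOn ℂ (G t) U) :
    ContinuousOn (fun x : T × E => fderiv ℂ (G x.1) x.2) (Set.univ ×ˢ U) :=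
  continuousOn_clm_apply.2 fun v => continuousOn_param_fderiv_apply hU hc hd v

lemma differentiableOn_param_integral {U : Set E} (hU : IsOpen U)
    {G : ℝ → E → ℂ} (hc : ContinuousOn (fun x : ℝ × E => G x.1 x.2) (Set.univ ×ˢ U))
    (hd : ∀ t, DifferentiableOn ℂ (G t) U) (a b : ℝ) :
    DifferentiableOn ℂ (fun z => ∫ t in a..b, G t z) U := by
  have : ProperSpace E := FiniteDimensional.proper ℂ E
  intro z0 hz0
  refine DifferentiableAt.differentiableWithinAt ?_
  obtain ⟨r, hr, hrU⟩ := Metric.nhds_basis_closedBall.mem_iff.1 (hU.mem_nhds hz0)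
  have hcf := continuousOn_param_fderiv hU hc hd
  have hK : IsCompact (Set.uIcc a b ×ˢ Metric.closedBall z0 r) :=
    isCompact_uIcc.prod (isCompact_closedBall z0 r)
  obtain ⟨C, hC⟩ := hK.exists_bound_of_continuousOn
    (hcf.mono (Set.prod_mono (Set.subset_univ _) hrU))
  have hsl : ∀ z ∈ U, Continuous fun t => G t z := fun z hz =>
    hc.comp_continuous (f := fun t : ℝ => (t, z)) (by fun_prop) (fun t => ⟨trivial, hz⟩)
  have hsl' : Continuous fun t => fderiv ℂ (G t) z0 :=
    hcf.comp_continuous (f := fun t : ℝ => (t, z0)) (by fun_prop) (fun t => ⟨trivial, hz0⟩)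
  refine (intervalIntegral.hasFDerivAt_integral_of_dominated_of_fderiv_le
    (F := fun z t => G t z) (F' := fun z t => fderiv ℂ (G t) z) (bound := fun _ => C)
    (μ := MeasureTheory.volume)
    (Metric.closedBall_mem_nhds z0 hr) ?_ ?_ ?_ ?_ ?_ ?_).differentiableAt
  · filter_upwards [hU.mem_nhds hz0] with z hz
    exact (hsl z hz).aestronglyMeasurable
  · exact (hsl z0 hz0).intervalIntegrable _ _
  · exact hsl'.aestronglyMeasurable
  · refine Filter.Eventually.of_forall fun t ht z hz => ?_
    exact hC (t, z) ⟨Set.uIoc_subset_uIcc ht, hz⟩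
  · exact intervalIntegrable_const
  · refine Filter.Eventually.of_forall fun t ht z hz => ?_
    exact ((hd t).differentiableAt (hU.mem_nhds (hrU hz))).hasFDerivAt

lemma differentiableOn_fderiv_apply {U : Set E} (hU : IsOpen U) {f : E → ℂ}
    (hf : DifferentiableOn ℂ f U) (v : E) :
    DifferentiableOn ℂ (fun z => fderiv ℂ f z v) U := by
  intro z0 hz0
  obtain ⟨r, hr, ε, hε, h⟩ := exists_radius hU hz0 v
  refine DifferentiableAt.differentiableWithinAt ?_
  refine DifferentiableOn.differentiableAt (s := Metric.ball z0 r) ?_ (Metric.ball_mem_nhds z0 hr)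
  refine DifferentiableOn.congr ?_ (fun z hz => fderiv_eq_cauchy hU hf hε (h z hz))
  refine differentiableOn_param_integral (G := fun θ z => cauchyKer ε θ *
    f (z + circleMap 0 ε θ • v)) Metric.isOpen_ball ?_ ?_ _ _
  · refine ContinuousOn.mul ((continuous_cauchyKer hε).comp continuous_fst).continuousOn ?_
    refine hf.continuousOn.comp (f := fun x : ℝ × E => x.2 + circleMap 0 ε x.1 • v) ?_ ?_
    · have : Continuous (circleMap 0 ε) := continuous_circleMap 0 ε
      fun_prop
    · rintro ⟨θ, z⟩ ⟨-, hz⟩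
      exact h z hz _ (by simp [abs_of_pos hε])
  · intro θ
    refine DifferentiableOn.const_mul (hf.comp (by fun_prop) ?_) _
    intro z hz
    exact h z hz _ (by simp [abs_of_pos hε])

lemma continuousOn_fderiv_holo {U : Set E} (hU : IsOpen U) {f : E → ℂ}
    (hf : DifferentiableOn ℂ f U) : ContinuousOn (fun z => fderiv ℂ f z) U :=
  continuousOn_clm_apply.2 fun v => (differentiableOn_fderiv_apply hU hf v).continuousOn

lemma contDiffAt_holo {U : Set E} (hU : IsOpen U) {f : E → ℂ}
    (hf : DifferentiableOn ℂ f U) {z : E} (hz : z ∈ U) : ContDiffAt ℂ 1 f z := by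
  have : ContDiffOn ℂ 1 f U := by
    rw [show (1 : WithTop ℕ∞) = 0 + 1 by norm_num, contDiffOn_succ_iff_fderiv_of_isOpen hU]
    exact ⟨hf, by simp, contDiffOn_zero.2 (continuousOn_fderiv_holo hU hf)⟩
  exact this.contDiffAt (hU.mem_nhds hz)

lemma differentiableOn_tsum_holo {U : Set E} (hU : IsOpen U) {f : ℕ → E → ℂ} {u : ℕ → ℝ}
    (hu : Summable u) (hf : ∀ m, DifferentiableOn ℂ (f m) U) (hb : ∀ m, ∀ y ∈ U, ‖f m y‖ ≤ u m) :
    DifferentiableOn ℂ (fun z => ∑' m, f m z) U := by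
  intro z0 hz0
  obtain ⟨r, hr, hrU⟩ := Metric.isOpen_iff.1 hU z0 hz0
  have hu0 : ∀ m, 0 ≤ u m := fun m => (norm_nonneg _).trans (hb m z0 hz0)
  refine DifferentiableAt.differentiableWithinAt ?_
  refine (hasFDerivAt_tsum_of_isPreconnected (u := fun m => u m / (r / 2))
    (f' := fun m z => fderiv ℂ (f m) z) (s := Metric.ball z0 (r / 2)) (x₀ := z0) (x := z0)
    (hu.div_const _) Metric.isOpen_ball (convex_ball _ _).isPreconnected ?_ ?_ ?_ ?_
    ?_).differentiableAt
  · intro m x hx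
    exact ((hf m).differentiableAt (hU.mem_nhds
      (hrU (Metric.ball_subset_ball (by linarith) hx)))).hasFDerivAt
  · intro m x hx
    refine norm_fderiv_le_of_bound hU (hf m) (by positivity) (hu0 m) ?_ (hb m)
    intro y hy
    apply hrU
    rw [Metric.mem_ball] at hx ⊢
    rw [Metric.mem_closedBall] at hy
    linarith [dist_triangle y x z0]
  · exact Metric.mem_ball_self (by positivity)
  · exact Summable.of_norm_bounded hu (fun m => hb m z0 hz0)
  · exact Metric.mem_ball_self (by positivity)

end SCV

/-- polarization -/
lemma polarization {n : ℕ} {U : Set (Fin n → ℂ)} (hU : IsOpen U) (hc : Convex ℝ U)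
    {G : (Fin n → ℂ) → (Fin n → ℂ) → ℂ}
    (hG : DifferentiableOn ℂ (fun x : (Fin n → ℂ) × (Fin n → ℂ) => G x.1 x.2)
      {x | x.1 ∈ U ∧ star x.2 ∈ U})
    (h0 : ∀ w ∈ U, G w (star w) = 0) {w u : Fin n → ℂ} (hw : w ∈ U) (hu : u ∈ U) :
    G w (star u) = 0 := by
  set P : Fin n → ℂ := (1/2 : ℝ) • w + (1/2:ℝ) • u with hP
  set Q : Fin n → ℂ := (-Complex.I/2) • (w - u) with hQ
  have hw' : w = P + Complex.I • Q := by
    ext j; simp [hP, hQ]; ring_nf; simp; ring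
  have hu' : u = P + (-Complex.I) • Q := by
    ext j; simp [hP, hQ]; ring_nf; simp; ring
  have hPU : P ∈ U := hc hw hu (by norm_num) (by norm_num) (by norm_num)
  set S : Set ℂ := {τ | P + τ • Q ∈ U ∧ P + (star τ) • Q ∈ U} with hS
  have hSo : IsOpen S := by
    refine (hU.preimage (f := fun τ : ℂ => P + τ • Q) (by fun_prop)).inter
      (hU.preimage (f := fun τ : ℂ => P + (star τ) • Q) (by fun_prop))
  have hlin : ∀ (a b : ℂ) (s t : ℝ), s + t = 1 → P + (s • a + t • b) • Q =
      s • (P + a • Q) + t • (P + b • Q) := by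
    intro a b s t hst
    have hst' : (s : ℂ) + t = 1 := by exact_mod_cast hst
    ext j
    simp
    linear_combination -(P j) * hst'
  have hSc : IsPreconnected S := by
    refine Convex.isPreconnected ?_
    intro a ha b hb s t hs ht hst
    refine ⟨?_, ?_⟩
    · rw [hlin a b s t hst]; exact hc ha.1 hb.1 hs ht hst
    · have : star (s • a + t • b) = s • star a + t • star b := by simp
      rw [this, hlin _ _ s t hst]; exact hc ha.2 hb.2 hs ht hst
  have hstar : ∀ τ : ℂ, star (star P + τ • star Q) = P + star τ • Q := by
    intro τ; ext j; simp
  have hg : DifferentiableOn ℂ (fun τ : ℂ => G (P + τ • Q) (star P + τ • star Q)) S := by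
    refine hG.comp (f := fun τ : ℂ => (P + τ • Q, star P + τ • star Q)) (t := {x | x.1 ∈ U ∧ star x.2 ∈ U}) ?_ ?_
    · fun_prop
    · intro τ hτ
      refine ⟨hτ.1, ?_⟩
      rw [hstar]; exact hτ.2
  have h0S : (0:ℂ) ∈ S := by simp [hS, hPU]
  have hIS : Complex.I ∈ S := by
    refine ⟨by rw [← hw']; exact hw, ?_⟩
    have : star Complex.I = -Complex.I := by simp
    rw [this, ← hu']; exact hu
  have hfr : ∃ᶠ τ in nhdsWithin (0:ℂ) {0}ᶜ, G (P + τ • Q) (star P + τ • star Q) = 0 := by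
    have ht : Filter.Tendsto (fun x : ℝ => (x : ℂ)) (nhdsWithin 0 {0}ᶜ) (nhdsWithin (0:ℂ) {0}ᶜ) := by
      refine tendsto_nhdsWithin_iff.2 ⟨?_, ?_⟩
      · have := Complex.continuous_ofReal.tendsto 0
        simpa using this.mono_left nhdsWithin_le_nhds
      · filter_upwards [self_mem_nhdsWithin] with x hx
        simpa using hx
    refine ht.frequently (Filter.Eventually.frequently ?_)
    have : ∀ᶠ x : ℝ in nhds 0, (x : ℂ) ∈ S := by
      have h := Complex.continuous_ofReal.tendsto 0
      rw [Complex.ofReal_zero] at h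
      exact h.eventually (hSo.mem_nhds h0S)
    filter_upwards [nhdsWithin_le_nhds this] with x hx
    have h := h0 _ hx.1
    convert h using 2
    ext j; simp
  have := (hg.analyticOnNhd hSo).eqOn_zero_of_preconnected_of_frequently_eq_zero hSc h0S hfr hIS
  simp only [Pi.zero_apply] at this
  rw [hw']
  convert this using 2
  rw [hu']; ext j; simp

section PiMap
variable {n : ℕ}

/-- weighted dilation -/
def Tm {n : ℕ} (t : ℂ) (z : Fin n → ℂ) : Fin n → ℂ := fun k => t ^ (k.1 + 1) * z k

/-- Euler vector field -/
def Eul {n : ℕ} (z : Fin n → ℂ) : Fin n → ℂ := fun k => ((k.1 : ℂ) + 1) * z k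

/-- the alternating polynomial with coefficient vector `x` -/
def altPoly {n : ℕ} (x : Fin n → ℂ) (t : ℂ) : ℂ := ∑ k : Fin n, (-1) ^ k.1 * x k * t ^ (n - 1 - k.1)

lemma prod_sub_eq (l : Fin n → ℂ) (t : ℂ) :
    ∏ j, (t - l j) = t ^ n - altPoly (piMap n l) t := by
  have h1 : ∏ j, (t - l j) = ∏ j, (-l j + t) := Finset.prod_congr rfl fun j _ => by ring
  rw [h1, Finset.prod_add, Finset.sum_powerset, Finset.card_univ, Fintype.card_fin,
    Finset.sum_range_succ']
  rw [Finset.sum_range (n := n)]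
  simp only [Finset.powersetCard_zero, Finset.sum_singleton, Finset.prod_empty, one_mul,
    Finset.sdiff_empty, Finset.prod_const, Finset.card_univ, Fintype.card_fin]
  rw [altPoly, sub_eq_add_neg, add_comm, ← Finset.sum_neg_distrib]
  congr 1
  refine Finset.sum_congr rfl fun k _ => ?_
  rw [piMap, Finset.mul_sum, Finset.sum_mul, ← Finset.sum_neg_distrib]
  refine Finset.sum_congr rfl fun s hs => ?_
  have hs' : s.card = k.1 + 1 := (Finset.mem_powersetCard.1 hs).2
  have h2 : (univ \ s).card = n - 1 - k.1 := by
    rw [Finset.card_sdiff_of_subset (Finset.subset_univ s), Finset.card_univ, Fintype.card_fin, hs']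
    omega
  rw [h2, Finset.prod_neg, hs']
  ring

lemma altPoly_eq_zero {l x : Fin n → ℂ} (hl : Function.Injective l)
    (h : ∀ j, altPoly x (l j) = 0) : x = 0 := by
  have := Matrix.eq_zero_of_forall_index_sum_mul_pow_eq_zero (f := l)
    (v := fun i => (-1) ^ (Fin.rev i).1 * x (Fin.rev i)) hl (fun j => by
      rw [← h j, altPoly, ← Equiv.sum_comp Fin.revPerm]
      refine Finset.sum_congr rfl fun i _ => ?_
      have hi : (Fin.revPerm i).1 = n - 1 - i.1 := by
        have := i.2
        simp only [Fin.revPerm_apply, Fin.val_rev]; omega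
      rw [hi]; simp only [Fin.revPerm_apply, Fin.rev_rev])
  ext k
  have h2 := congrFun this (Fin.rev k)
  simpa using h2

lemma altPoly_sub (x y : Fin n → ℂ) (t : ℂ) : altPoly (x - y) t = altPoly x t - altPoly y t := by
  simp only [altPoly, ← Finset.sum_sub_distrib]
  refine Finset.sum_congr rfl fun k _ => ?_
  simp only [Pi.sub_apply]; ring

lemma altPoly_smul (c : ℂ) (x : Fin n → ℂ) (t : ℂ) : altPoly (c • x) t = c * altPoly x t := by
  simp only [altPoly, Finset.mul_sum]
  refine Finset.sum_congr rfl fun k _ => ?_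
  simp only [Pi.smul_apply, smul_eq_mul]; ring

lemma altPoly_ext {x y : Fin n → ℂ} (h : ∀ t, altPoly x t = altPoly y t) : x = y := by
  have : x - y = 0 := by
    refine altPoly_eq_zero (l := fun j : Fin n => (j.1 : ℂ)) ?_ fun j => ?_
    · intro i j hij; ext; simpa using hij
    · rw [altPoly_sub, h, sub_self]
  exact sub_eq_zero.1 this

lemma piMap_eq_multiset {l m : Fin n → ℂ} (h : piMap n l = piMap n m) :
    Multiset.map l univ.val = Multiset.map m univ.val := by
  have h1 : ∀ l : Fin n → ℂ,
      ((Multiset.map l univ.val).map fun a => Polynomial.X - Polynomial.C a).prod.roots =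
        Multiset.map l univ.val := fun l => Polynomial.roots_multiset_prod_X_sub_C _
  rw [← h1 l, ← h1 m]
  congr 1
  apply Polynomial.funext
  intro t
  simp only [Multiset.map_map]
  have : ∀ l : Fin n → ℂ, Polynomial.eval t (Multiset.map ((fun a => Polynomial.X - Polynomial.C a)
      ∘ l) univ.val).prod = ∏ j, (t - l j) := by
    intro l
    change Polynomial.eval t (∏ j, (Polynomial.X - Polynomial.C (l j))) = _
    simp [Polynomial.eval_prod]
  rw [this, this, prod_sub_eq, prod_sub_eq, h]

lemma piMap_of_multiset {l m : Fin n → ℂ}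
    (h : Multiset.map l univ.val = Multiset.map m univ.val) : piMap n l = piMap n m := by
  refine altPoly_ext fun t => ?_
  have h1 : ∀ l : Fin n → ℂ, altPoly (piMap n l) t =
      t ^ n - (Multiset.map (fun a => t - a) (Multiset.map l univ.val)).prod := by
    intro l
    rw [Multiset.map_map]
    change _ = t ^ n - ∏ j, (t - l j)
    rw [prod_sub_eq]; ring
  rw [h1, h1, h]

lemma piMap_comp_perm (l : Fin n → ℂ) (σ : Equiv.Perm (Fin n)) :
    piMap n (l ∘ σ) = piMap n l := by
  apply piMap_of_multiset
  rw [← Multiset.map_map, Multiset.map_univ_val_equiv]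

lemma piMap_surjective : Function.Surjective (piMap n) := by
  intro z
  set R : Polynomial ℂ := ∑ k : Fin n, Polynomial.C (-((-1) ^ k.1 * z k)) * Polynomial.X ^ (n - 1 - k.1) with hR
  set P : Polynomial ℂ := Polynomial.X ^ n + R with hP
  have hdeg : R.degree < n := by
    by_cases hn : n = 0
    · subst hn; simp [hR]
    refine (Polynomial.degree_sum_le _ _).trans_lt ?_
    rw [Finset.sup_lt_iff (by simp [bot_lt_iff_ne_bot])]
    intro k _
    refine (Polynomial.degree_C_mul_X_pow_le _ _).trans_lt ?_
    have : n - 1 - k.1 < n := by omega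
    exact_mod_cast this
  have hmon : P.Monic := Polynomial.monic_X_pow_add hdeg
  have hnd : P.natDegree = n := by
    have : P.degree = n := by
      rw [hP, Polynomial.degree_add_eq_left_of_degree_lt (by simpa using hdeg)]; simp
    exact Polynomial.natDegree_eq_of_degree_eq_some this
  have hsp : P.Splits := IsAlgClosed.splits P
  have hcard : P.roots.card = n := by rw [← hsp.natDegree_eq_card_roots, hnd]
  obtain ⟨L, hL⟩ : ∃ L : List ℂ, (L : Multiset ℂ) = P.roots := ⟨_, Multiset.coe_toList _⟩
  have hLn : L.length = n := by rw [← hcard, ← hL]; rfl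
  subst hLn
  refine ⟨L.get, altPoly_ext fun t => ?_⟩
  have h1 : P = (P.roots.map fun a => Polynomial.X - Polynomial.C a).prod :=
    hsp.eq_prod_roots_of_monic hmon
  have h2 := congrArg (Polynomial.eval t) h1
  have h3 : ∏ j, (t - L.get j) = Polynomial.eval t P := by
    rw [h2, ← hL, Polynomial.eval_multiset_prod, Multiset.map_map, Multiset.map_coe, Multiset.prod_coe]
    rw [← List.prod_ofFn]
    congr 1
    apply List.ext_get
    · simp
    · intro i h1 h2; simp
  rw [prod_sub_eq] at h3
  have h4 : Polynomial.eval t P = t ^ L.length - altPoly z t := by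
    simp only [hP, hR, Polynomial.eval_add, Polynomial.eval_pow, Polynomial.eval_X,
      Polynomial.eval_finsetSum, Polynomial.eval_mul, Polynomial.eval_C, altPoly, sub_eq_add_neg,
      ← Finset.sum_neg_distrib, neg_mul]
  rw [h4] at h3
  exact sub_right_injective h3

lemma piMap_smul (t : ℂ) (l : Fin n → ℂ) : piMap n (t • l) = Tm t (piMap n l) := by
  ext k
  simp only [piMap, Tm, Pi.smul_apply, smul_eq_mul, Finset.mul_sum]
  refine Finset.sum_congr rfl fun s hs => ?_
  rw [Finset.prod_mul_distrib, Finset.prod_const, (Finset.mem_powersetCard.1 hs).2]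

lemma Tm_mul (s t : ℂ) (z : Fin n → ℂ) : Tm s (Tm t z) = Tm (s * t) z := by
  ext k; simp only [Tm]; ring

lemma Tm_one (z : Fin n → ℂ) : Tm 1 z = z := by ext k; simp [Tm]

lemma Tm_zero (z : Fin n → ℂ) : Tm 0 z = 0 := by ext k; simp [Tm]

lemma Tm_zero_right (t : ℂ) : Tm t (0 : Fin n → ℂ) = 0 := by ext k; simp [Tm]

lemma differentiable_piMap : Differentiable ℂ (piMap n) := by
  unfold piMap; fun_prop

lemma continuous_piMap : Continuous (piMap n) := differentiable_piMap.continuous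

lemma root_bound (l : Fin n → ℂ) (j : Fin n) : ‖l j‖ ≤ 1 + ∑ k, ‖piMap n l k‖ := by
  by_contra! h
  have hS : 0 ≤ ∑ k, ‖piMap n l k‖ := Finset.sum_nonneg fun _ _ => norm_nonneg _
  have h1 : 1 ≤ ‖l j‖ := by linarith
  have h0 : ∏ i, (l j - l i) = 0 := Finset.prod_eq_zero (Finset.mem_univ j) (sub_self _)
  rw [prod_sub_eq, sub_eq_zero] at h0
  have hn : n = (n - 1) + 1 := by have := j.2; omega
  have h2 : ‖l j‖ ^ n ≤ (∑ k, ‖piMap n l k‖) * ‖l j‖ ^ (n - 1) := by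
    rw [← norm_pow, h0, altPoly, Finset.sum_mul]
    refine (norm_sum_le _ _).trans (Finset.sum_le_sum fun k _ => ?_)
    rw [norm_mul, norm_mul, norm_pow, norm_pow, norm_neg, norm_one, one_pow, one_mul]
    have : n - 1 - k.1 ≤ n - 1 := by omega
    gcongr
  have h4 : ‖l j‖ ^ n = ‖l j‖ * ‖l j‖ ^ (n - 1) := by
    rw [← pow_succ', ← hn]
  rw [h4] at h2
  have h3 : 0 < ‖l j‖ ^ (n - 1) := by positivity
  have := le_of_mul_le_mul_right h2 h3
  linarith

lemma isProperMap_piMap : IsProperMap (piMap n) := by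
  rw [isProperMap_iff_isCompact_preimage]
  refine ⟨continuous_piMap, fun K hK => ?_⟩
  refine Metric.isCompact_of_isClosed_isBounded (hK.isClosed.preimage continuous_piMap) ?_
  obtain ⟨C, hC⟩ := hK.exists_bound_of_continuousOn (f := fun z : Fin n → ℂ => ∑ k, ‖z k‖) (by fun_prop)
  refine (Metric.isBounded_closedBall (x := (0 : Fin n → ℂ)) (r := 1 + |C|)).subset fun l hl => ?_
  rw [mem_closedBall_zero_iff, pi_norm_le_iff_of_nonneg (by positivity)]
  intro j
  have h1 := hC _ hl
  have := root_bound l j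
  have h2 := le_abs_self (∑ k, ‖piMap n l k‖)
  rw [Real.norm_eq_abs] at h1
  linarith [le_abs_self C]

lemma isQuotientMap_piMap : Topology.IsQuotientMap (piMap n) :=
  isProperMap_piMap.isClosedMap.isQuotientMap continuous_piMap piMap_surjective

lemma hasDerivAt_Tm (z : Fin n → ℂ) : HasDerivAt (fun t : ℂ => Tm t z) (Eul z) 1 := by
  rw [hasDerivAt_pi]
  intro k
  have := (hasDerivAt_pow (k.1 + 1) (1:ℂ)).mul_const (z k)
  simpa [Tm, Eul] using this

lemma altPoly_fderiv_piMap (l v : Fin n → ℂ) (j : Fin n) :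
    altPoly (fderiv ℂ (piMap n) l v) (l j) = v j * ∏ i ∈ univ.erase j, (l j - l i) := by
  have hc : HasDerivAt (fun τ : ℂ => l + τ • v) v 0 := by
    simpa using ((hasDerivAt_id (0:ℂ)).smul_const v).const_add l
  have h1 : HasDerivAt (fun τ : ℂ => piMap n (l + τ • v)) (fderiv ℂ (piMap n) l v) 0 := by
    have h : HasFDerivAt (piMap n) (fderiv ℂ (piMap n) l) (l + (0:ℂ) • v) := by
      simpa using (differentiable_piMap l).hasFDerivAt
    exact h.comp_hasDerivAt (0:ℂ) hc
  have h2 : HasDerivAt (fun τ : ℂ => altPoly (piMap n (l + τ • v)) (l j))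
      (altPoly (fderiv ℂ (piMap n) l v) (l j)) 0 := by
    unfold altPoly
    refine HasDerivAt.fun_sum fun k _ => ?_
    exact ((hasDerivAt_pi.1 h1 k).const_mul _).mul_const _
  have h3 : HasDerivAt (fun τ : ℂ => ∏ i, (l j - (l i + τ * v i)))
      (∑ i, (∏ i' ∈ univ.erase i, (l j - (l i' + 0 * v i'))) • (-v i)) 0 := by
    refine HasDerivAt.fun_finsetProd fun i _ => ?_
    have := (((hasDerivAt_id (0:ℂ)).mul_const (v i)).const_add (l i)).const_sub (l j)
    simpa using this
  have h4 : (fun τ : ℂ => altPoly (piMap n (l + τ • v)) (l j)) =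
      fun τ : ℂ => (l j) ^ n - ∏ i, (l j - (l i + τ * v i)) := by
    ext τ
    have := prod_sub_eq (l + τ • v) (l j)
    simp only [Pi.add_apply, Pi.smul_apply, smul_eq_mul] at this
    rw [this]; ring
  rw [h4] at h2
  have h5 := h2.unique (h3.const_sub _)
  rw [h5, Finset.sum_eq_single j]
  · simp [mul_comm]
  · intro i _ hij
    rw [Finset.prod_eq_zero (Finset.mem_erase.2 ⟨hij.symm, Finset.mem_univ j⟩)]
    · simp
    · simp
  · simp

lemma prod_erase_ne_zero {l : Fin n → ℂ} (hl : Function.Injective l) (j : Fin n) :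
    ∏ i ∈ univ.erase j, (l j - l i) ≠ 0 := by
  refine Finset.prod_ne_zero_iff.2 fun i hi => ?_
  rw [Finset.mem_erase] at hi
  exact sub_ne_zero.2 fun h => hi.1 (hl h.symm)

lemma fderiv_piMap_injective {l : Fin n → ℂ} (hl : Function.Injective l) :
    Function.Injective (fderiv ℂ (piMap n) l) := by
  rw [injective_iff_map_eq_zero]
  intro v hv
  ext j
  have := altPoly_fderiv_piMap l v j
  rw [hv] at this
  have h0 : altPoly (0 : Fin n → ℂ) (l j) = 0 := by simp [altPoly]
  rw [h0] at this
  exact (mul_eq_zero.1 this.symm).resolve_right (prod_erase_ne_zero hl j)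

lemma fderiv_piMap_self (l : Fin n → ℂ) : fderiv ℂ (piMap n) l l = Eul (piMap n l) := by
  have hc : HasDerivAt (fun τ : ℂ => τ • l) l 1 := by
    simpa using ((hasDerivAt_id (1:ℂ)).smul_const l)
  have h : HasFDerivAt (piMap n) (fderiv ℂ (piMap n) l) ((1:ℂ) • l) := by
    simpa using (differentiable_piMap l).hasFDerivAt
  have h1 := h.comp_hasDerivAt (1:ℂ) hc
  have h2 : (piMap n ∘ fun τ : ℂ => τ • l) = fun τ => Tm τ (piMap n l) := by
    ext τ; simp [piMap_smul]
  rw [h2] at h1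
  exact h1.unique (hasDerivAt_Tm _)

lemma exists_equiv_of_injective {f : (Fin n → ℂ) →L[ℂ] (Fin n → ℂ)} (hf : Function.Injective f) :
    ∃ e : (Fin n → ℂ) ≃L[ℂ] (Fin n → ℂ), (e : (Fin n → ℂ) →L[ℂ] (Fin n → ℂ)) = f :=
  ⟨(LinearEquiv.ofInjectiveEndo (f : (Fin n → ℂ) →ₗ[ℂ] (Fin n → ℂ)) hf).toContinuousLinearEquiv,
    by ext x; rfl⟩

lemma contDiffAt_holo_pi {U : Set (Fin n → ℂ)} (hU : IsOpen U) {F : (Fin n → ℂ) → (Fin n → ℂ)}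
    (hF : DifferentiableOn ℂ F U) {z : Fin n → ℂ} (hz : z ∈ U) : ContDiffAt ℂ 1 F z :=
  contDiffAt_pi.2 fun i => contDiffAt_holo hU (differentiableOn_pi.1 hF i) hz

/-- holomorphic local inverse -/
lemma exists_local_inverse {U : Set (Fin n → ℂ)} (hU : IsOpen U)
    {F : (Fin n → ℂ) → (Fin n → ℂ)} (hF : DifferentiableOn ℂ F U) {z : Fin n → ℂ} (hz : z ∈ U)
    (hinj : Function.Injective (fderiv ℂ F z)) :
    ∃ g : (Fin n → ℂ) → (Fin n → ℂ), ∃ V : Set (Fin n → ℂ), IsOpen V ∧ F z ∈ V ∧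
      DifferentiableOn ℂ g V ∧ g (F z) = z ∧ (∀ y ∈ V, F (g y) = y) ∧
      (∀ᶠ x in nhds z, g (F x) = x) := by
  obtain ⟨e, he⟩ := exists_equiv_of_injective hinj
  have hc := contDiffAt_holo_pi hU hF hz
  have hd : HasFDerivAt F (e : (Fin n → ℂ) →L[ℂ] (Fin n → ℂ)) z := by
    rw [he]; exact (hF.differentiableAt (hU.mem_nhds hz)).hasFDerivAt
  have hs : HasStrictFDerivAt F (e : (Fin n → ℂ) →L[ℂ] (Fin n → ℂ)) z :=
    hc.hasStrictFDerivAt' hd (by norm_num)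
  have hg := hc.to_localInverse hd (by norm_num)
  have h1 : ∀ᶠ y in nhds (F z), DifferentiableAt ℂ (hs.localInverse F e z) y := by
    have := hg.eventually (by simp)
    filter_upwards [this] with y hy
    exact hy.differentiableAt (by norm_num)
  have h2 : ∀ᶠ y in nhds (F z), F (hs.localInverse F e z y) = y := hs.eventually_right_inverse
  obtain ⟨V, hV, hVo, hzV⟩ := eventually_nhds_iff.1 (h1.and h2)
  exact ⟨hs.localInverse F e z, V, hVo, hzV, fun y hy => (hV y hy).1.differentiableWithinAt,
    hs.localInverse_apply_image, fun y hy => (hV y hy).2, hs.eventually_left_inverse⟩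

end PiMap

section Rho
variable {n : ℕ}

/-- the exhaustion upstairs -/
noncomputable def Nfun (p : ℝ) (l : Fin n → ℂ) : ℝ := ∑ j, ‖l j‖ ^ (2 * p)

/-- the exhaustion downstairs -/
noncomputable def rho (p : ℝ) (z : Fin n → ℂ) : ℝ := Nfun p (Function.surjInv piMap_surjective z)

lemma Nfun_of_piMap_eq (p : ℝ) {l m : Fin n → ℂ} (h : piMap n l = piMap n m) :
    Nfun p l = Nfun p m := by
  have h1 := piMap_eq_multiset h
  have h2 : ∀ l : Fin n → ℂ, Nfun p l =
      (Multiset.map (fun a : ℂ => ‖a‖ ^ (2 * p)) (Multiset.map l univ.val)).sum := by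
    intro l; rw [Multiset.map_map]; rfl
  rw [h2, h2, h1]

lemma rho_piMap (p : ℝ) (l : Fin n → ℂ) : rho p (piMap n l) = Nfun p l :=
  Nfun_of_piMap_eq p (Function.surjInv_eq piMap_surjective _)

lemma continuous_Nfun {p : ℝ} (hp : 0 < p) : Continuous (Nfun p : (Fin n → ℂ) → ℝ) := by
  unfold Nfun
  refine continuous_finsetSum _ fun j _ => ?_
  exact (Continuous.rpow_const (by fun_prop) fun x => Or.inr (by positivity))

lemma continuous_rho {p : ℝ} (hp : 0 < p) : Continuous (rho p : (Fin n → ℂ) → ℝ) := by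
  rw [isQuotientMap_piMap.continuous_iff]
  have : rho p ∘ piMap n = Nfun p := by ext l; exact rho_piMap p l
  rw [this]; exact continuous_Nfun hp

lemma Nfun_nonneg (p : ℝ) (l : Fin n → ℂ) : 0 ≤ Nfun p l :=
  Finset.sum_nonneg fun _ _ => Real.rpow_nonneg (norm_nonneg _) _

lemma rho_nonneg (p : ℝ) (z : Fin n → ℂ) : 0 ≤ rho p z := Nfun_nonneg p _

lemma Nfun_smul (p : ℝ) (t : ℂ) (l : Fin n → ℂ) : Nfun p (t • l) = ‖t‖ ^ (2 * p) * Nfun p l := by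
  simp only [Nfun, Pi.smul_apply, smul_eq_mul, norm_mul, Finset.mul_sum]
  exact Finset.sum_congr rfl fun j _ => Real.mul_rpow (norm_nonneg _) (norm_nonneg _)

lemma rho_Tm (p : ℝ) (t : ℂ) (z : Fin n → ℂ) : rho p (Tm t z) = ‖t‖ ^ (2 * p) * rho p z := by
  obtain ⟨l, rfl⟩ := piMap_surjective z
  rw [← piMap_smul, rho_piMap, rho_piMap, Nfun_smul]

lemma rho_Tm_of_norm_one (p : ℝ) {t : ℂ} (ht : ‖t‖ = 1) (z : Fin n → ℂ) :
    rho p (Tm t z) = rho p z := by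
  rw [rho_Tm, ht, Real.one_rpow, one_mul]

lemma symEllipsoid_eq (p : ℝ) (n : ℕ) : symEllipsoid p n = {z | rho p z < 1} := by
  ext z
  constructor
  · rintro ⟨l, hl, rfl⟩
    rw [Set.mem_ofPred_eq, rho_piMap]; exact hl
  · intro hz
    obtain ⟨l, rfl⟩ := piMap_surjective z
    rw [Set.mem_ofPred_eq, rho_piMap] at hz
    exact ⟨l, hz, rfl⟩

lemma mem_symEllipsoid {p : ℝ} {z : Fin n → ℂ} : z ∈ symEllipsoid p n ↔ rho p z < 1 := by
  rw [symEllipsoid_eq]; rfl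

lemma isOpen_rho_lt {p : ℝ} (hp : 0 < p) (c : ℝ) : IsOpen {z : Fin n → ℂ | rho p z < c} :=
  isOpen_lt (continuous_rho hp) continuous_const

lemma isOpen_symEllipsoid {p : ℝ} (hp : 0 < p) : IsOpen (symEllipsoid p n) := by
  rw [symEllipsoid_eq]; exact isOpen_rho_lt hp 1

lemma isCompact_rho_le {p : ℝ} (hp : 0 < p) (c : ℝ) :
    IsCompact {z : Fin n → ℂ | rho p z ≤ c} := by
  have hK : IsCompact {l : Fin n → ℂ | Nfun p l ≤ c} := by
    refine Metric.isCompact_of_isClosed_isBounded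
      (isClosed_le (continuous_Nfun hp) continuous_const) ?_
    refine (Metric.isBounded_closedBall (x := (0 : Fin n → ℂ))
      (r := |c| ^ (1 / (2 * p)))).subset fun l hl => ?_
    rw [mem_closedBall_zero_iff, pi_norm_le_iff_of_nonneg (by positivity)]
    intro j
    have h1 : ‖l j‖ ^ (2 * p) ≤ |c| := by
      refine le_trans ?_ (le_trans hl (le_abs_self c))
      exact Finset.single_le_sum (f := fun j => ‖l j‖ ^ (2 * p))
        (fun _ _ => Real.rpow_nonneg (norm_nonneg _) _) (Finset.mem_univ j)
    have h2 := Real.rpow_le_rpow (by positivity) h1 (z := 1 / (2 * p)) (by positivity)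
    rwa [← Real.rpow_mul (norm_nonneg _), mul_one_div_cancel (by positivity), Real.rpow_one] at h2
  have : {z : Fin n → ℂ | rho p z ≤ c} = piMap n '' {l : Fin n → ℂ | Nfun p l ≤ c} := by
    ext z
    obtain ⟨l, rfl⟩ := piMap_surjective z
    constructor
    · intro h; exact ⟨l, by rw [Set.mem_ofPred_eq, ← rho_piMap]; exact h, rfl⟩
    · rintro ⟨m, hm, h⟩
      rw [← h, Set.mem_ofPred_eq, rho_piMap]; exact hm
  rw [this]
  exact hK.image continuous_piMap

lemma Nfun_zero {p : ℝ} (hp : 0 < p) : Nfun p (0 : Fin n → ℂ) = 0 := by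
  simp [Nfun, Real.zero_rpow (by positivity : 2 * p ≠ 0)]

lemma rho_zero {p : ℝ} (hp : 0 < p) : rho p (0 : Fin n → ℂ) = 0 := by
  have := rho_Tm p 0 (0 : Fin n → ℂ)
  rw [Tm_zero] at this
  simpa [Real.zero_rpow (by positivity : 2 * p ≠ 0)] using this

lemma isPreconnected_Nfun_lt {p : ℝ} (hp : 0 < p) {c : ℝ} (hc : 0 < c) :
    IsPreconnected {l : Fin n → ℂ | Nfun p l < c} := by
  have : StarConvex ℝ 0 {l : Fin n → ℂ | Nfun p l < c} := by
    rw [starConvex_zero_iff]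
    intro x hx a ha ha1
    have h : (a • x) = (a : ℂ) • x := by ext; simp
    rw [Set.mem_ofPred_eq, h, Nfun_smul]
    refine lt_of_le_of_lt ?_ hx
    refine mul_le_of_le_one_left (Nfun_nonneg p x) ?_
    refine Real.rpow_le_one (norm_nonneg _) (by simpa [abs_of_nonneg ha] using ha1) (by positivity)
  exact (this.isPathConnected (by
    rw [Set.mem_ofPred_eq, Nfun_zero hp]; exact hc)).isConnected.isPreconnected

lemma isPreconnected_rho_lt {p : ℝ} (hp : 0 < p) {c : ℝ} (hc : 0 < c) :
    IsPreconnected {z : Fin n → ℂ | rho p z < c} := by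
  have : {z : Fin n → ℂ | rho p z < c} = piMap n '' {l : Fin n → ℂ | Nfun p l < c} := by
    ext z
    obtain ⟨l, rfl⟩ := piMap_surjective z
    constructor
    · intro h; exact ⟨l, by rw [Set.mem_ofPred_eq, ← rho_piMap]; exact h, rfl⟩
    · rintro ⟨m, hm, h⟩
      rw [← h, Set.mem_ofPred_eq, rho_piMap]; exact hm
  rw [this]
  exact (isPreconnected_Nfun_lt hp hc).image _ continuous_piMap.continuousOn

end Rho

section S2
open MeasureTheory

/-- point of the unit circle -/
noncomputable def ex (θ : ℝ) : ℂ := Complex.exp (θ * Complex.I)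

lemma norm_ex (θ : ℝ) : ‖ex θ‖ = 1 := Complex.norm_exp_ofReal_mul_I θ

lemma ex_ne_zero (θ : ℝ) : ex θ ≠ 0 := Complex.exp_ne_zero _

lemma continuous_ex : Continuous ex := by unfold ex; fun_prop

/-- weighted rotation -/
noncomputable def rot {n : ℕ} (a : Fin n → ℕ) (θ : ℝ) (z : Fin n → ℂ) : Fin n → ℂ :=
  fun k => ex θ ^ a k * z k

lemma continuous_rot {n : ℕ} (a : Fin n → ℕ) :
    Continuous (fun x : ℝ × (Fin n → ℂ) => rot a x.1 x.2) := by
  have := continuous_ex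
  unfold rot
  fun_prop

lemma mulUnit_mp {c : ℂ} (hc : ‖c‖ = 1) : MeasurePreserving (fun z : ℂ => c * z) := by
  have h := (rotation (⟨c, by simp [Submonoid.unitSphere, hc]⟩ : Circle)).measurePreserving
  exact h

lemma rot_mp {n : ℕ} (a : Fin n → ℕ) (θ : ℝ) : MeasurePreserving (rot a θ) := by
  have h : ∀ k : Fin n, MeasurePreserving (fun z : ℂ => ex θ ^ a k * z) := fun k =>
    mulUnit_mp (by simp [norm_ex])
  exact volume_preserving_pi h

lemma avg {n : ℕ} (a : Fin n → ℕ) {S : Set (Fin n → ℂ)} (hS : MeasurableSet S)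
    (hinv : ∀ θ z, rot a θ z ∈ S ↔ z ∈ S) {G : (Fin n → ℂ) → ℂ} (hG : IntegrableOn G S) :
    ∫ z in S, G z = ∫ z in S, ((2 * Real.pi : ℝ) : ℂ)⁻¹ *
      ∫ θ in (0 : ℝ)..2 * Real.pi, G (rot a θ z) := by
  set ν : Measure ℝ := volume.restrict (Set.Ioc 0 (2 * Real.pi)) with hν
  set μ : Measure (Fin n → ℂ) := volume.restrict S with hμ
  have hmp : ∀ θ, MeasurePreserving (rot a θ) μ μ := by
    intro θ
    have := (rot_mp a θ).restrict_preimage hS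
    have h2 : rot a θ ⁻¹' S = S := by ext z; exact hinv θ z
    rwa [h2] at this
  have hsk : MeasurePreserving (fun x : ℝ × (Fin n → ℂ) => (x.1, rot a x.1 x.2))
      (ν.prod μ) (ν.prod μ) := by
    refine (MeasurePreserving.id ν).skew_product (g := fun θ z => rot a θ z) ?_ ?_
    · exact (continuous_rot a).measurable
    · exact Filter.Eventually.of_forall fun θ => (hmp θ).map_eq
  have hi1 : Integrable (fun x : ℝ × (Fin n → ℂ) => G x.2) (ν.prod μ) :=
    MeasureTheory.Integrable.comp_snd hG ν
  have hi2 : Integrable (fun x : ℝ × (Fin n → ℂ) => G (rot a x.1 x.2)) (ν.prod μ) :=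
    hsk.integrable_comp_of_integrable hi1
  have hswap := integral_integral_swap (f := fun θ z => G (rot a θ z)) hi2
  have hθ : ∀ θ, ∫ z, G (rot a θ z) ∂μ = ∫ z, G z ∂μ := by
    intro θ
    have hme : MeasurableEmbedding (rot a θ) := by
      have hl : Function.LeftInverse (rot a (-θ)) (rot a θ) := by
        intro z; ext k; simp [rot, ← mul_assoc, ← mul_pow, ex, ← Complex.exp_add]
      have hr : Function.RightInverse (rot a (-θ)) (rot a θ) := by
        intro z; ext k; simp [rot, ← mul_assoc, ← mul_pow, ex, ← Complex.exp_add]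
      let e : (Fin n → ℂ) ≃ₜ (Fin n → ℂ) :=
        { toFun := rot a θ, invFun := rot a (-θ), left_inv := hl, right_inv := hr
          continuous_toFun := (continuous_rot a).comp (Continuous.prodMk_right θ)
          continuous_invFun := (continuous_rot a).comp (Continuous.prodMk_right (-θ)) }
      exact e.measurableEmbedding
    exact (hmp θ).integral_comp hme G
  simp only [hθ] at hswap
  rw [integral_const] at hswap
  have hpi : (0 : ℝ) ≤ 2 * Real.pi := by positivity
  simp only [intervalIntegral.integral_of_le hpi]
  rw [integral_const_mul, ← hswap]
  simp only [hν, measureReal_restrict_apply_univ, Real.volume_real_Ioc_of_le hpi, sub_zero]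
  rw [Complex.real_smul, ← mul_assoc, inv_mul_cancel₀, one_mul]
  exact_mod_cast Real.two_pi_pos.ne'

/-- homogeneous components -/
noncomputable def wt {n : ℕ} (F : (Fin n → ℂ) → ℂ) (m : ℕ) (z : Fin n → ℂ) : ℂ :=
  iteratedDeriv m (fun ζ => F (Tm ζ z)) 0 / m.factorial

/-- homogeneous components with integer weights -/
noncomputable def wtZ {n : ℕ} (F : (Fin n → ℂ) → ℂ) (a : ℤ) (z : Fin n → ℂ) : ℂ :=
  if 0 ≤ a then wt F a.toNat z else 0

lemma iteratedDeriv_scale (c : ℂ) (g : ℂ → ℂ) (m : ℕ) :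
    iteratedDeriv m (fun ζ => g (c * ζ)) = fun ζ => c ^ m * iteratedDeriv m g (c * ζ) := by
  induction m with
  | zero => simp
  | succ m ih =>
    rw [iteratedDeriv_succ, ih]
    ext ζ
    rw [deriv_const_mul_field, deriv_comp_mul_left, iteratedDeriv_succ, pow_succ, smul_eq_mul, mul_assoc]

lemma wt_Tm {n : ℕ} (F : (Fin n → ℂ) → ℂ) (m : ℕ) (t : ℂ) (z : Fin n → ℂ) :
    wt F m (Tm t z) = t ^ m * wt F m z := by
  have : (fun ζ => F (Tm ζ (Tm t z))) = fun ζ => (fun ζ => F (Tm ζ z)) (t * ζ) := by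
    ext ζ; rw [Tm_mul, mul_comm]
  unfold wt
  rw [this, iteratedDeriv_scale t (fun ζ => F (Tm ζ z)) m]
  simp [mul_div_assoc]

lemma wtZ_Tm {n : ℕ} (F : (Fin n → ℂ) → ℂ) (a : ℤ) {t : ℂ} (z : Fin n → ℂ) :
    wtZ F a (Tm t z) = t ^ a * wtZ F a z := by
  unfold wtZ
  split_ifs with h
  · rw [wt_Tm]
    obtain ⟨m, rfl⟩ := Int.eq_ofNat_of_zero_le h
    simp
  · simp

lemma circle_coeff {g : ℂ → ℂ} (hg : DiffContOnCl ℂ g (Metric.ball 0 1)) (a : ℤ) :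
    ((2 * Real.pi : ℝ) : ℂ)⁻¹ * ∫ θ in (0 : ℝ)..2 * Real.pi, g (ex θ) * (ex θ) ^ (-a) =
      if 0 ≤ a then iteratedDeriv a.toNat g 0 / a.toNat.factorial else 0 := by
  have hpi : ((2 * Real.pi : ℝ) : ℂ) ≠ 0 := by exact_mod_cast Real.two_pi_pos.ne'
  have hcm : ∀ θ, circleMap 0 1 θ = ex θ := by intro θ; simp [circleMap, ex]
  split_ifs with h
  · obtain ⟨m, rfl⟩ := Int.eq_ofNat_of_zero_le h
    have h1 := DiffContOnCl.circleIntegral_one_div_sub_center_pow_smul one_pos m hg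
    simp only [circleIntegral, deriv_circleMap, hcm, sub_zero, smul_eq_mul] at h1
    have h2 : ∀ θ, ex θ * Complex.I * (1 / ex θ ^ (m + 1) * g (ex θ)) =
        Complex.I * (g (ex θ) * ex θ ^ (-(m : ℤ))) := by
      intro θ
      have := ex_ne_zero θ
      rw [zpow_neg, zpow_natCast]
      field_simp
      ring
    simp only [h2] at h1
    rw [intervalIntegral.integral_const_mul] at h1
    simp only [Int.toNat_natCast]
    have hI := Complex.I_ne_zero
    have h3 : ∫ θ in (0 : ℝ)..2 * Real.pi, g (ex θ) * ex θ ^ (-(m : ℤ)) =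
        2 * Real.pi / m.factorial * iteratedDeriv m g 0 := by
      apply mul_left_cancel₀ hI
      rw [h1]; ring
    rw [h3]
    push_cast
    have : (Real.pi : ℂ) ≠ 0 := by exact_mod_cast Real.pi_ne_zero
    field_simp
  · push Not at h
    obtain ⟨m, hm⟩ : ∃ m : ℕ, -a = m + 1 := ⟨(-a - 1).toNat, by omega⟩
    have hd : DiffContOnCl ℂ (fun ζ => g ζ * ζ ^ m) (Metric.ball 0 1) := by
      have : DiffContOnCl ℂ (fun ζ : ℂ => ζ ^ m) (Metric.ball 0 1) :=
        (differentiable_pow m).diffContOnCl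
      exact hg.smul this
    have h1 := DiffContOnCl.circleIntegral_eq_zero zero_le_one hd
    simp only [circleIntegral, deriv_circleMap, hcm, smul_eq_mul] at h1
    have h2 : ∀ θ, ex θ * Complex.I * (g (ex θ) * ex θ ^ m) =
        Complex.I * (g (ex θ) * ex θ ^ (-a)) := by
      intro θ
      rw [hm]
      norm_cast
      ring
    simp only [h2] at h1
    rw [intervalIntegral.integral_const_mul] at h1
    rw [(mul_eq_zero.1 h1).resolve_left Complex.I_ne_zero, mul_zero]


variable {n : ℕ} {p : ℝ} {c : ℝ}

lemma continuous_Tm : Continuous (fun x : ℂ × (Fin n → ℂ) => Tm x.1 x.2) := by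
  unfold Tm; fun_prop

lemma differentiable_Tm_left (z : Fin n → ℂ) : Differentiable ℂ (fun ζ => Tm ζ z) := by
  unfold Tm; fun_prop

lemma differentiable_Tm_right (t : ℂ) : Differentiable ℂ (fun z : Fin n → ℂ => Tm t z) := by
  unfold Tm; fun_prop

lemma rho_Tm_lt (hp : 0 < p) {z : Fin n → ℂ} (hz : rho p z < c) {ζ : ℂ} (hζ : ‖ζ‖ ≤ 1) :
    rho p (Tm ζ z) < c := by
  rw [rho_Tm]
  refine lt_of_le_of_lt (mul_le_of_le_one_left (rho_nonneg p z) ?_) hz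
  exact Real.rpow_le_one (norm_nonneg _) hζ (by positivity)

lemma slice_Tm_diff {F : (Fin n → ℂ) → ℂ} (hF : DifferentiableOn ℂ F {z | rho p z < c})
    (z : Fin n → ℂ) : DifferentiableOn ℂ (fun ζ => F (Tm ζ z)) {ζ | rho p (Tm ζ z) < c} :=
  hF.comp (differentiable_Tm_left z).differentiableOn fun _ h => h

lemma slice_diffContOnCl (hp : 0 < p) {F : (Fin n → ℂ) → ℂ}
    (hF : DifferentiableOn ℂ F {z | rho p z < c}) {z : Fin n → ℂ} (hz : rho p z < c) :
    DiffContOnCl ℂ (fun ζ => F (Tm ζ z)) (Metric.ball 0 1) := by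
  apply DifferentiableOn.diffContOnCl
  rw [closure_ball _ one_ne_zero]
  refine (slice_Tm_diff hF z).mono fun ζ hζ => rho_Tm_lt hp hz (by simpa using hζ)

lemma wtZ_eq (hp : 0 < p) {F : (Fin n → ℂ) → ℂ} (hF : DifferentiableOn ℂ F {z | rho p z < c})
    (a : ℤ) {z : Fin n → ℂ} (hz : rho p z < c) :
    wtZ F a z = ((2 * Real.pi : ℝ) : ℂ)⁻¹ *
      ∫ θ in (0 : ℝ)..2 * Real.pi, F (Tm (ex θ) z) * (ex θ) ^ (-a) :=
  (circle_coeff (slice_diffContOnCl hp hF hz) a).symm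

lemma wtZ_natCast (F : (Fin n → ℂ) → ℂ) (m : ℕ) (z : Fin n → ℂ) : wtZ F m z = wt F m z := by
  simp [wtZ]

lemma wt_eq (hp : 0 < p) {F : (Fin n → ℂ) → ℂ} (hF : DifferentiableOn ℂ F {z | rho p z < c})
    (m : ℕ) {z : Fin n → ℂ} (hz : rho p z < c) :
    wt F m z = ((2 * Real.pi : ℝ) : ℂ)⁻¹ *
      ∫ θ in (0 : ℝ)..2 * Real.pi, F (Tm (ex θ) z) * (ex θ) ^ (-(m : ℤ)) := by
  rw [← wtZ_natCast, wtZ_eq hp hF m hz]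

lemma exists_scale (hp : 0 < p) (hc : 0 < c) (z : Fin n → ℂ) :
    ∃ t : ℝ, 0 < t ∧ rho p (Tm (t : ℂ) z) < c := by
  have h1 : Continuous (fun t : ℝ => rho p (Tm (t : ℂ) z)) :=
    (continuous_rho hp).comp (continuous_Tm.comp (by fun_prop : Continuous fun t : ℝ => ((t : ℂ), z)))
  have h2 : ∀ᶠ t : ℝ in nhds 0, rho p (Tm (t : ℂ) z) < c :=
    h1.continuousAt.eventually_lt continuousAt_const (by simp [Tm_zero, rho_zero hp, hc])
  have h3 : ∀ᶠ t : ℝ in nhdsWithin 0 (Set.Ioi 0), rho p (Tm (t : ℂ) z) < c :=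
    h2.filter_mono nhdsWithin_le_nhds
  obtain ⟨t, h, ht⟩ := (h3.and self_mem_nhdsWithin).exists
  exact ⟨t, ht, h⟩

lemma wt_differentiableOn (hp : 0 < p) {F : (Fin n → ℂ) → ℂ}
    (hF : DifferentiableOn ℂ F {z | rho p z < c}) (m : ℕ) :
    DifferentiableOn ℂ (wt F m) {z | rho p z < c} := by
  have h1 : DifferentiableOn ℂ (fun z => ∫ θ in (0 : ℝ)..2 * Real.pi,
      F (Tm (ex θ) z) * (ex θ) ^ (-(m : ℤ))) {z | rho p z < c} := by
    refine differentiableOn_param_integral (G := fun θ z => F (Tm (ex θ) z) * (ex θ) ^ (-(m : ℤ)))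
      (isOpen_rho_lt hp c) ?_ ?_ _ _
    · refine ContinuousOn.mul ?_ ?_
      · refine hF.continuousOn.comp (Continuous.continuousOn ?_) ?_
        · exact continuous_Tm.comp ((continuous_ex.comp continuous_fst).prodMk continuous_snd)
        · rintro ⟨θ, z⟩ ⟨-, hz⟩
          exact rho_Tm_lt hp hz (norm_ex θ).le
      · refine Continuous.continuousOn ?_
        exact (continuous_ex.comp continuous_fst).zpow₀ _ (fun x => Or.inl (ex_ne_zero _))
    · intro θ
      refine DifferentiableOn.mul_const ?_ _
      exact hF.comp (differentiable_Tm_right _).differentiableOn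
        fun z hz => rho_Tm_lt hp hz (norm_ex θ).le
  exact (h1.const_mul _).congr fun z hz => wt_eq hp hF m hz

lemma wt_differentiable (hp : 0 < p) (hc : 0 < c) {F : (Fin n → ℂ) → ℂ}
    (hF : DifferentiableOn ℂ F {z | rho p z < c}) (m : ℕ) : Differentiable ℂ (wt F m) := by
  intro z
  obtain ⟨t, ht, h⟩ := exists_scale hp hc z
  have ht' : (t : ℂ) ≠ 0 := by exact_mod_cast ht.ne'
  have h1 : wt F m = fun z => ((t : ℂ) ^ m)⁻¹ * wt F m (Tm t z) := by
    ext z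
    rw [wt_Tm, inv_mul_cancel_left₀ (pow_ne_zero _ ht')]
  rw [h1]
  refine DifferentiableAt.const_mul ?_ _
  have h2 : DifferentiableAt ℂ (wt F m) (Tm t z) :=
    (wt_differentiableOn hp hF m).differentiableAt ((isOpen_rho_lt hp c).mem_nhds h)
  exact h2.comp z (differentiable_Tm_right _ z)

lemma wtZ_differentiable (hp : 0 < p) (hc : 0 < c) {F : (Fin n → ℂ) → ℂ}
    (hF : DifferentiableOn ℂ F {z | rho p z < c}) (a : ℤ) : Differentiable ℂ (wtZ F a) := by
  unfold wtZ
  split_ifs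
  · exact wt_differentiable hp hc hF _
  · exact differentiable_const _

lemma wt_hasSum (hp : 0 < p) {F : (Fin n → ℂ) → ℂ}
    (hF : DifferentiableOn ℂ F {z | rho p z < c}) {z : Fin n → ℂ} (hz : rho p z < c) :
    HasSum (fun m => wt F m z) (F z) := by
  have hopen : IsOpen {ζ : ℂ | rho p (Tm ζ z) < c} :=
    (isOpen_rho_lt hp c).preimage (differentiable_Tm_left z).continuous
  obtain ⟨δ, hδ, hsub⟩ := (isCompact_closedBall (0 : ℂ) 1).exists_thickening_subset_open hopen
    (fun ζ hζ => rho_Tm_lt hp hz (by simpa using hζ))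
  rw [thickening_closedBall hδ zero_le_one] at hsub
  have h := Complex.hasSum_taylorSeries_on_ball (r := (δ + 1).toNNReal) (c := (0 : ℂ)) (z := 1)
    ((slice_Tm_diff hF z).mono (fun ζ hζ => hsub (by
      simpa [Real.coe_toNNReal _ (show (0 : ℝ) ≤ δ + 1 by linarith)] using hζ))) (by
      simp [Real.coe_toNNReal _ (show (0 : ℝ) ≤ δ + 1 by linarith)]; linarith)
  simp only [sub_zero, one_pow, Tm_one, smul_eq_mul] at h
  have h2 : (fun m => wt F m z) = fun m : ℕ => ((m.factorial : ℂ))⁻¹ * (1 * iteratedDeriv m (fun ζ => F (Tm ζ z)) 0) := by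
    ext m; simp [wt, div_eq_inv_mul]
  rw [h2]
  exact h

lemma orth (hp : 0 < p) {S : Set (Fin n → ℂ)} (hS : MeasurableSet S)
    (hSc : S ⊆ {z | rho p z < c}) (hinv : ∀ θ z, Tm (ex θ) z ∈ S ↔ z ∈ S)
    {h f : (Fin n → ℂ) → ℂ} (hh : DifferentiableOn ℂ h {z | rho p z < c}) {m : ℕ}
    (hf : ∀ t z, f (Tm t z) = t ^ m * f z) (hi : IntegrableOn (fun z => h z * star (f z)) S) :
    ∫ z in S, h z * star (f z) = ∫ z in S, wt h m z * star (f z) := by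
  rw [avg (fun k : Fin n => k.1 + 1) hS hinv hi]
  refine setIntegral_congr_fun hS fun z hz => ?_
  have h1 : ∀ θ, rot (fun k : Fin n => k.1 + 1) θ z = Tm (ex θ) z := fun θ => rfl
  have h2 : ∀ θ, star (ex θ) = (ex θ)⁻¹ := fun θ => by
    rw [Complex.inv_def]; simp [Complex.normSq_eq_norm_sq, norm_ex]
  rw [wt_eq hp hh m (hSc hz), mul_assoc, ← intervalIntegral.integral_mul_const]
  congr 1
  refine intervalIntegral.integral_congr fun θ _ => ?_
  simp only [h1, hf, star_mul, star_pow, h2, zpow_neg, zpow_natCast, inv_pow]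
  ring

lemma mean_value {f : (Fin n → ℂ) → ℂ} (hf : Differentiable ℂ f) (a : Fin n → ℂ) {ε : ℝ}
    {D : Set (Fin n → ℂ)} (hD : Metric.ball a ε ⊆ D) (hi : IntegrableOn (fun z => ‖f z‖ ^ 2) D) :
    ‖f a‖ ^ 2 * volume.real (Metric.ball (0 : Fin n → ℂ) ε) ≤ ∫ z in D, ‖f z‖ ^ 2 := by
  set S := Metric.ball (0 : Fin n → ℂ) ε with hS
  set g : (Fin n → ℂ) → ℂ := fun z => f (a + z) ^ 2 with hg
  have hgd : Differentiable ℂ g := by rw [hg]; fun_prop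
  have hinv : ∀ θ z, rot (fun _ : Fin n => 1) θ z ∈ S ↔ z ∈ S := by
    intro θ z
    have : rot (fun _ : Fin n => 1) θ z = ex θ • z := by ext k; simp [rot]
    simp [hS, this, norm_smul, norm_ex]
  have hgi : IntegrableOn g S :=
    (hgd.continuous.continuousOn.integrableOn_compact (isCompact_closedBall 0 ε)).mono_set
      Metric.ball_subset_closedBall
  have h1 := avg (fun _ : Fin n => 1) measurableSet_ball hinv hgi
  have h2 : ∀ z, ((2 * Real.pi : ℝ) : ℂ)⁻¹ * ∫ θ in (0 : ℝ)..2 * Real.pi,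
      g (rot (fun _ : Fin n => 1) θ z) = f a ^ 2 := by
    intro z
    have hd : Differentiable ℂ (fun ζ : ℂ => g (ζ • z)) := by fun_prop
    have := circle_coeff (hd.diffContOnCl (s := Metric.ball 0 1)) 0
    simp only [neg_zero, zpow_zero, mul_one, le_refl, if_true, Int.toNat_zero, iteratedDeriv_zero,
      zero_smul, Nat.factorial_zero, Nat.cast_one, div_one] at this
    have h3 : ∀ θ, rot (fun _ : Fin n => 1) θ z = ex θ • z := by intro θ; ext k; simp [rot]
    simp only [h3]
    rw [this]; simp [hg]
  simp only [h2] at h1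
  rw [setIntegral_const] at h1
  have h3 : ‖∫ z in S, g z‖ ≤ ∫ z in S, ‖g z‖ := norm_integral_le_integral_norm _
  rw [h1, norm_smul, norm_pow, Real.norm_of_nonneg measureReal_nonneg, mul_comm] at h3
  refine h3.trans ?_
  have h4 : ∫ z in S, ‖g z‖ = ∫ z in Metric.ball a ε, ‖f z‖ ^ 2 := by
    have hmp := measurePreserving_add_left (volume : Measure (Fin n → ℂ)) a
    have h5 := hmp.setIntegral_preimage_emb (MeasurableEquiv.addLeft a).measurableEmbedding
      (fun z => ‖f z‖ ^ 2) (Metric.ball a ε)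
    have h6 : (fun z => a + z) ⁻¹' Metric.ball a ε = S := by ext z; simp [hS]
    rw [h6] at h5
    rw [← h5]
    simp [hg]
  rw [h4]
  exact setIntegral_mono_set hi (Filter.Eventually.of_forall fun z => by positivity)
    hD.eventuallyLE

end S2

section S4
open MeasureTheory

variable {n : ℕ} {p : ℝ}

/-- complex Jacobian determinant -/
noncomputable def Jac (φ : (Fin n → ℂ) → (Fin n → ℂ)) (z : Fin n → ℂ) : ℂ := (fderiv ℂ φ z).det

lemma differentiableOn_prod_holo {V ι : Type*} [NormedAddCommGroup V] [NormedSpace ℂ V] {U : Set V}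
    {f : ι → V → ℂ} (s : Finset ι) (h : ∀ i, DifferentiableOn ℂ (f i) U) :
    DifferentiableOn ℂ (fun x => ∏ i ∈ s, f i x) U := by
  classical
  induction s using Finset.induction_on with
  | empty => simp
  | insert a s ha ih => simpa only [Finset.prod_insert ha] using (h a).fun_mul ih

lemma Jac_differentiableOn {U : Set (Fin n → ℂ)} (hU : IsOpen U) {φ : (Fin n → ℂ) → (Fin n → ℂ)}
    (hφ : DifferentiableOn ℂ φ U) : DifferentiableOn ℂ (Jac φ) U := by
  have h1 : ∀ z ∈ U, Jac φ z = ∑ σ : Equiv.Perm (Fin n), Equiv.Perm.sign σ •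
      ∏ i, fderiv ℂ (fun z => φ z (σ i)) z (Pi.single i 1) := by
    intro z hz
    have hd := hφ.differentiableAt (hU.mem_nhds hz)
    unfold Jac
    rw [ContinuousLinearMap.det, ← LinearMap.det_toMatrix', Matrix.det_apply]
    refine Finset.sum_congr rfl fun σ _ => ?_
    congr 1
    refine Finset.prod_congr rfl fun i _ => ?_
    rw [LinearMap.toMatrix'_apply]
    rw [(hasFDerivAt_pi'.1 hd.hasFDerivAt (σ i)).fderiv]
    simp
  refine DifferentiableOn.congr ?_ h1
  refine DifferentiableOn.fun_sum fun σ _ => ?_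
  refine DifferentiableOn.const_smul ?_ _
  refine differentiableOn_prod_holo _ fun i => ?_
  refine differentiableOn_fderiv_apply hU ?_ _
  exact differentiableOn_pi.1 hφ _

lemma realDet (A : (Fin n → ℂ) →L[ℂ] (Fin n → ℂ)) :
    (A.restrictScalars ℝ).det = ‖A.det‖ ^ 2 := by
  have h := LinearMap.det_restrictScalars (R := ℝ) (f := (A : (Fin n → ℂ) →ₗ[ℂ] (Fin n → ℂ)))
  have h2 : (A.restrictScalars ℝ).det = LinearMap.det ((A : (Fin n → ℂ) →ₗ[ℂ] (Fin n → ℂ)).restrictScalars ℝ) := rfl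
  rw [h2, h, Algebra.norm_complex_apply, Complex.normSq_eq_norm_sq]

lemma cov {s : Set (Fin n → ℂ)} (hs : IsOpen s) {f : (Fin n → ℂ) → (Fin n → ℂ)}
    (hf : DifferentiableOn ℂ f s) (hinj : Set.InjOn f s) (g : (Fin n → ℂ) → ℂ) :
    ∫ z in f '' s, g z = ∫ z in s, ((‖Jac f z‖ ^ 2 : ℝ) : ℂ) * g (f z) := by
  have h := integral_image_eq_integral_abs_det_fderiv_smul (μ := volume) (s := s) (f := f)
    (f' := fun z => (fderiv ℂ f z).restrictScalars ℝ) hs.measurableSet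
    (fun z hz => ((hf.differentiableAt (hs.mem_nhds hz)).hasFDerivAt.restrictScalars ℝ).hasFDerivWithinAt) hinj g
  rw [h]
  refine setIntegral_congr_fun hs.measurableSet fun z hz => ?_
  simp only [realDet, abs_of_nonneg (sq_nonneg ‖(fderiv ℂ f z).det‖), Complex.real_smul]
  rfl

lemma cov_integrable {s : Set (Fin n → ℂ)} (hs : IsOpen s) {f : (Fin n → ℂ) → (Fin n → ℂ)}
    (hf : DifferentiableOn ℂ f s) (hinj : Set.InjOn f s) (g : (Fin n → ℂ) → ℝ) :
    IntegrableOn g (f '' s) ↔ IntegrableOn (fun z => ‖Jac f z‖ ^ 2 * g (f z)) s := by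
  have h := integrableOn_image_iff_integrableOn_abs_det_fderiv_smul (μ := volume) (s := s) (f := f)
    (f' := fun z => (fderiv ℂ f z).restrictScalars ℝ) hs.measurableSet
    (fun z hz => ((hf.differentiableAt (hs.mem_nhds hz)).hasFDerivAt.restrictScalars ℝ).hasFDerivWithinAt) hinj g
  rw [h]
  simp only [realDet, abs_of_nonneg (sq_nonneg ‖_‖), smul_eq_mul]
  rfl

/-- A pair of mutually inverse automorphisms -/
structure AutPair (p : ℝ) (φ ψ : (Fin n → ℂ) → (Fin n → ℂ)) : Prop where
  dφ : DifferentiableOn ℂ φ {z | rho p z < 1}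
  dψ : DifferentiableOn ℂ ψ {z | rho p z < 1}
  mφ : ∀ z, rho p z < 1 → rho p (φ z) < 1
  mψ : ∀ z, rho p z < 1 → rho p (ψ z) < 1
  l : ∀ z, rho p z < 1 → ψ (φ z) = z
  r : ∀ z, rho p z < 1 → φ (ψ z) = z

variable {φ ψ : (Fin n → ℂ) → (Fin n → ℂ)}

lemma AutPair.symm (h : AutPair p φ ψ) : AutPair p ψ φ := ⟨h.dψ, h.dφ, h.mψ, h.mφ, h.r, h.l⟩

lemma AutPair.injOn (h : AutPair p φ ψ) : Set.InjOn φ {z | rho p z < 1} := by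
  intro a ha b hb hab
  rw [← h.l a ha, ← h.l b hb, hab]

lemma AutPair.image (h : AutPair p φ ψ) : φ '' {z | rho p z < 1} = {z | rho p z < 1} := by
  ext z
  constructor
  · rintro ⟨w, hw, rfl⟩; exact h.mφ w hw
  · intro hz; exact ⟨ψ z, h.mψ z hz, h.r z hz⟩

lemma AutPair.jac (hp : 0 < p) (h : AutPair p φ ψ) {z : Fin n → ℂ} (hz : rho p z < 1) :
    Jac φ (ψ z) * Jac ψ z = 1 := by
  have hD := isOpen_rho_lt (n := n) hp 1
  have h1 := (h.dφ.differentiableAt (hD.mem_nhds (h.mψ z hz))).hasFDerivAt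
  have h2 := (h.dψ.differentiableAt (hD.mem_nhds hz)).hasFDerivAt
  have h3 := h1.comp z h2
  have h4 : HasFDerivAt (φ ∘ ψ) (ContinuousLinearMap.id ℂ (Fin n → ℂ)) z := by
    refine (hasFDerivAt_id z).congr_of_eventuallyEq ?_
    filter_upwards [hD.mem_nhds hz] with w hw using h.r w hw
  have h5 := h3.unique h4
  have h6 := congrArg ContinuousLinearMap.det h5
  unfold Jac
  have h7 : (ContinuousLinearMap.id ℂ (Fin n → ℂ)).det = 1 := LinearMap.det_id
  rw [← h7, ← h6]
  exact (LinearMap.det_comp _ _).symm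

lemma volume_D_lt_top (hp : 0 < p) : volume {z : Fin n → ℂ | rho p z < 1} < ⊤ :=
  (measure_mono (fun z (hz : rho p z < 1) => hz.le)).trans_lt (isCompact_rho_le hp 1).measure_lt_top

lemma AutPair.jac_sq_integrable (hp : 0 < p) (h : AutPair p φ ψ) :
    IntegrableOn (fun z => ‖Jac φ z‖ ^ 2) {z | rho p z < 1} := by
  have h1 := (cov_integrable (isOpen_rho_lt hp 1) h.dφ h.injOn (fun _ => (1 : ℝ))).1
    (by rw [h.image]; exact integrableOn_const (volume_D_lt_top hp).ne)
  simpa using h1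

lemma AutPair.jac_mul_integrable (hp : 0 < p) (h : AutPair p φ ψ) {g : (Fin n → ℂ) → ℂ}
    (hg : ContinuousOn g {z | rho p z < 1}) {B : ℝ} (hB : ∀ z, rho p z < 1 → ‖g z‖ ≤ B) :
    IntegrableOn (fun z => Jac φ z * g z) {z | rho p z < 1} := by
  have hD := isOpen_rho_lt (n := n) hp 1
  have hJ := (Jac_differentiableOn hD h.dφ).continuousOn
  have h1 : IntegrableOn (fun z => (1 + ‖Jac φ z‖ ^ 2) * B) {z | rho p z < 1} :=
    ((integrableOn_const (volume_D_lt_top hp).ne).add (h.jac_sq_integrable hp)).mul_const B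
  refine Integrable.mono' h1 ((hJ.mul hg).aestronglyMeasurable hD.measurableSet) ?_
  refine (ae_restrict_iff' hD.measurableSet).2 (Filter.Eventually.of_forall fun z hz => ?_)
  rw [norm_mul]
  have h2 := hB z hz
  have h3 : ‖Jac φ z‖ ≤ 1 + ‖Jac φ z‖ ^ 2 := by nlinarith [sq_nonneg (‖Jac φ z‖ - 1), norm_nonneg (Jac φ z)]
  gcongr

lemma continuous_Tm_right (t : ℂ) : Continuous (fun z : Fin n → ℂ => Tm t z) :=
  (differentiable_Tm_right t).continuous

lemma Tm_inv {t : ℂ} (ht : t ≠ 0) (z : Fin n → ℂ) : Tm t (Tm t⁻¹ z) = z := by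
  rw [Tm_mul, mul_inv_cancel₀ ht, Tm_one]

lemma Jac_Tm (t : ℂ) (ht : t ≠ 0) : ∃ C : ℝ, 0 < C ∧ ∀ z : Fin n → ℂ, ‖Jac (Tm t) z‖ ^ 2 = C := by
  let L : ℂ → (Fin n → ℂ) →L[ℂ] (Fin n → ℂ) := fun t => ContinuousLinearMap.pi fun k =>
    (t ^ (k.1 + 1)) • ContinuousLinearMap.proj k
  have hL : ∀ t z, L t z = Tm t z := fun t z => by ext k; simp [L, Tm]
  have h1 : ∀ z : Fin n → ℂ, Jac (Tm t) z = (L t).det := by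
    intro z
    unfold Jac
    have : (Tm t : (Fin n → ℂ) → (Fin n → ℂ)) = L t := by ext1 z; rw [hL]
    rw [this, ContinuousLinearMap.fderiv]
  have h2 : (L t).det * (L t⁻¹).det = 1 := by
    have h3 : (L t).comp (L t⁻¹) = ContinuousLinearMap.id ℂ _ := by
      ext1 z; simp only [ContinuousLinearMap.comp_apply, hL, Tm_inv ht, ContinuousLinearMap.id_apply]
    have h7 : (ContinuousLinearMap.id ℂ (Fin n → ℂ)).det = 1 := LinearMap.det_id
    rw [← h7, ← h3]
    exact (LinearMap.det_comp _ _).symm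
  refine ⟨‖(L t).det‖ ^ 2, ?_, fun z => by rw [h1]⟩
  have : (L t).det ≠ 0 := left_ne_zero_of_mul_eq_one h2
  positivity

lemma Tm_image {t : ℝ} (ht : 0 < t) :
    Tm (t : ℂ) '' {z : Fin n → ℂ | rho p z < 1} = {z | rho p z < t ^ (2 * p)} := by
  have ht' : (t : ℂ) ≠ 0 := by exact_mod_cast ht.ne'
  have h0 : 0 < t ^ (2 * p) := Real.rpow_pos_of_pos ht _
  ext z
  constructor
  · rintro ⟨w, hw, rfl⟩
    have hw' : rho p w < 1 := hw
    show rho p _ < _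
    rw [rho_Tm, Complex.norm_real, Real.norm_of_nonneg ht.le]
    exact mul_lt_of_lt_one_right h0 hw'
  · intro hz
    refine ⟨Tm (t : ℂ)⁻¹ z, ?_, Tm_inv ht' z⟩
    have hz' : rho p z < t ^ (2 * p) := hz
    show rho p _ < _
    rw [rho_Tm, norm_inv, Complex.norm_real, Real.norm_of_nonneg ht.le, Real.inv_rpow ht.le,
      inv_mul_lt_iff₀ h0, mul_one]
    exact hz'

lemma scale_integral (hp : 0 < p) {t : ℝ} (ht : 0 < t) (k : ℕ) :
    ∃ C : ℝ, 0 < C ∧ ∀ G : (Fin n → ℂ) → ℂ, (∀ z, G (Tm t z) = (t : ℂ) ^ (2 * k) * G z) →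
      ∫ z in {z | rho p z < t ^ (2 * p)}, G z = C * ∫ z in {z | rho p z < 1}, G z := by
  have ht' : (t : ℂ) ≠ 0 := by exact_mod_cast ht.ne'
  obtain ⟨C, hC, hJ⟩ := Jac_Tm (n := n) t ht'
  refine ⟨C * t ^ (2 * k), by positivity, fun G hG => ?_⟩
  rw [← Tm_image ht, cov (isOpen_rho_lt hp 1) (differentiable_Tm_right _).differentiableOn]
  · simp only [hJ, hG]
    rw [← integral_const_mul]
    push_cast
    simp only [mul_assoc]
  · intro a _ b _ hab
    have := congrArg (Tm (t : ℂ)⁻¹) hab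
    simpa [Tm_mul, inv_mul_cancel₀ ht', Tm_one] using this

end S4

section S4b
open MeasureTheory
variable {n : ℕ} {p : ℝ} {φ ψ : (Fin n → ℂ) → (Fin n → ℂ)}

lemma exists_radius_lt_one (hp : 0 < p) {b : ℝ} (hb : b < 1) :
    ∃ r : ℝ, 0 < r ∧ r < 1 ∧ b ≤ r ^ (2 * p) := by
  have h0 : 0 < max b (1 / 2) := by positivity
  have h1 : max b (1 / 2) < 1 := max_lt hb (by norm_num)
  refine ⟨(max b (1 / 2)) ^ (1 / (2 * p)), Real.rpow_pos_of_pos h0 _,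
    Real.rpow_lt_one h0.le h1 (by positivity), ?_⟩
  rw [← Real.rpow_mul h0.le, one_div_mul_cancel (by positivity), Real.rpow_one]
  exact le_max_left _ _

/-- a weight function on `{ρ ≤ r^(2p)}` is bounded by `r^m` times its bound on `{ρ ≤ 1}` -/
lemma weight_bound {f : (Fin n → ℂ) → ℂ} {m : ℕ} (hf : ∀ t z, f (Tm t z) = t ^ m * f z)
    {M : ℝ} (hM : ∀ z, rho p z ≤ 1 → ‖f z‖ ≤ M) {r : ℝ} (hr : 0 < r) {z : Fin n → ℂ}
    (hz : rho p z ≤ r ^ (2 * p)) : ‖f z‖ ≤ r ^ m * M := by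
  have hr' : (r : ℂ) ≠ 0 := by exact_mod_cast hr.ne'
  rw [← Tm_inv hr' z, hf, norm_mul, norm_pow, Complex.norm_real, Real.norm_of_nonneg hr.le]
  refine mul_le_mul_of_nonneg_left (hM _ ?_) (by positivity)
  rw [rho_Tm, norm_inv, Complex.norm_real, Real.norm_of_nonneg hr.le, Real.inv_rpow hr.le,
    inv_mul_le_iff₀ (Real.rpow_pos_of_pos hr _), mul_one]
  exact hz

lemma key_est (hp : 0 < p) (h : AutPair p φ ψ) {q : (Fin n → ℂ) → ℂ} (hq : Differentiable ℂ q)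
    {k : ℕ} (hqk : ∀ t z, q (Tm t z) = t ^ k * q z) :
    ∃ C r : ℝ, 0 ≤ C ∧ 0 < r ∧ r < 1 ∧ ∀ (m : ℕ) (M : ℝ),
      (∀ z, rho p z ≤ 1 → ‖wt (fun z => Jac φ z * q (φ z)) m z‖ ≤ M) →
      ∫ z in {z | rho p z < 1}, ‖wt (fun z => Jac φ z * q (φ z)) m z‖ ^ 2 ≤ C * r ^ m * M := by
  have hD := isOpen_rho_lt (n := n) hp 1
  set F : (Fin n → ℂ) → ℂ := fun z => Jac φ z * q (φ z) with hF
  have hFd : DifferentiableOn ℂ F {z | rho p z < 1} :=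
    (Jac_differentiableOn hD h.dφ).mul (hq.comp_differentiableOn h.dφ)
  obtain ⟨B, hB⟩ := (isCompact_rho_le (n := n) hp 1).exists_bound_of_continuousOn hq.continuous.continuousOn
  have hB0 : 0 ≤ B := (norm_nonneg _).trans (hB 0 (by simp [rho_zero hp]))
  set s : ℝ := (1 / 2 : ℝ) ^ (2 * p) with hs
  have hs0 : 0 < s := Real.rpow_pos_of_pos (by norm_num) _
  have hs1 : s < 1 := Real.rpow_lt_one (by norm_num) (by norm_num) (by positivity)
  obtain ⟨y, hy, hymax⟩ := (isCompact_rho_le (n := n) hp s).exists_isMaxOn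
    (f := fun z => rho p (ψ z)) ⟨0, by simp [rho_zero hp, hs0.le]⟩
    ((continuous_rho hp).comp_continuousOn (h.dψ.continuousOn.mono fun z (hz : rho p z ≤ s) => lt_of_le_of_lt hz hs1))
  obtain ⟨r, hr0, hr1, hr⟩ := exists_radius_lt_one hp (h.mψ y (lt_of_le_of_lt hy hs1))
  have hψr : ∀ z, rho p z ≤ s → rho p (ψ z) ≤ r ^ (2 * p) := fun z hz => (hymax hz).trans hr
  obtain ⟨Cs, hCs, hscale⟩ := scale_integral (n := n) hp (t := 1 / 2) (by norm_num) k
  have hJi : IntegrableOn (fun z => Jac ψ z) {z | rho p z < 1} := by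
    have := h.symm.jac_mul_integrable hp (g := fun _ => 1) continuousOn_const (B := 1) (by simp)
    simpa using this
  refine ⟨Cs⁻¹ * (B * ∫ z in {z | rho p z < 1}, ‖Jac ψ z‖), r, ?_, hr0, hr1, ?_⟩
  · have : 0 ≤ ∫ z in {z | rho p z < 1}, ‖Jac ψ z‖ := integral_nonneg fun z => norm_nonneg _
    positivity
  intro m M hM
  have hM0 : 0 ≤ M := (norm_nonneg _).trans (hM 0 (by simp [rho_zero hp]))
  set f : (Fin n → ℂ) → ℂ := wt F m with hf
  have hfd : Differentiable ℂ f := wt_differentiable hp one_pos hFd m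
  have hfw : ∀ t z, f (Tm t z) = t ^ m * f z := fun t z => wt_Tm F m t z
  have hinv : ∀ c : ℝ, ∀ θ z, Tm (ex θ) z ∈ {z : Fin n → ℂ | rho p z < c} ↔ z ∈ {z | rho p z < c} := by
    intro c θ z
    show rho p _ < c ↔ rho p _ < c
    rw [rho_Tm_of_norm_one p (norm_ex θ)]
  -- step 1
  have e1 : ((∫ z in {z | rho p z < 1}, ‖f z‖ ^ 2 : ℝ) : ℂ) = ∫ z in {z | rho p z < 1}, F z * star (f z) := by
    rw [orth hp hD.measurableSet le_rfl (hinv 1) hFd hfw]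
    · rw [← integral_complex_ofReal]
      refine setIntegral_congr_fun hD.measurableSet fun z _ => ?_
      show ((‖f z‖ ^ 2 : ℝ) : ℂ) = f z * star (f z)
      have := Complex.mul_conj (f z)
      rw [Complex.star_def, this, Complex.normSq_eq_norm_sq]
    · have := h.jac_mul_integrable hp (g := fun z => q (φ z) * star (f z)) (B := B * M)
        ((hq.continuous.comp_continuousOn h.dφ.continuousOn).mul
          (hfd.continuous.star.continuousOn)) (fun z hz => by
            rw [norm_mul, norm_star]
            exact mul_le_mul (hB _ (h.mφ z hz).le) (hM z hz.le) (norm_nonneg _) hB0)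
      simpa only [hF, mul_assoc] using this
  -- step 2
  set hh : (Fin n → ℂ) → ℂ := fun z => Jac ψ z * f (ψ z) with hhh
  have hhd : DifferentiableOn ℂ hh {z | rho p z < 1} :=
    (Jac_differentiableOn hD h.dψ).mul (hfd.comp_differentiableOn h.dψ)
  have e2 : ∫ z in {z | rho p z < 1}, F z * star (f z) =
      star (∫ z in {z | rho p z < 1}, hh z * star (q z)) := by
    conv_lhs => rw [← h.symm.image]
    rw [cov hD h.dψ h.symm.injOn]
    rw [Complex.star_def, ← integral_conj]
    refine setIntegral_congr_fun hD.measurableSet fun z hz => ?_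
    have hj := h.jac hp hz
    have hn : ((‖Jac ψ z‖ ^ 2 : ℝ) : ℂ) = Jac ψ z * star (Jac ψ z) := by
      rw [Complex.star_def, Complex.mul_conj, Complex.normSq_eq_norm_sq]
    simp only [hF, hhh, hn, h.r z hz, map_mul, Complex.star_def, Complex.conj_conj]
    linear_combination ((starRingEnd ℂ) (Jac ψ z) * (starRingEnd ℂ) (f (ψ z)) * q z) * hj
  have hhq : IntegrableOn (fun z => hh z * star (q z)) {z | rho p z < 1} := by
    have := h.symm.jac_mul_integrable hp (g := fun z => f (ψ z) * star (q z)) (B := M * B)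
      ((hfd.continuous.comp_continuousOn h.dψ.continuousOn).mul
        (hq.continuous.star.continuousOn)) (fun z hz => by
          rw [norm_mul, norm_star]
          exact mul_le_mul (hM _ (h.mψ z hz).le) (hB z hz.le) (norm_nonneg _) hM0)
    simpa only [hhh, mul_assoc] using this
  have hsub : {z : Fin n → ℂ | rho p z < s} ⊆ {z | rho p z < 1} := fun z hz => lt_trans hz hs1
  have e3 := orth hp hD.measurableSet le_rfl (hinv 1) hhd hqk hhq
  have e4 := orth hp (isOpen_rho_lt hp s).measurableSet hsub (hinv s) hhd hqk (hhq.mono_set hsub)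
  have e5 := hscale (fun z => wt hh k z * star (q z)) (fun z => by
    rw [wt_Tm, hqk, star_mul, star_pow, Complex.star_def, Complex.conj_ofReal]; ring)
  have e6 : ∫ z in {z | rho p z < s}, hh z * star (q z) = Cs * ∫ z in {z | rho p z < 1}, hh z * star (q z) := by
    rw [e4, e3]; exact e5
  have e7 : ‖∫ z in {z | rho p z < s}, hh z * star (q z)‖ ≤
      (r ^ m * M * B) * ∫ z in {z | rho p z < 1}, ‖Jac ψ z‖ := by
    have a1 : ‖∫ z in {z | rho p z < s}, hh z * star (q z)‖ ≤
        ∫ z in {z | rho p z < s}, (r ^ m * M * B) * ‖Jac ψ z‖ := by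
      refine norm_integral_le_of_norm_le ((hJi.mono_set hsub).norm.const_mul _) ?_
      refine (ae_restrict_iff' (isOpen_rho_lt hp s).measurableSet).2
        (Filter.Eventually.of_forall fun z hz => ?_)
      have b1 : ‖f (ψ z)‖ ≤ r ^ m * M := weight_bound hfw hM hr0 (hψr z (le_of_lt hz))
      have b2 : ‖q z‖ ≤ B := hB z (show rho p z ≤ 1 from le_of_lt (show rho p z < 1 from hsub hz))
      simp only [hhh, norm_mul, norm_star]
      calc ‖Jac ψ z‖ * ‖f (ψ z)‖ * ‖q z‖ ≤ ‖Jac ψ z‖ * (r ^ m * M) * B := by gcongr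
        _ = _ := by ring
    rw [integral_const_mul] at a1
    refine a1.trans (mul_le_mul_of_nonneg_left ?_ (by positivity))
    exact setIntegral_mono_set hJi.norm (Filter.Eventually.of_forall fun z => norm_nonneg _)
      hsub.eventuallyLE
  have e8 : ‖∫ z in {z | rho p z < 1}, hh z * star (q z)‖ = ∫ z in {z | rho p z < 1}, ‖f z‖ ^ 2 := by
    have a1 : 0 ≤ ∫ z in {z | rho p z < 1}, ‖f z‖ ^ 2 := integral_nonneg fun z => by positivity
    rw [← norm_star, ← e2, ← e1, Complex.norm_real, Real.norm_of_nonneg a1]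
  rw [e6, norm_mul, e8, Complex.norm_real, Real.norm_of_nonneg hCs.le] at e7
  rw [← mul_le_mul_iff_right₀ hCs]
  refine e7.trans (le_of_eq ?_)
  field_simp

lemma exists_extension (hp : 0 < p) (h : AutPair p φ ψ) {q : (Fin n → ℂ) → ℂ} (hq : Differentiable ℂ q)
    {k : ℕ} (hqk : ∀ t z, q (Tm t z) = t ^ k * q z) :
    ∃ (c : ℝ) (G : (Fin n → ℂ) → ℂ), 1 < c ∧ DifferentiableOn ℂ G {z | rho p z < c} ∧
      ∀ z, rho p z < 1 → G z = Jac φ z * q (φ z) := by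
  have hD := isOpen_rho_lt (n := n) hp 1
  obtain ⟨C, r, hC, hr0, hr1, hest⟩ := key_est hp h hq hqk
  set F : (Fin n → ℂ) → ℂ := fun z => Jac φ z * q (φ z) with hF
  have hFd : DifferentiableOn ℂ F {z | rho p z < 1} :=
    (Jac_differentiableOn hD h.dφ).mul (hq.comp_differentiableOn h.dφ)
  obtain ⟨t, ht1, ht2⟩ := exists_between hr1
  set s := Real.sqrt t with hs
  have ht0 : 0 < t := hr0.trans ht1
  have hs0 : 0 < s := Real.sqrt_pos.2 ht0
  have hs1 : s < 1 := by rw [hs, Real.sqrt_lt' one_pos]; simpa using ht2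
  have hss : s ^ 2 = t := Real.sq_sqrt ht0.le
  have hsp1 : s ^ (2 * p) < 1 := Real.rpow_lt_one hs0.le hs1 (by positivity)
  obtain ⟨ε, hε, hth⟩ := (isCompact_rho_le (n := n) hp (s ^ (2 * p))).exists_thickening_subset_open hD
    (fun z hz => lt_of_le_of_lt hz hsp1)
  set v := volume.real (Metric.ball (0 : Fin n → ℂ) ε) with hv
  have hv0 : 0 < v := by
    rw [hv, Measure.real]
    exact ENNReal.toReal_pos (Metric.measure_ball_pos volume _ hε).ne' measure_ball_lt_top.ne
  set κ := r / t with hκ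
  have hκ0 : 0 < κ := by positivity
  have hκ1 : κ < 1 := (div_lt_one ht0).2 ht1
  have bound : ∀ m z, rho p z ≤ 1 → ‖wt F m z‖ ≤ C / v * κ ^ m := by
    intro m
    have hfd : Differentiable ℂ (wt F m) := wt_differentiable hp one_pos hFd m
    obtain ⟨y, hy, hymax⟩ := (isCompact_rho_le (n := n) hp 1).exists_isMaxOn
      ⟨0, by simp [rho_zero hp]⟩ hfd.continuous.norm.continuousOn
    have hy' : rho p y ≤ 1 := hy
    set M := ‖wt F m y‖ with hM
    have hMb : ∀ z, rho p z ≤ 1 → ‖wt F m z‖ ≤ M := fun z hz => hymax hz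
    suffices hfin : M ≤ C / v * κ ^ m from fun z hz => (hMb z hz).trans hfin
    have h1 := hest m M hMb
    have hi : IntegrableOn (fun z => ‖wt F m z‖ ^ 2) {z | rho p z < 1} :=
      ((hfd.continuous.norm.pow 2).continuousOn.integrableOn_compact (isCompact_rho_le hp 1)).mono_set
        (fun z hz => show rho p z ≤ 1 from le_of_lt (show rho p z < 1 from hz))
    have hmem : rho p (Tm (s : ℂ) y) ≤ s ^ (2 * p) := by
      rw [rho_Tm, Complex.norm_real, Real.norm_of_nonneg hs0.le]
      exact mul_le_of_le_one_right (by positivity) hy'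
    have h2 := mean_value hfd (Tm (s : ℂ) y) (ε := ε) (D := {z | rho p z < 1})
      (fun w hw => hth (Metric.mem_thickening_iff.2 ⟨_, hmem, hw⟩)) hi
    rw [wt_Tm, norm_mul, norm_pow, Complex.norm_real, Real.norm_of_nonneg hs0.le, ← hM] at h2
    have h3 : t ^ m * M ^ 2 * v ≤ C * r ^ m * M := by
      refine le_trans (le_of_eq ?_) (h2.trans h1)
      rw [← hss]; ring
    rcases (norm_nonneg (wt F m y)).eq_or_lt with h0 | h0
    · rw [hM, ← h0]; positivity
    · rw [← hM] at h0
      have h4 : t ^ m * v * M ≤ C * r ^ m := by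
        refine le_of_mul_le_mul_right ?_ h0
        linarith
      rw [hκ, div_pow, div_mul_div_comm, le_div_iff₀ (by positivity)]
      linarith
  set R := (1 + κ⁻¹) / 2 with hR
  have hκi : 1 < κ⁻¹ := (one_lt_inv₀ hκ0).2 hκ1
  have hR1 : 1 < R := by rw [hR]; linarith
  have hRκ : R * κ < 1 := by
    have : R < κ⁻¹ := by rw [hR]; linarith
    calc R * κ < κ⁻¹ * κ := by gcongr
      _ = 1 := inv_mul_cancel₀ hκ0.ne'
  refine ⟨R ^ (2 * p), fun z => ∑' m, wt F m z, Real.one_lt_rpow hR1 (by positivity), ?_, ?_⟩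
  · have hRκ0 : 0 ≤ R * κ := by positivity
    refine differentiableOn_tsum_holo (u := fun m => C / v * (R * κ) ^ m) (isOpen_rho_lt hp _)
      ((summable_geometric_of_lt_one hRκ0 hRκ).mul_left _)
      (fun m => (wt_differentiable hp one_pos hFd m).differentiableOn) ?_
    intro m z hz
    refine (weight_bound (wt_Tm F m) (bound m) (by linarith : 0 < R) (le_of_lt hz)).trans (le_of_eq ?_)
    rw [mul_pow]; ring
  · intro z hz
    exact (wt_hasSum hp hFd hz).tsum_eq

end S4b

section S4c
variable {n : ℕ} {p : ℝ} {φ ψ : (Fin n → ℂ) → (Fin n → ℂ)}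

lemma exists_rho_lt_subset (hp : 0 < p) {V : Set (Fin n → ℂ)} (hV : IsOpen V)
    (h : ∀ z, rho p z ≤ 1 → z ∈ V) : ∃ c : ℝ, 1 < c ∧ ∀ z, rho p z < c → z ∈ V := by
  have hK : IsCompact ({z : Fin n → ℂ | rho p z ≤ 2} \ V) := (isCompact_rho_le hp 2).diff hV
  rcases ({z : Fin n → ℂ | rho p z ≤ 2} \ V).eq_empty_or_nonempty with he | hne
  · refine ⟨2, by norm_num, fun z hz => ?_⟩
    by_contra hc
    have : z ∈ ({z : Fin n → ℂ | rho p z ≤ 2} \ V) := ⟨hz.le, hc⟩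
    rw [he] at this; exact this
  · obtain ⟨y, hy, hmin⟩ := hK.exists_isMinOn hne (continuous_rho hp).continuousOn
    have hy1 : 1 < rho p y := by
      by_contra hc; exact hy.2 (h y (not_lt.1 hc))
    have hy2 : rho p y ≤ 2 := hy.1
    refine ⟨rho p y, hy1, fun z hz => ?_⟩
    by_contra hc
    have : rho p y ≤ rho p z := hmin (show z ∈ ({z : Fin n → ℂ | rho p z ≤ 2} \ V) from ⟨hz.le.trans hy2, hc⟩)
    linarith

lemma tendsto_Tm_one (z : Fin n → ℂ) :
    Filter.Tendsto (fun t : ℝ => Tm (t : ℂ) z) (nhdsWithin 1 (Set.Iio 1)) (nhds z) := by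
  have h1 : Continuous (fun t : ℝ => Tm (t : ℂ) z) := (differentiable_Tm_left z).continuous.comp Complex.continuous_ofReal
  have h2 := h1.tendsto 1
  simp only [Complex.ofReal_one, Tm_one] at h2
  exact h2.mono_left nhdsWithin_le_nhds

lemma eventually_Tm_mem (hp : 0 < p) {z : Fin n → ℂ} (hz : rho p z ≤ 1) :
    ∀ᶠ t : ℝ in nhdsWithin 1 (Set.Iio 1), rho p (Tm (t : ℂ) z) < 1 := by
  have h1 : ∀ᶠ t : ℝ in nhdsWithin 1 (Set.Iio 1), 0 < t :=
    nhdsWithin_le_nhds (Ioi_mem_nhds zero_lt_one)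
  filter_upwards [h1, self_mem_nhdsWithin] with t ht0 ht1
  rw [rho_Tm, Complex.norm_real, Real.norm_of_nonneg ht0.le]
  have : t ^ (2 * p) < 1 := Real.rpow_lt_one ht0.le ht1 (by positivity)
  have h0 := rho_nonneg p z
  have h3 := Real.rpow_nonneg ht0.le (2 * p)
  nlinarith

lemma differentiableOn_div_holo {V : Type*} [NormedAddCommGroup V] [NormedSpace ℂ V] {U : Set V}
    {f g : V → ℂ} (hf : DifferentiableOn ℂ f U) (hg : DifferentiableOn ℂ g U) (h0 : ∀ z ∈ U, g z ≠ 0) :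
    DifferentiableOn ℂ (fun z => f z / g z) U := by
  simp only [div_eq_mul_inv]
  refine hf.fun_mul ?_
  intro z hz
  exact (differentiableAt_inv (h0 z hz)).comp_differentiableWithinAt z (hg z hz)

lemma ext_map (hp : 0 < p) (h : AutPair p φ ψ) :
    ∃ (c : ℝ) (Φ : (Fin n → ℂ) → (Fin n → ℂ)), 1 < c ∧ DifferentiableOn ℂ Φ {z | rho p z < c} ∧
      ∀ z, rho p z < 1 → Φ z = φ z := by
  obtain ⟨c0, u, hc0, hu, hu'⟩ := exists_extension hp h (q := fun _ => 1) (differentiable_const _) (k := 0)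
    (by simp)
  obtain ⟨c1, U, hc1, hU, hU'⟩ := exists_extension hp h.symm (q := fun _ => 1) (differentiable_const _) (k := 0)
    (by simp)
  have hk : ∀ k : Fin n, ∃ (c : ℝ) (G : (Fin n → ℂ) → ℂ), 1 < c ∧ DifferentiableOn ℂ G {z | rho p z < c} ∧
      ∀ z, rho p z < 1 → G z = Jac φ z * φ z k := fun k =>
    exists_extension hp h (q := fun z => z k) (by fun_prop) (k := k.1 + 1) (fun t z => rfl)
  choose ck G hck hG hG' using hk
  obtain ⟨B, hB⟩ := (isCompact_rho_le (n := n) hp 1).exists_bound_of_continuousOn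
    (hU.continuousOn.mono fun z (hz : rho p z ≤ 1) => lt_of_le_of_lt hz hc1)
  have hune : ∀ z, rho p z ≤ 1 → u z ≠ 0 := by
    intro z hz h0
    have h1 : Filter.Tendsto (fun t : ℝ => ‖u (Tm (t : ℂ) z)‖ * B) (nhdsWithin 1 (Set.Iio 1)) (nhds (‖u z‖ * B)) := by
      refine Filter.Tendsto.mul_const _ (Filter.Tendsto.norm ?_)
      have := (hu.differentiableAt ((isOpen_rho_lt hp c0).mem_nhds (lt_of_le_of_lt hz hc0))).continuousAt
      exact this.tendsto.comp (tendsto_Tm_one z)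
    have h2 : ∀ᶠ t : ℝ in nhdsWithin 1 (Set.Iio 1), 1 ≤ ‖u (Tm (t : ℂ) z)‖ * B := by
      filter_upwards [eventually_Tm_mem hp hz] with t ht
      have e1 := h.symm.jac hp ht
      have e2 := hU' _ (h.mφ _ ht)
      have e3 := hu' _ ht
      rw [mul_one] at e2 e3
      rw [← e2, ← e3] at e1
      have e4 := congrArg norm e1
      rw [norm_mul, norm_one] at e4
      have e5 := hB _ (show rho p (φ (Tm (t : ℂ) z)) ≤ 1 from (h.mφ _ ht).le)
      rw [← e4, mul_comm]
      gcongr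
    have h3 := ge_of_tendsto h1 h2
    rw [h0] at h3
    norm_num at h3
  set V : Set (Fin n → ℂ) := ({z | rho p z < c0} ∩ u ⁻¹' {0}ᶜ) ∩ ⋂ k, {z | rho p z < ck k} with hV
  have hVo : IsOpen V := by
    refine (hu.continuousOn.isOpen_inter_preimage (isOpen_rho_lt hp _) isOpen_compl_singleton).inter ?_
    exact isOpen_iInter_of_finite fun k => isOpen_rho_lt hp _
  obtain ⟨c, hc, hcV⟩ := exists_rho_lt_subset hp hVo (fun z hz => by
    refine ⟨⟨lt_of_le_of_lt hz hc0, hune z hz⟩, Set.mem_iInter.2 fun k => lt_of_le_of_lt hz (hck k)⟩)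
  refine ⟨c, fun z k => G k z / u z, hc, ?_, ?_⟩
  · refine differentiableOn_pi.2 fun k => ?_
    refine differentiableOn_div_holo ((hG k).mono ?_) (hu.mono ?_) ?_
    · intro z hz; exact Set.mem_iInter.1 (hcV z hz).2 k
    · intro z hz; exact (hcV z hz).1.1
    · intro z hz; exact (hcV z hz).1.2
  · intro z hz
    ext k
    show G k z / u z = _
    rw [hG' k z hz, div_eq_iff (hune z hz.le), hu' z hz]
    ring

lemma differentiable_Eul : Differentiable ℂ (Eul : (Fin n → ℂ) → (Fin n → ℂ)) := by
  unfold Eul; fun_prop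

lemma differentiableOn_fderiv_apply_pi {U V : Set (Fin n → ℂ)} (hU : IsOpen U)
    {Φ A B : (Fin n → ℂ) → (Fin n → ℂ)} (hΦ : DifferentiableOn ℂ Φ U) (hA : DifferentiableOn ℂ A V)
    (hB : DifferentiableOn ℂ B V) (hm : ∀ z ∈ V, A z ∈ U) :
    DifferentiableOn ℂ (fun z => fderiv ℂ Φ (A z) (B z)) V := by
  have h1 : ∀ z ∈ V, fderiv ℂ Φ (A z) (B z) = fun k => ∑ j, B z j * fderiv ℂ (fun z => Φ z k) (A z) (Pi.single j 1) := by
    intro z hz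
    ext k
    have hd := hΦ.differentiableAt (hU.mem_nhds (hm z hz))
    have h2 := (hasFDerivAt_pi'.1 hd.hasFDerivAt k).fderiv
    rw [h2]
    conv_lhs => rw [pi_eq_sum_univ' (B z)]
    simp only [map_sum, map_smul, Finset.sum_apply, Pi.smul_apply, smul_eq_mul]
    refine Finset.sum_congr rfl fun j _ => ?_
    simp
  refine DifferentiableOn.congr ?_ h1
  refine differentiableOn_pi.2 fun k => DifferentiableOn.fun_sum fun j _ => ?_
  refine (differentiableOn_pi.1 hB j).fun_mul ?_
  exact (differentiableOn_fderiv_apply hU (differentiableOn_pi.1 hΦ k) _).comp hA hm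

lemma exists_field (hp : 0 < p) (h : AutPair p φ ψ) :
    ∃ (c : ℝ) (X : (Fin n → ℂ) → (Fin n → ℂ)), 1 < c ∧ DifferentiableOn ℂ X {z | rho p z < c} ∧
      (∀ z, rho p z < 1 → X z = fderiv ℂ φ (ψ z) (Eul (ψ z))) ∧
      ∀ z, rho p z = 1 → ∃ γ : ℝ → (Fin n → ℂ), γ 0 = z ∧ (∀ θ, rho p (γ θ) = 1) ∧
        HasDerivAt γ (Complex.I • X z) 0 := by
  have hD := isOpen_rho_lt (n := n) hp 1
  obtain ⟨c1, Φ, hc1, hΦ, hΦ'⟩ := ext_map hp h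
  obtain ⟨c2, Ψ, hc2, hΨ, hΨ'⟩ := ext_map hp h.symm
  have cΦ : ∀ z, rho p z ≤ 1 → ContinuousAt Φ z := fun z hz =>
    (hΦ.differentiableAt ((isOpen_rho_lt hp c1).mem_nhds (lt_of_le_of_lt hz hc1))).continuousAt
  have cΨ : ∀ z, rho p z ≤ 1 → ContinuousAt Ψ z := fun z hz =>
    (hΨ.differentiableAt ((isOpen_rho_lt hp c2).mem_nhds (lt_of_le_of_lt hz hc2))).continuousAt
  have mΦ : ∀ z, rho p z ≤ 1 → rho p (Φ z) ≤ 1 := by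
    intro z hz
    refine le_of_tendsto (((continuous_rho hp).tendsto _).comp ((cΦ z hz).tendsto.comp (tendsto_Tm_one z))) ?_
    filter_upwards [eventually_Tm_mem hp hz] with t ht
    simp only [Function.comp, hΦ' _ ht]
    exact (h.mφ _ ht).le
  have mΨ : ∀ z, rho p z ≤ 1 → rho p (Ψ z) ≤ 1 := by
    intro z hz
    refine le_of_tendsto (((continuous_rho hp).tendsto _).comp ((cΨ z hz).tendsto.comp (tendsto_Tm_one z))) ?_
    filter_upwards [eventually_Tm_mem hp hz] with t ht
    simp only [Function.comp, hΨ' _ ht]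
    exact (h.mψ _ ht).le
  have lΨ : ∀ z, rho p z ≤ 1 → Ψ (Φ z) = z := by
    intro z hz
    refine tendsto_nhds_unique ((cΨ _ (mΦ z hz)).tendsto.comp ((cΦ z hz).tendsto.comp (tendsto_Tm_one z))) ?_
    refine (tendsto_Tm_one z).congr' ?_
    filter_upwards [eventually_Tm_mem hp hz] with t ht
    simp only [Function.comp, hΦ' _ ht, hΨ' _ (h.mφ _ ht), h.l _ ht]
  have rΨ : ∀ z, rho p z ≤ 1 → Φ (Ψ z) = z := by
    intro z hz
    refine tendsto_nhds_unique ((cΦ _ (mΨ z hz)).tendsto.comp ((cΨ z hz).tendsto.comp (tendsto_Tm_one z))) ?_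
    refine (tendsto_Tm_one z).congr' ?_
    filter_upwards [eventually_Tm_mem hp hz] with t ht
    simp only [Function.comp, hΨ' _ ht, hΦ' _ (h.mψ _ ht), h.r _ ht]
  have bΦ : ∀ z, rho p z = 1 → rho p (Φ z) = 1 := by
    intro z hz
    refine le_antisymm (mΦ z hz.le) (not_lt.1 fun hlt => ?_)
    have := h.mψ _ hlt
    rw [← hΨ' _ hlt, lΨ z hz.le, hz] at this
    exact lt_irrefl _ this
  have bΨ : ∀ z, rho p z = 1 → rho p (Ψ z) = 1 := by
    intro z hz
    refine le_antisymm (mΨ z hz.le) (not_lt.1 fun hlt => ?_)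
    have := h.mφ _ hlt
    rw [← hΦ' _ hlt, rΨ z hz.le, hz] at this
    exact lt_irrefl _ this
  have hVo : IsOpen ({z | rho p z < c2} ∩ Ψ ⁻¹' {z | rho p z < c1}) :=
    hΨ.continuousOn.isOpen_inter_preimage (isOpen_rho_lt hp _) (isOpen_rho_lt hp _)
  obtain ⟨c, hc, hcV⟩ := exists_rho_lt_subset hp hVo (fun z hz =>
    ⟨lt_of_le_of_lt hz hc2, lt_of_le_of_lt (mΨ z hz) hc1⟩)
  refine ⟨c, fun z => fderiv ℂ Φ (Ψ z) (Eul (Ψ z)), hc, ?_, ?_, ?_⟩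
  · have hΨc : DifferentiableOn ℂ Ψ {z | rho p z < c} := hΨ.mono fun z hz => (hcV z hz).1
    exact differentiableOn_fderiv_apply_pi (isOpen_rho_lt hp c1) hΦ hΨc
      (differentiable_Eul.comp_differentiableOn hΨc) fun z hz => (hcV z hz).2
  · intro z hz
    have h1 : Φ =ᶠ[nhds (ψ z)] φ := by
      filter_upwards [hD.mem_nhds (h.mψ z hz)] with w hw using hΦ' w hw
    simp only [hΨ' z hz, h1.fderiv_eq]
  · intro z hz
    set y := Ψ z with hy
    have hy1 : rho p y = 1 := bΨ z hz
    have hex0 : ex 0 = 1 := by simp [ex]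
    refine ⟨fun θ => Φ (Tm (ex θ) y), ?_, ?_, ?_⟩
    · simp only [hex0, Tm_one]; exact rΨ z hz.le
    · intro θ
      exact bΦ _ (by rw [rho_Tm_of_norm_one p (norm_ex θ), hy1])
    · have h1 : HasDerivAt ex Complex.I 0 := by
        have e1 : HasDerivAt (fun θ : ℝ => (θ : ℂ) * Complex.I) (1 * Complex.I) 0 :=
          (HasDerivAt.ofReal_comp (hasDerivAt_id (0 : ℝ))).mul_const Complex.I
        have := e1.cexp
        have e3 : ex = fun θ : ℝ => Complex.exp ((θ : ℂ) * Complex.I) := rfl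
        rw [e3]
        simpa using this
      have h2 : HasDerivAt (fun θ : ℝ => Tm (ex θ) y) (Complex.I • Eul y) 0 := by
        have e2 := hasDerivAt_Tm y
        rw [← hex0] at e2
        exact e2.scomp (0 : ℝ) h1
      have h3 := (hΦ.differentiableAt ((isOpen_rho_lt hp c1).mem_nhds
        (show rho p y < c1 by rw [hy1]; exact hc1))).hasFDerivAt.restrictScalars ℝ
      have h4 : Tm (ex 0) y = y := by rw [hex0, Tm_one]
      rw [← h4] at h3
      have h5 := h3.comp_hasDerivAt (0 : ℝ) h2
      rw [h4] at h5
      simp only [ContinuousLinearMap.coe_restrictScalars', map_smul] at h5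
      exact h5

end S4c

section S5a
variable {n : ℕ} {p : ℝ}

/-- the coefficients `v_j / λ_j` -/
noncomputable def aj (Y l : Fin n → ℂ) (j : Fin n) : ℂ :=
  altPoly Y (l j) / (l j * ∏ i ∈ univ.erase j, (l j - l i))

lemma hasDerivAt_norm_rpow_curve {α : ℝ → ℂ} {α' : ℂ} (p : ℝ) (h : HasDerivAt α α' 0) (h0 : α 0 ≠ 0) :
    HasDerivAt (fun θ => ‖α θ‖ ^ (2 * p)) (2 * p * (‖α 0‖ ^ (2 * p) * (α' / α 0).re)) 0 := by
  have h1 := h.norm_sq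
  have h2 := h1.rpow_const (p := p) (Or.inl (by positivity))
  have e : ∀ x : ℝ, 0 ≤ x → (x ^ 2) ^ p = x ^ (2 * p) := by
    intro x hx
    rw [← Real.rpow_natCast x 2, ← Real.rpow_mul hx]; norm_num
  simp only [e _ (norm_nonneg _)] at h2
  convert h2 using 1
  have hpos : 0 < ‖α 0‖ := norm_pos_iff.2 h0
  have e2 : (‖α 0‖ ^ 2) ^ (p - 1) = ‖α 0‖ ^ (2 * p) / ‖α 0‖ ^ 2 := by
    rw [Real.rpow_sub (by positivity), e _ hpos.le, Real.rpow_one]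
  rw [e2, Complex.inner, Complex.div_re, Complex.normSq_eq_norm_sq]
  simp [Complex.mul_re]
  field_simp

lemma tan_id {X : Fin n → ℂ} {l : Fin n → ℂ} (hl : Function.Injective l) (hl0 : ∀ j, l j ≠ 0)
    (hp : 0 < p) {γ : ℝ → (Fin n → ℂ)} (hγ0 : γ 0 = piMap n l) (hγ : ∀ θ, rho p (γ θ) = 1)
    (hγ' : HasDerivAt γ (Complex.I • X) 0) :
    (∑ j, ((‖l j‖ ^ (2 * p) : ℝ) : ℂ) * aj X l j).im = 0 := by
  obtain ⟨g, V, hV, hVm, hgd, hg0, hg, -⟩ := exists_local_inverse isOpen_univ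
    (differentiable_piMap (n := n)).differentiableOn (Set.mem_univ l) (fderiv_piMap_injective hl)
  have hgda := (hgd.differentiableAt (hV.mem_nhds hVm)).hasFDerivAt
  set v := fderiv ℂ g (piMap n l) X with hv
  have h1 : fderiv ℂ (piMap n) l v = X := by
    have e1 : HasFDerivAt (piMap n ∘ g) (ContinuousLinearMap.id ℂ (Fin n → ℂ)) (piMap n l) := by
      refine (hasFDerivAt_id _).congr_of_eventuallyEq ?_
      filter_upwards [hV.mem_nhds hVm] with y hy using hg y hy
    have e2 := (differentiable_piMap (n := n) (g (piMap n l))).hasFDerivAt.comp (piMap n l) hgda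
    have e3 := e2.unique e1
    have e4 := congrArg (fun A => A X) e3
    simpa [hg0] using e4
  have h2 : ∀ j, aj X l j = v j / l j := by
    intro j
    rw [aj, ← h1, altPoly_fderiv_piMap]
    have := prod_erase_ne_zero hl j
    have := hl0 j
    field_simp
  have hα : HasDerivAt (fun θ => g (γ θ)) (Complex.I • v) 0 := by
    have e1 := hgda.restrictScalars ℝ
    rw [← hγ0] at e1
    have e2 := e1.comp_hasDerivAt (0 : ℝ) hγ'
    simp only [ContinuousLinearMap.coe_restrictScalars', map_smul] at e2
    rw [hγ0] at e2
    exact e2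
  have hαj := hasDerivAt_pi.1 hα
  have hα0 : g (γ 0) = l := by rw [hγ0, hg0]
  have h3 : HasDerivAt (fun θ => ∑ j, ‖g (γ θ) j‖ ^ (2 * p))
      (∑ j, 2 * p * (‖l j‖ ^ (2 * p) * ((Complex.I • v) j / l j).re)) 0 := by
    refine HasDerivAt.fun_sum fun j _ => ?_
    have := hasDerivAt_norm_rpow_curve p (hαj j) (by rw [hα0]; exact hl0 j)
    rw [hα0] at this
    exact this
  have h4 : (fun θ => ∑ j, ‖g (γ θ) j‖ ^ (2 * p)) =ᶠ[nhds 0] fun _ => (1 : ℝ) := by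
    have hc : ContinuousAt γ 0 := hγ'.continuousAt
    have : ∀ᶠ θ in nhds (0 : ℝ), γ θ ∈ V := hc.eventually_mem (by rw [hγ0]; exact hV.mem_nhds hVm)
    filter_upwards [this] with θ hθ
    have e1 := rho_piMap p (g (γ θ))
    rw [hg _ hθ, hγ] at e1
    exact e1.symm
  have h5 := h3.unique ((hasDerivAt_const (0 : ℝ) (1 : ℝ)).congr_of_eventuallyEq h4)
  rw [← Finset.mul_sum] at h5
  have h6 := (mul_eq_zero.1 h5).resolve_left (by positivity)
  rw [Complex.im_sum, ← neg_eq_zero, ← Finset.sum_neg_distrib, ← h6]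
  refine Finset.sum_congr rfl fun j _ => ?_
  have : (Complex.I • v) j / l j = Complex.I * (v j / l j) := by simp [mul_div_assoc]
  rw [h2, this, Complex.im_ofReal_mul, Complex.I_mul_re]
  ring

/-- Fourier components of a field -/
noncomputable def Xm (X : (Fin n → ℂ) → (Fin n → ℂ)) (m : ℤ) (z : Fin n → ℂ) : Fin n → ℂ :=
  fun k => wtZ (fun z => X z k) (m + k.1 + 1) z

/-- Fourier components of the defect -/
noncomputable def hm (p : ℝ) (X : (Fin n → ℂ) → (Fin n → ℂ)) (m : ℤ) (l : Fin n → ℂ) : ℂ :=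
  ∑ j, ((‖l j‖ ^ (2 * p) : ℝ) : ℂ) * aj (Xm X m (piMap n l)) l j

lemma aj_denom_smul {t : ℂ} (l : Fin n → ℂ) (j : Fin n) :
    (t • l) j * ∏ i ∈ univ.erase j, ((t • l) j - (t • l) i) =
      t ^ n * (l j * ∏ i ∈ univ.erase j, (l j - l i)) := by
  have hn : n = (univ.erase j).card + 1 := by
    have := j.2
    simp; omega
  have : ∏ i ∈ univ.erase j, ((t • l) j - (t • l) i) = t ^ (univ.erase j).card * ∏ i ∈ univ.erase j, (l j - l i) := by
    rw [← Finset.prod_const, ← Finset.prod_mul_distrib]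
    refine Finset.prod_congr rfl fun i _ => ?_
    simp [mul_sub]
  have h2 : t ^ n = t ^ (univ.erase j).card * t := by
    rw [← pow_succ, ← hn]
  rw [this, h2]
  simp only [Pi.smul_apply, smul_eq_mul]
  ring

lemma altPoly_smul_arg {t : ℂ} (ht : t ≠ 0) (Y l : Fin n → ℂ) (j : Fin n) :
    altPoly Y ((t • l) j) = t ^ n * altPoly (fun k => t ^ (-((k.1 : ℤ) + 1)) * Y k) (l j) := by
  unfold altPoly
  rw [Finset.mul_sum]
  refine Finset.sum_congr rfl fun k _ => ?_
  have hk := k.2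
  have : t ^ (n - 1 - k.1) = t ^ n * t ^ (-((k.1 : ℤ) + 1)) := by
    rw [← zpow_natCast, ← zpow_natCast, ← zpow_add₀ ht]
    congr 1; omega
  simp only [Pi.smul_apply, smul_eq_mul, mul_pow]
  rw [this]; ring

lemma aj_smul {t : ℂ} (ht : t ≠ 0) (Y l : Fin n → ℂ) (j : Fin n) :
    aj Y (t • l) j = aj (fun k => t ^ (-((k.1 : ℤ) + 1)) * Y k) l j := by
  unfold aj
  rw [aj_denom_smul, altPoly_smul_arg ht, mul_div_mul_left _ _ (pow_ne_zero _ ht)]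

lemma hm_smul {t : ℂ} (ht : t ≠ 0) (X : (Fin n → ℂ) → (Fin n → ℂ)) (m : ℤ) (l : Fin n → ℂ) :
    hm p X m (t • l) = ((‖t‖ ^ (2 * p) : ℝ) : ℂ) * t ^ m * hm p X m l := by
  unfold hm
  rw [Finset.mul_sum]
  refine Finset.sum_congr rfl fun j _ => ?_
  rw [aj_smul ht, piMap_smul]
  have : (fun k : Fin n => t ^ (-((k.1 : ℤ) + 1)) * Xm X m (Tm t (piMap n l)) k) = t ^ m • Xm X m (piMap n l) := by
    ext k
    simp only [Xm, wtZ_Tm, Pi.smul_apply, smul_eq_mul, ← mul_assoc]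
    rw [← zpow_add₀ ht]
    congr 2; ring
  rw [this]
  unfold aj
  rw [altPoly_smul, Pi.smul_apply, norm_smul, Real.mul_rpow (norm_nonneg _) (norm_nonneg _)]
  push_cast
  ring

lemma hm_fourier (hp : 0 < p) {c : ℝ} {X : (Fin n → ℂ) → (Fin n → ℂ)}
    (hX : DifferentiableOn ℂ X {z | rho p z < c}) (m : ℤ) {l : Fin n → ℂ} (hl : rho p (piMap n l) < c) :
    hm p X m l = ((2 * Real.pi : ℝ) : ℂ)⁻¹ * ∫ θ in (0 : ℝ)..2 * Real.pi,
      (∑ j, ((‖(ex θ • l) j‖ ^ (2 * p) : ℝ) : ℂ) * aj (X (piMap n (ex θ • l))) (ex θ • l) j) * ex θ ^ (-m) := by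
  have hintg : ∀ k : Fin n, IntervalIntegrable (fun θ => X (Tm (ex θ) (piMap n l)) k * ex θ ^ (-(m + k.1 + 1)))
      MeasureTheory.volume 0 (2 * Real.pi) := by
    intro k
    refine Continuous.intervalIntegrable ?_ _ _
    refine Continuous.mul ?_ (continuous_ex.zpow₀ _ (fun x => Or.inl (ex_ne_zero _)))
    have h1 : Continuous (fun θ => Tm (ex θ) (piMap n l)) :=
      (differentiable_Tm_left _).continuous.comp continuous_ex
    have h2 := (differentiableOn_pi.1 hX k).continuousOn.comp_continuous h1
      (fun θ => rho_Tm_lt hp hl (norm_ex θ).le)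
    exact h2
  have h1 : ∀ θ, (∑ j, ((‖(ex θ • l) j‖ ^ (2 * p) : ℝ) : ℂ) * aj (X (piMap n (ex θ • l))) (ex θ • l) j) * ex θ ^ (-m)
      = ∑ j, ∑ k : Fin n, (((‖l j‖ ^ (2 * p) : ℝ) : ℂ) * ((-1) ^ k.1 * (l j) ^ (n - 1 - k.1) /
        (l j * ∏ i ∈ univ.erase j, (l j - l i)))) * (X (Tm (ex θ) (piMap n l)) k * ex θ ^ (-(m + k.1 + 1))) := by
    intro θ
    rw [Finset.sum_mul]
    refine Finset.sum_congr rfl fun j _ => ?_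
    rw [aj_smul (ex_ne_zero θ), piMap_smul, aj, altPoly, Finset.sum_div, Finset.mul_sum, Finset.sum_mul]
    refine Finset.sum_congr rfl fun k _ => ?_
    have e1 : ex θ ^ (-(m + k.1 + 1)) = ex θ ^ (-((k.1 : ℤ) + 1)) * ex θ ^ (-m) := by
      rw [← zpow_add₀ (ex_ne_zero θ)]; congr 1; ring
    rw [e1, Pi.smul_apply, norm_smul, norm_ex, one_mul]
    ring
  simp only [h1]
  rw [intervalIntegral.integral_finsetSum]
  · simp_rw [intervalIntegral.integral_finsetSum (fun k _ => (hintg k).const_mul _), intervalIntegral.integral_const_mul]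
    unfold hm
    rw [Finset.mul_sum]
    refine Finset.sum_congr rfl fun j _ => ?_
    rw [aj, altPoly, Finset.sum_div, Finset.mul_sum, Finset.mul_sum]
    refine Finset.sum_congr rfl fun k _ => ?_
    rw [Xm, wtZ_eq hp (differentiableOn_pi.1 hX k) _ hl]
    ring
  · intro j _
    have := IntervalIntegrable.sum univ (fun k (_ : k ∈ univ) => (hintg k).const_mul
      (((‖l j‖ ^ (2 * p) : ℝ) : ℂ) * ((-1) ^ k.1 * (l j) ^ (n - 1 - k.1) /
        (l j * ∏ i ∈ univ.erase j, (l j - l i)))))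
    rw [Finset.sum_fn] at this
    exact this

lemma hm_conj (hp : 0 < p) {c : ℝ} (hc : 1 < c) {X : (Fin n → ℂ) → (Fin n → ℂ)}
    (hX : DifferentiableOn ℂ X {z | rho p z < c})
    (hγ : ∀ z, rho p z = 1 → ∃ γ : ℝ → (Fin n → ℂ), γ 0 = z ∧ (∀ θ, rho p (γ θ) = 1) ∧
        HasDerivAt γ (Complex.I • X z) 0) (m : ℤ) {l : Fin n → ℂ} (hl : Function.Injective l)
    (hl0 : ∀ j, l j ≠ 0) (hN : Nfun p l = 1) : hm p X m l = star (hm p X (-m) l) := by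
  have hlc : rho p (piMap n l) < c := by rw [rho_piMap, hN]; exact hc
  rw [hm_fourier hp hX m hlc, hm_fourier hp hX (-m) hlc, Complex.star_def, map_mul, map_inv₀,
    Complex.conj_ofReal, intervalIntegral.integral_of_le (by positivity),
    intervalIntegral.integral_of_le (by positivity), ← integral_conj,
    ← intervalIntegral.integral_of_le (by positivity), ← intervalIntegral.integral_of_le (by positivity)]
  congr 1
  refine intervalIntegral.integral_congr fun θ _ => ?_
  have h1 : rho p (piMap n (ex θ • l)) = 1 := by
    rw [rho_piMap, Nfun_smul, norm_ex, hN]; simp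
  obtain ⟨γ, g0, g1, g2⟩ := hγ _ h1
  have h2 := tan_id (l := ex θ • l) (fun a b hab => hl (by
    simpa [ex_ne_zero] using hab)) (fun j => by simp [ex_ne_zero, hl0 j]) hp g0 g1 g2
  have h3 := Complex.conj_eq_iff_im.2 h2
  have h4 : (starRingEnd ℂ) (ex θ) = (ex θ)⁻¹ := by
    rw [Complex.inv_def]; simp [Complex.normSq_eq_norm_sq, norm_ex]
  simp only [map_mul, h3, map_zpow₀, h4, neg_neg, inv_zpow']

lemma hm_id (hp : 0 < p) {c : ℝ} (hc : 1 < c) {X : (Fin n → ℂ) → (Fin n → ℂ)}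
    (hX : DifferentiableOn ℂ X {z | rho p z < c})
    (hγ : ∀ z, rho p z = 1 → ∃ γ : ℝ → (Fin n → ℂ), γ 0 = z ∧ (∀ θ, rho p (γ θ) = 1) ∧
        HasDerivAt γ (Complex.I • X z) 0) (m : ℤ) {l : Fin n → ℂ} (hl : Function.Injective l)
    (hl0 : ∀ j, l j ≠ 0) (hN : 0 < Nfun p l) :
    hm p X m l = ((Nfun p l ^ ((m : ℝ) / p) : ℝ) : ℂ) * star (hm p X (-m) l) := by
  set t : ℝ := Nfun p l ^ (-(1 / (2 * p))) with ht
  have ht0 : 0 < t := Real.rpow_pos_of_pos hN _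
  have ht' : (t : ℂ) ≠ 0 := by exact_mod_cast ht0.ne'
  have htn : ‖(t : ℂ)‖ = t := by rw [Complex.norm_real, Real.norm_of_nonneg ht0.le]
  have h1 : Nfun p ((t : ℂ) • l) = 1 := by
    rw [Nfun_smul, htn, ht, ← Real.rpow_mul hN.le]
    have : -(1 / (2 * p)) * (2 * p) = -1 := by field_simp
    rw [this, Real.rpow_neg_one, inv_mul_cancel₀ hN.ne']
  have h2 := hm_conj hp hc hX hγ m (l := (t : ℂ) • l) (fun a b hab => hl (by
    simpa [ht0.ne'] using hab)) (fun j => by simp [ht0.ne', hl0 j]) h1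
  rw [hm_smul ht', hm_smul ht', htn] at h2
  simp only [Complex.star_def, map_mul, Complex.conj_ofReal, map_zpow₀, mul_assoc] at h2
  have h3 : ((t ^ (2 * p) : ℝ) : ℂ) ≠ 0 := by
    exact_mod_cast (Real.rpow_pos_of_pos ht0 _).ne'
  have h4 := mul_left_cancel₀ h3 h2
  have h5 : (Nfun p l ^ ((m : ℝ) / p) : ℝ) = t ^ (-m) * t ^ (-m) := by
    rw [← zpow_add₀ ht0.ne', ← Real.rpow_intCast, ht, ← Real.rpow_mul hN.le]
    congr 1
    push_cast; field_simp; ring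
  rw [h5]
  push_cast
  rw [Complex.star_def, mul_assoc, ← h4, ← mul_assoc, ← zpow_add₀ ht']
  simp

end S5a

section S5b
variable {n : ℕ}

/-- one-variable computation -/
lemma quad_id {g g1 : ℂ → ℂ} {g2 s x y a b : ℂ} (hx : x ∈ Complex.slitPlane)
    (hg : ∀ᶠ t in nhds (0 : ℂ), HasDerivAt g (g1 t) t) (hg1 : HasDerivAt g1 g2 0)
    (h : ∀ᶠ t in nhds (0 : ℂ), (x + t * y) ^ s * g t = a + b * t) :
    s * (s - 1) * y ^ 2 * g 0 + 2 * s * x * y * g1 0 + x ^ 2 * g2 = 0 := by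
  have hlin : ∀ t : ℂ, HasDerivAt (fun t => x + t * y) y t := by
    intro t
    simpa using ((hasDerivAt_id t).mul_const y).const_add x
  have hcont : ContinuousAt (fun t : ℂ => x + t * y) 0 := (hlin 0).continuousAt
  have hslit : ∀ᶠ t in nhds (0 : ℂ), x + t * y ∈ Complex.slitPlane :=
    hcont.eventually_mem (Complex.isOpen_slitPlane.mem_nhds (by simpa using hx))
  have hpow : ∀ r t : ℂ, x + t * y ∈ Complex.slitPlane →
      HasDerivAt (fun t => (x + t * y) ^ r) (r * (x + t * y) ^ (r - 1) * y) t := by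
    intro r t ht
    exact (hlin t).cpow_const ht
  have h1 : ∀ᶠ t in nhds (0 : ℂ), s * (x + t * y) ^ (s - 1) * y * g t + (x + t * y) ^ s * g1 t = b := by
    filter_upwards [h.eventually_nhds, hg, hslit] with t ht hgt hst
    have e1 := (hpow s t hst).mul hgt
    have e2 : HasDerivAt (fun t => a + b * t) b t := by
      simpa using ((hasDerivAt_id t).const_mul b).const_add a
    exact e1.unique (e2.congr_of_eventuallyEq ht)
  have hx0 : x + 0 * y ∈ Complex.slitPlane := by simpa using hx
  have e1 := ((((hpow (s - 1) 0 hx0).const_mul s).mul_const y).mul hg.self_of_nhds).add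
    ((hpow s 0 hx0).mul hg1)
  have e2 := e1.unique ((hasDerivAt_const (0 : ℂ) b).congr_of_eventuallyEq h1)
  have hxne : x ≠ 0 := Complex.slitPlane_ne_zero hx
  simp only [zero_mul, add_zero] at e2
  have p1 : x ^ (s - 1) = x ^ s / x := by rw [Complex.cpow_sub _ _ hxne, Complex.cpow_one]
  have p2 : x ^ (s - 1 - 1) = x ^ s / x / x := by
    rw [Complex.cpow_sub _ _ hxne, p1, Complex.cpow_one]
  have p3 : x ^ s ≠ 0 := by simp [Complex.cpow_eq_zero_iff, hxne]
  rw [p1, p2] at e2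
  field_simp at e2
  have : x ^ s * (s * (s - 1) * y ^ 2 * g 0 + 2 * s * x * y * g1 0 + x ^ 2 * g2) = 0 := by
    linear_combination e2
  simpa [p3] using this

/-- the kind of sets used for polarization -/
structure GoodB (B : Set (Fin n → ℂ)) : Prop where
  op : IsOpen B
  cv : Convex ℝ B
  ne : B.Nonempty
  nz : ∀ w ∈ B, ∀ j, w j ≠ 0
  sl : ∀ w ∈ B, ∀ u ∈ B, ∑ j, w j * u j ∈ Complex.slitPlane

lemma quad_multi {B : Set (Fin n → ℂ)} (hB : GoodB B) {G : (Fin n → ℂ) → ℂ}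
    (hG : DifferentiableOn ℂ G B) {w C : Fin n → ℂ} (hw : w ∈ B) {s : ℂ}
    (h : ∀ u ∈ B, (∑ j, w j * u j) ^ s * G u = ∑ j, C j * u j) {u : Fin n → ℂ} (hu : u ∈ B)
    (η : Fin n → ℂ) :
    s * (s - 1) * (∑ j, w j * η j) ^ 2 * G u + 2 * s * (∑ j, w j * u j) * (∑ j, w j * η j) *
      fderiv ℂ G u η + (∑ j, w j * u j) ^ 2 * fderiv ℂ (fun u => fderiv ℂ G u η) u η = 0 := by
  have hline : ∀ t : ℂ, HasDerivAt (fun t : ℂ => u + t • η) η t := by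
    intro t
    simpa using ((hasDerivAt_id t).smul_const η).const_add u
  have hmem : ∀ᶠ t in nhds (0 : ℂ), u + t • η ∈ B :=
    (hline 0).continuousAt.eventually_mem (hB.op.mem_nhds (by simpa using hu))
  have key : ∀ F : (Fin n → ℂ) → ℂ, DifferentiableOn ℂ F B → ∀ t : ℂ, u + t • η ∈ B →
      HasDerivAt (fun t : ℂ => F (u + t • η)) (fderiv ℂ F (u + t • η) η) t := by
    intro F hF t ht
    exact (hF.differentiableAt (hB.op.mem_nhds ht)).hasFDerivAt.comp_hasDerivAt t (hline t)
  have h2 := quad_id (g := fun t => G (u + t • η)) (g1 := fun t => fderiv ℂ G (u + t • η) η)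
    (g2 := fderiv ℂ (fun u => fderiv ℂ G u η) u η) (s := s) (x := ∑ j, w j * u j) (y := ∑ j, w j * η j)
    (a := ∑ j, C j * u j) (b := ∑ j, C j * η j) (hB.sl w hw u hu)
    (by filter_upwards [hmem] with t ht using key G hG t ht)
    (by
      have := key (fun u => fderiv ℂ G u η) (differentiableOn_fderiv_apply hB.op hG η) 0 (by simpa using hu)
      simpa using this)
    (by
      filter_upwards [hmem] with t ht
      have := h _ ht
      simp only [Pi.add_apply, Pi.smul_apply, smul_eq_mul, mul_add, Finset.sum_add_distrib] at this
      rw [Finset.mul_sum, Finset.sum_mul]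
      convert this using 3
      · refine congrArg _ (Finset.sum_congr rfl fun j _ => by ring)
      · ring)
  simpa using h2

/-- entire functions vanishing on `B` vanish -/
lemma entire_zero {B : Set (Fin n → ℂ)} (hB : IsOpen B) (hne : B.Nonempty) {F : (Fin n → ℂ) → ℂ}
    (hF : Differentiable ℂ F) (h : ∀ w ∈ B, F w = 0) (w : Fin n → ℂ) : F w = 0 := by
  obtain ⟨w0, hw0⟩ := hne
  exact identity_holo isOpen_univ isPreconnected_univ hF.differentiableOn (Set.mem_univ w0)
    (by filter_upwards [hB.mem_nhds hw0] with z hz using h z hz) w (Set.mem_univ _)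

lemma sum_pair (i j : Fin n) (_hij : i ≠ j) (a b : ℂ) (f : Fin n → ℂ) :
    ∑ k, (Pi.single j a - Pi.single i b : Fin n → ℂ) k * f k = a * f j - b * f i := by
  simp [sub_mul, Finset.sum_sub_distrib, Pi.single_apply, Finset.sum_ite_eq']

lemma fderiv_sum_const {B : Set (Fin n → ℂ)} (hB : IsOpen B) {d : (Fin n → ℂ) → (Fin n → ℂ)}
    (hd : ∀ j, DifferentiableOn ℂ (fun u => d u j) B) (w : Fin n → ℂ) {u : Fin n → ℂ} (hu : u ∈ B)
    (η : Fin n → ℂ) : fderiv ℂ (fun u => ∑ j, w j * d u j) u η = ∑ j, w j * fderiv ℂ (fun u => d u j) u η := by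
  have h : HasFDerivAt (fun u => ∑ j, w j * d u j) (∑ j, w j • fderiv ℂ (fun u => d u j) u) u := by
    refine HasFDerivAt.fun_sum fun j _ => ?_
    exact ((hd j).differentiableAt (hB.mem_nhds hu)).hasFDerivAt.const_mul (w j)
  rw [h.fderiv]
  simp

lemma alg_quad {B : Set (Fin n → ℂ)} (hB : GoodB B) {c d : (Fin n → ℂ) → (Fin n → ℂ)}
    (hd : DifferentiableOn ℂ d B) {s : ℂ}
    (h : ∀ w ∈ B, ∀ u ∈ B, ∑ j, c w j * u j = (∑ j, w j * u j) ^ s * ∑ j, w j * d u j)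
    {u : Fin n → ℂ} (hu : u ∈ B) (η : Fin n → ℂ) {w : Fin n → ℂ} (hw : w ∈ B) :
    s * (s - 1) * (∑ j, w j * η j) ^ 2 * (∑ j, w j * d u j) + 2 * s * (∑ j, w j * u j) * (∑ j, w j * η j) *
      (∑ j, w j * fderiv ℂ (fun u => d u j) u η) + (∑ j, w j * u j) ^ 2 *
      (∑ j, w j * fderiv ℂ (fun u => fderiv ℂ (fun u => d u j) u η) u η) = 0 := by
  have hdj : ∀ j, DifferentiableOn ℂ (fun u => d u j) B := fun j => differentiableOn_pi.1 hd j
  have h1 := quad_multi hB (G := fun u => ∑ j, w j * d u j) (C := c w) (s := s)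
    (DifferentiableOn.fun_sum fun j _ => (hdj j).const_mul (w j)) hw
    (fun u hu => (h w hw u hu).symm) hu η
  rw [fderiv_sum_const hB.op hdj w hu] at h1
  have h2 : fderiv ℂ (fun u => fderiv ℂ (fun u => ∑ j, w j * d u j) u η) u =
      fderiv ℂ (fun u => ∑ j, w j * fderiv ℂ (fun u => d u j) u η) u := by
    refine Filter.EventuallyEq.fderiv_eq ?_
    filter_upwards [hB.op.mem_nhds hu] with v hv using fderiv_sum_const hB.op hdj w hv η
  rw [h2, fderiv_sum_const (d := fun u j => fderiv ℂ (fun u => d u j) u η) hB.op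
    (fun j => differentiableOn_fderiv_apply hB.op (hdj j) η) w hu] at h1
  exact h1

lemma alg_c_zero {B : Set (Fin n → ℂ)} (hB : GoodB B) {c : Fin n → ℂ}
    (h : ∀ u ∈ B, ∑ j, c j * u j = 0) : c = 0 := by
  have h1 := entire_zero hB.op hB.ne (F := fun u => ∑ j, c j * u j) (by fun_prop) h
  ext j
  have := h1 (Pi.single j 1)
  simpa [Pi.single_apply] using this

lemma alg_generic (hn : 2 ≤ n) {B : Set (Fin n → ℂ)} (hB : GoodB B) {c d : (Fin n → ℂ) → (Fin n → ℂ)}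
    (hd : DifferentiableOn ℂ d B) {s : ℂ} (hs0 : s ≠ 0) (hs1 : s ≠ 1) (hs2 : s + 1 ≠ 0)
    (h : ∀ w ∈ B, ∀ u ∈ B, ∑ j, c w j * u j = (∑ j, w j * u j) ^ s * ∑ j, w j * d u j) :
    ∀ u ∈ B, d u = 0 := by
  have hdj : ∀ j, DifferentiableOn ℂ (fun u => d u j) B := fun j => differentiableOn_pi.1 hd j
  have h1 : ∀ u ∈ B, ∀ i j, u i * d u j = u j * d u i := by
    intro u hu i j
    by_cases hij : i = j
    · rw [hij]
    have h2 := entire_zero hB.op hB.ne (F := fun w => _) (by fun_prop)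
      (fun w hw => alg_quad hB hd h hu (Pi.single j 1) hw) (Pi.single j (u i) - Pi.single i (u j))
    simp only [sum_pair i j hij] at h2
    have hz : u i * u j - u j * u i = 0 := by ring
    rw [hz] at h2
    have hui := hB.nz u hu i
    simp [hij, hs0, sub_ne_zero.2 hs1, hui] at h2
    linear_combination h2
  let i0 : Fin n := ⟨0, by omega⟩
  let i1 : Fin n := ⟨1, by omega⟩
  have hi : i0 ≠ i1 := by simp [i0, i1]
  have hl : DifferentiableOn ℂ (fun u => d u i0 / u i0) B :=
    differentiableOn_div_holo (hdj i0) (by fun_prop) (fun u hu => hB.nz u hu i0)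
  have h2 : ∀ w ∈ B, ∀ u ∈ B, (∑ j, w j * u j) ^ (s + 1) * (d u i0 / u i0) = ∑ j, c w j * u j := by
    intro w hw u hu
    have hx := Complex.slitPlane_ne_zero (hB.sl w hw u hu)
    rw [h w hw u hu, Complex.cpow_add _ _ hx, Complex.cpow_one, mul_assoc, Finset.sum_mul]
    congr 1
    refine Finset.sum_congr rfl fun j _ => ?_
    have := hB.nz u hu i0
    field_simp
    linear_combination (-w j) * h1 u hu i0 j
  intro u hu
  have h3 := entire_zero hB.op hB.ne (F := fun w => _) (by fun_prop)
      (fun w hw => quad_multi hB hl hw (h2 w hw) hu (Pi.single i1 1)) (Pi.single i1 (u i0) - Pi.single i0 (u i1))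
  simp only [sum_pair i0 i1 hi] at h3
  have hz : u i0 * u i1 - u i1 * u i0 = 0 := by ring
  rw [hz] at h3
  have hu0 := hB.nz u hu i0
  simp [hi, hu0, hs2, hs0] at h3
  ext j
  have := h1 u hu i0 j
  simpa [h3, hu0] using this

lemma alg_one (hn : 2 ≤ n) {B : Set (Fin n → ℂ)} (hB : GoodB B) {c d : (Fin n → ℂ) → (Fin n → ℂ)}
    (hd : DifferentiableOn ℂ d B)
    (h : ∀ w ∈ B, ∀ u ∈ B, ∑ j, c w j * u j = (∑ j, w j * u j) ^ (1 : ℂ) * ∑ j, w j * d u j) :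
    ∃ C : Fin n → ℂ, ∀ u ∈ B, d u = C := by
  have hdj : ∀ j, DifferentiableOn ℂ (fun u => d u j) B := fun j => differentiableOn_pi.1 hd j
  have h1 : ∀ u ∈ B, ∀ j, ∀ w : Fin n → ℂ, 2 * w j * (∑ k, w k * fderiv ℂ (fun u => d u k) u (Pi.single j 1)) +
      (∑ k, w k * u k) * (∑ k, w k * fderiv ℂ (fun u => fderiv ℂ (fun u => d u k) u (Pi.single j 1)) u (Pi.single j 1)) = 0 := by
    intro u hu j
    refine entire_zero hB.op hB.ne (by fun_prop) fun w hw => ?_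
    have h2 := alg_quad hB hd h hu (Pi.single j 1) hw
    have hx := Complex.slitPlane_ne_zero (hB.sl w hw u hu)
    have hy : ∑ k, w k * (Pi.single j 1 : Fin n → ℂ) k = w j := by simp [Pi.single_apply]
    rw [hy] at h2
    refine mul_left_cancel₀ hx ?_
    linear_combination h2
  have h3 : ∀ u ∈ B, ∀ i j, i ≠ j → u i * fderiv ℂ (fun u => d u j) u (Pi.single j 1) =
      u j * fderiv ℂ (fun u => d u i) u (Pi.single j 1) := by
    intro u hu i j hij
    have h2 := h1 u hu j (Pi.single j (u i) - Pi.single i (u j))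
    simp only [sum_pair i j hij] at h2
    have hui := hB.nz u hu i
    have hz : u i * u j - u j * u i = 0 := by ring
    rw [hz] at h2
    simp [Ne.symm hij, hui] at h2
    linear_combination h2
  have h4 : ∀ u ∈ B, ∀ i j, i ≠ j → fderiv ℂ (fun u => d u i) u (Pi.single j 1) = 0 ∧
      fderiv ℂ (fun u => d u j) u (Pi.single j 1) = 0 := by
    intro u hu i j hij
    have e1 := h1 u hu j (Pi.single i 1)
    have e2 := h1 u hu j (Pi.single j 1)
    have hui := hB.nz u hu i
    have huj := hB.nz u hu j
    simp [Pi.single_apply, hij.symm, hui] at e1 e2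
    have ev : (fun u => u i * fderiv ℂ (fun u => d u j) u (Pi.single j 1)) =ᶠ[nhds u] fun u =>
      u j * fderiv ℂ (fun u => d u i) u (Pi.single j 1) := by
      filter_upwards [hB.op.mem_nhds hu] with v hv using h3 v hv i j hij
    have f1 := ev.fderiv_eq (𝕜 := ℂ)
    have g1 : ∀ k, DifferentiableAt ℂ (fun u : Fin n → ℂ => u k) u := fun k => by fun_prop
    have g2 : ∀ k, DifferentiableAt ℂ (fun u => fderiv ℂ (fun u => d u k) u (Pi.single j 1)) u := fun k =>
      (differentiableOn_fderiv_apply hB.op (hdj k) _).differentiableAt (hB.op.mem_nhds hu)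
    rw [fderiv_fun_mul (g1 i) (g2 j), fderiv_fun_mul (g1 j) (g2 i)] at f1
    have f2 := congrArg (fun A : (Fin n → ℂ) →L[ℂ] ℂ => A (Pi.single j 1)) f1
    have f3 : ∀ k, fderiv ℂ (fun u : Fin n → ℂ => u k) u (Pi.single j 1) = (Pi.single j 1 : Fin n → ℂ) k := by
      intro k
      have : HasFDerivAt (fun u : Fin n → ℂ => u k) (ContinuousLinearMap.proj k : (Fin n → ℂ) →L[ℂ] ℂ) u :=
        (ContinuousLinearMap.proj k : (Fin n → ℂ) →L[ℂ] ℂ).hasFDerivAt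
      rw [this.fderiv]; rfl
    simp [f3, hij, e1] at f2
    have h5 := h3 u hu i j hij
    have h6 : fderiv ℂ (fun u => d u i) u (Pi.single j 1) = 0 := by
      refine mul_left_cancel₀ (mul_ne_zero (three_ne_zero (α := ℂ)) huj) ?_
      linear_combination u i * e2 - 2 * h5 - u j * f2
    refine ⟨h6, ?_⟩
    rw [h6, mul_zero] at h5
    exact (mul_eq_zero.1 h5).resolve_left hui
  obtain ⟨u0, hu0⟩ := hB.ne
  refine ⟨d u0, fun u hu => ?_⟩
  have hfd : ∀ v ∈ B, ∀ k, fderiv ℂ (fun u => d u k) v = 0 := by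
    intro v hv k
    ext η
    rw [pi_eq_sum_univ' η, map_sum]
    simp only [zero_apply, map_smul]
    refine Finset.sum_eq_zero fun j _ => ?_
    have : fderiv ℂ (fun u => d u k) v (Pi.single j 1) = 0 := by
      by_cases hkj : k = j
      · obtain ⟨i, hi⟩ : ∃ i : Fin n, i ≠ j := by
          have : Nontrivial (Fin n) := Fin.nontrivial_iff_two_le.2 hn
          exact exists_ne j
        rw [hkj]
        exact (h4 v hv i j hi).2
      · exact (h4 v hv k j hkj).1
    rw [this, smul_zero]
  ext k
  have := hB.op.is_const_of_fderiv_eq_zero hB.cv.isPreconnected (hdj k) (fun v hv => hfd v hv k) hu hu0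
  exact this

lemma exists_step {B : Set (Fin n → ℂ)} (hB : IsOpen B) {u0 : Fin n → ℂ} (hu0 : u0 ∈ B) (j : Fin n) :
    ∃ δ : ℂ, δ ≠ 0 ∧ u0 + δ • (Pi.single j 1 : Fin n → ℂ) ∈ B := by
  have hc : ContinuousAt (fun δ : ℂ => u0 + δ • (Pi.single j 1 : Fin n → ℂ)) 0 := by fun_prop
  have h1 : ∀ᶠ δ in nhds (0 : ℂ), u0 + δ • (Pi.single j 1 : Fin n → ℂ) ∈ B :=
    hc.eventually_mem (hB.mem_nhds (by simpa using hu0))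
  obtain ⟨δ, h2, h3⟩ := ((h1.filter_mono nhdsWithin_le_nhds).and
    (self_mem_nhdsWithin (s := {(0 : ℂ)}ᶜ))).exists
  exact ⟨δ, h3, h2⟩

lemma alg_zero {B : Set (Fin n → ℂ)} (hB : IsOpen B) (hne : B.Nonempty) {c d : (Fin n → ℂ) → (Fin n → ℂ)}
    {W : Set (Fin n → ℂ)}
    (h : ∀ w ∈ W, ∀ u ∈ B, ∑ j, c w j * u j = ∑ j, w j * d u j) :
    ∃ M : Fin n → Fin n → ℂ, ∀ w ∈ W, ∀ j, c w j = ∑ k, M j k * w k := by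
  obtain ⟨u0, hu0⟩ := hne
  choose δ hδ0 hδ using exists_step hB hu0
  refine ⟨fun j k => (d (u0 + δ j • (Pi.single j 1 : Fin n → ℂ)) k - d u0 k) / δ j, fun w hw j => ?_⟩
  have h1 := h w hw _ (hδ j)
  have h2 := h w hw _ hu0
  simp only [Pi.add_apply, Pi.smul_apply, smul_eq_mul, mul_add, Finset.sum_add_distrib, h2] at h1
  have h3 : ∑ x, c w x * (δ j * (Pi.single j 1 : Fin n → ℂ) x) = c w j * δ j := by
    simp [Pi.single_apply]
  rw [h3] at h1
  have h4 : ∑ k, (d (u0 + δ j • (Pi.single j 1 : Fin n → ℂ)) k - d u0 k) / δ j * w k =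
      (∑ k, w k * d (u0 + δ j • (Pi.single j 1 : Fin n → ℂ)) k - ∑ k, w k * d u0 k) / δ j := by
    rw [← Finset.sum_sub_distrib, Finset.sum_div]
    refine Finset.sum_congr rfl fun k _ => by ring
  rw [h4, ← h1, eq_div_iff (hδ0 j)]
  ring

end S5b

section S5c
variable {n : ℕ} {p : ℝ}

/-- the coordinates `λ_j = w_j^(1/p)` -/
noncomputable def lam (p : ℝ) (w : Fin n → ℂ) : Fin n → ℂ := fun j => Complex.exp (Complex.log (w j) / p)

/-- reference ball -/
noncomputable def Bset (n : ℕ) : Set (Fin n → ℂ) := Metric.ball (fun j : Fin n => (j.1 : ℂ) + 1) (1 / 4)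

lemma lam_ne_zero (w : Fin n → ℂ) (j : Fin n) : lam p w j ≠ 0 := Complex.exp_ne_zero _

lemma norm_lam_rpow (hp : 0 < p) {w : Fin n → ℂ} {j : Fin n} (hw : w j ≠ 0) :
    ‖lam p w j‖ ^ (2 * p) = ‖w j‖ ^ 2 := by
  have h0 : 0 < ‖w j‖ := norm_pos_iff.2 hw
  have h1 : (Complex.log (w j) / p).re = Real.log ‖w j‖ / p := by
    rw [Complex.div_ofReal_re, Complex.log_re]
  rw [lam, Complex.norm_exp, h1, ← Real.exp_mul]
  have : Real.log ‖w j‖ / p * (2 * p) = Real.log ‖w j‖ + Real.log ‖w j‖ := by field_simp; ring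
  rw [this, Real.exp_add, Real.exp_log h0]; ring

lemma lam_injective (hp : 0 < p) {w : Fin n → ℂ} (hw : ∀ j, w j ≠ 0)
    (hi : Function.Injective fun j => ‖w j‖) : Function.Injective (lam p w) := by
  intro a b hab
  have h1 := norm_lam_rpow hp (hw a)
  rw [hab, norm_lam_rpow hp (hw b)] at h1
  refine hi ?_
  show ‖w a‖ = ‖w b‖
  nlinarith [norm_pos_iff.2 (hw a), norm_pos_iff.2 (hw b)]

lemma mem_Bset {w : Fin n → ℂ} (hw : w ∈ Bset n) (j : Fin n) : ‖w j - ((j.1 : ℂ) + 1)‖ < 1 / 4 := by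
  have h1 := (dist_pi_lt_iff (by norm_num : (0 : ℝ) < 1 / 4)).1 (Metric.mem_ball.1 hw) j
  rwa [dist_eq_norm] at h1

lemma Bset_re {w : Fin n → ℂ} (hw : w ∈ Bset n) (j : Fin n) : 3 / 4 < (w j).re ∧ |(w j).im| < 1 / 4 := by
  have h1 := mem_Bset hw j
  have h2 := (Complex.abs_re_le_norm _).trans_lt h1
  have h3 := (Complex.abs_im_le_norm _).trans_lt h1
  simp at h2 h3
  refine ⟨?_, by simpa using h3⟩
  have := (abs_lt.1 h2).1
  have h5 : (0 : ℝ) ≤ (j.1 : ℝ) := Nat.cast_nonneg _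
  linarith

lemma Bset_ne_zero {w : Fin n → ℂ} (hw : w ∈ Bset n) (j : Fin n) : w j ≠ 0 := by
  intro h
  have := (Bset_re hw j).1
  rw [h] at this
  norm_num at this

lemma Bset_slit {w : Fin n → ℂ} (hw : w ∈ Bset n) (j : Fin n) : w j ∈ Complex.slitPlane := by
  have := (Bset_re hw j).1
  exact Or.inl (by linarith)

lemma Bset_inj {w : Fin n → ℂ} (hw : w ∈ Bset n) : Function.Injective fun j => ‖w j‖ := by
  intro a b hab
  have h1 : ∀ j : Fin n, |‖w j‖ - ((j.1 : ℝ) + 1)| < 1 / 4 := by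
    intro j
    have e : ‖((j.1 : ℂ) + 1)‖ = (j.1 : ℝ) + 1 := by
      rw [← Nat.cast_succ, Complex.norm_natCast]; simp
    have := abs_norm_sub_norm_le (w j) ((j.1 : ℂ) + 1)
    rw [e] at this
    exact this.trans_lt (mem_Bset hw j)
  have ha := abs_lt.1 (h1 a)
  have hb := abs_lt.1 (h1 b)
  simp only at hab
  rw [hab] at ha
  have h2 : (a.1 : ℝ) < b.1 + 1 := by linarith
  have h3 : (b.1 : ℝ) < a.1 + 1 := by linarith
  have h4 : a.1 < b.1 + 1 := by exact_mod_cast h2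
  have h5 : b.1 < a.1 + 1 := by exact_mod_cast h3
  ext; omega

lemma Bset_star {w : Fin n → ℂ} (hw : w ∈ Bset n) : star w ∈ Bset n := by
  rw [Bset, Metric.mem_ball, dist_pi_lt_iff (by norm_num)]
  intro j
  have h1 := mem_Bset hw j
  rw [dist_eq_norm, ← norm_star]
  simpa using h1

lemma Bset_good (hn : 2 ≤ n) : GoodB (Bset n) where
  op := Metric.isOpen_ball
  cv := convex_ball _ _
  ne := ⟨_, Metric.mem_ball_self (by norm_num)⟩
  nz := fun w hw j => Bset_ne_zero hw j
  sl := by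
    intro w hw u hu
    refine Or.inl ?_
    rw [Complex.re_sum]
    refine Finset.sum_pos (fun j _ => ?_) ⟨⟨0, by omega⟩, Finset.mem_univ _⟩
    obtain ⟨h1, h2⟩ := Bset_re hw j
    obtain ⟨h3, h4⟩ := Bset_re hu j
    rw [Complex.mul_re]
    have h5 := abs_mul (w j).im (u j).im
    have h6 := le_abs_self ((w j).im * (u j).im)
    have := abs_nonneg (w j).im
    have := abs_nonneg (u j).im
    nlinarith

lemma lam_inj_B (hp : 0 < p) {w : Fin n → ℂ} (hw : w ∈ Bset n) : Function.Injective (lam p w) :=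
  lam_injective hp (Bset_ne_zero hw) (Bset_inj hw)

lemma lam_diff {U : Set (Fin n → ℂ)} (hU : ∀ w ∈ U, ∀ j, w j ∈ Complex.slitPlane) :
    DifferentiableOn ℂ (lam (n := n) p) U := by
  refine differentiableOn_pi.2 fun j => ?_
  intro w hw
  have h1 : DifferentiableAt ℂ (fun w : Fin n → ℂ => w j) w := by fun_prop
  have h2 : DifferentiableAt ℂ (fun w : Fin n → ℂ => Complex.exp (Complex.log (w j) / p)) w :=
    (by simpa only [div_eq_mul_inv] using (h1.clog (hU w hw j)).mul_const ((p : ℂ)⁻¹) :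
      DifferentiableAt ℂ (fun w : Fin n → ℂ => Complex.log (w j) / p) w).cexp
  exact h2.differentiableWithinAt

lemma Xm_diff (hp : 0 < p) {c : ℝ} (hc : 0 < c) {X : (Fin n → ℂ) → (Fin n → ℂ)}
    (hX : DifferentiableOn ℂ X {z | rho p z < c}) (m : ℤ) : Differentiable ℂ (Xm X m) := by
  refine differentiable_pi.2 fun k => ?_
  exact wtZ_differentiable hp hc (differentiableOn_pi.1 hX k) _

lemma altPoly_diff {U : Set (Fin n → ℂ)} {Y : (Fin n → ℂ) → (Fin n → ℂ)} {f : (Fin n → ℂ) → ℂ}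
    (hY : DifferentiableOn ℂ Y U) (hf : DifferentiableOn ℂ f U) :
    DifferentiableOn ℂ (fun w => altPoly (Y w) (f w)) U := by
  unfold altPoly
  refine DifferentiableOn.fun_sum fun k _ => ?_
  have := differentiableOn_pi.1 hY k
  fun_prop

/-- the function `c_j(w)` -/
noncomputable def cf (p : ℝ) (X : (Fin n → ℂ) → (Fin n → ℂ)) (m : ℤ) (w : Fin n → ℂ) : Fin n → ℂ :=
  fun j => w j * aj (Xm X m (piMap n (lam p w))) (lam p w) j

lemma cf_diff (hp : 0 < p) {c : ℝ} (hc : 0 < c) {X : (Fin n → ℂ) → (Fin n → ℂ)}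
    (hX : DifferentiableOn ℂ X {z | rho p z < c}) (m : ℤ) : DifferentiableOn ℂ (cf p X m) (Bset n) := by
  have hl : DifferentiableOn ℂ (lam (n := n) p) (Bset n) := lam_diff fun w hw j => Bset_slit hw j
  have hlj : ∀ j, DifferentiableOn ℂ (fun w : Fin n → ℂ => lam p w j) (Bset n) := fun j =>
    differentiableOn_pi.1 hl j
  refine differentiableOn_pi.2 fun j => ?_
  unfold cf aj
  refine DifferentiableOn.mul (by fun_prop) (differentiableOn_div_holo ?_ ?_ ?_)
  · refine altPoly_diff ?_ (hlj j)
    exact ((Xm_diff hp hc hX m).comp differentiable_piMap).comp_differentiableOn hl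
  · refine (hlj j).mul (differentiableOn_prod_holo _ fun i => (hlj j).sub (hlj i))
  · intro w hw
    exact mul_ne_zero (lam_ne_zero w j) (prod_erase_ne_zero (lam_inj_B hp hw) j)

lemma diff_star_star {f : (Fin n → ℂ) → (Fin n → ℂ)} {U : Set (Fin n → ℂ)} (hU : IsOpen U)
    (hs : ∀ w ∈ U, star w ∈ U) (hf : DifferentiableOn ℂ f U) :
    DifferentiableOn ℂ (fun u => star (f (star u))) U := by
  intro u hu
  have h1 := (hf.differentiableAt (hU.mem_nhds (hs u hu)))
  have h2 := h1.star_star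
  rw [star_star] at h2
  exact h2.differentiableWithinAt

lemma polarized (hn : 2 ≤ n) (hp : 0 < p) {c : ℝ} (hc : 1 < c) {X : (Fin n → ℂ) → (Fin n → ℂ)}
    (hX : DifferentiableOn ℂ X {z | rho p z < c})
    (hγ : ∀ z, rho p z = 1 → ∃ γ : ℝ → (Fin n → ℂ), γ 0 = z ∧ (∀ θ, rho p (γ θ) = 1) ∧
        HasDerivAt γ (Complex.I • X z) 0) (m : ℤ) :
    ∀ w ∈ Bset n, ∀ u ∈ Bset n, ∑ j, cf p X m w j * u j =
      (∑ j, w j * u j) ^ (((m : ℝ) / p : ℝ) : ℂ) * ∑ j, w j * star (cf p X (-m) (star u)) j := by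
  have hB := Bset_good hn
  have hc0 : 0 < c := by linarith
  have hd := diff_star_star hB.op (fun w hw => Bset_star hw) (cf_diff hp hc0 hX (-m))
  have hcf := cf_diff hp hc0 hX m
  intro w hw u hu
  suffices hpol : (fun w u => ∑ j, cf p X m w j * u j -
      (∑ j, w j * u j) ^ (((m : ℝ) / p : ℝ) : ℂ) * ∑ j, w j * star (cf p X (-m) (star u)) j) w (star (star u)) = 0 by
    rw [star_star] at hpol
    exact sub_eq_zero.1 hpol
  refine polarization (n := n) (U := Bset n) (G := fun w u => ∑ j, cf p X m w j * u j -
    (∑ j, w j * u j) ^ (((m : ℝ) / p : ℝ) : ℂ) * ∑ j, w j * star (cf p X (-m) (star u)) j) hB.op hB.cv ?_ ?_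
    hw (Bset_star hu)
  · have hS : ∀ x ∈ {x : (Fin n → ℂ) × (Fin n → ℂ) | x.1 ∈ Bset n ∧ star x.2 ∈ Bset n}, x.2 ∈ Bset n := by
      intro x hx
      simpa using Bset_star hx.2
    have e1 : ∀ j, DifferentiableOn ℂ (fun x : (Fin n → ℂ) × (Fin n → ℂ) => cf p X m x.1 j)
        {x | x.1 ∈ Bset n ∧ star x.2 ∈ Bset n} := fun j =>
      (differentiableOn_pi.1 hcf j).comp differentiableOn_fst (fun x hx => hx.1)
    have e2 : ∀ j, DifferentiableOn ℂ (fun x : (Fin n → ℂ) × (Fin n → ℂ) => star (cf p X (-m) (star x.2)) j)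
        {x | x.1 ∈ Bset n ∧ star x.2 ∈ Bset n} := fun j =>
      (differentiableOn_pi.1 hd j).comp differentiableOn_snd hS
    refine DifferentiableOn.sub ?_ (DifferentiableOn.mul ?_ ?_)
    · refine DifferentiableOn.fun_sum fun j _ => (e1 j).mul (by fun_prop)
    · refine DifferentiableOn.cpow ?_ (differentiableOn_const _) (fun x hx => hB.sl _ hx.1 _ (hS x hx))
      fun_prop
    · refine DifferentiableOn.fun_sum fun j _ => DifferentiableOn.mul (by fun_prop) (e2 j)
  · intro w hw
    have hnz := Bset_ne_zero hw
    have hN : ((Nfun p (lam p w) : ℝ) : ℂ) = ∑ j, w j * star w j := by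
      rw [Nfun]
      push_cast
      refine Finset.sum_congr rfl fun j _ => ?_
      rw [Pi.star_apply, Complex.star_def, Complex.mul_conj, Complex.normSq_eq_norm_sq, ← norm_lam_rpow hp (hnz j)]
    have hNpos : 0 < Nfun p (lam p w) := by
      rw [Nfun]
      refine Finset.sum_pos (fun j _ => ?_) ⟨⟨0, by omega⟩, Finset.mem_univ _⟩
      exact Real.rpow_pos_of_pos (norm_pos_iff.2 (lam_ne_zero w j)) _
    have h1 := hm_id hp hc hX hγ m (lam_inj_B hp hw) (lam_ne_zero w) hNpos
    have h2 : ∀ m, hm p X m (lam p w) = ∑ j, cf p X m w j * star w j := by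
      intro m
      rw [hm]
      refine Finset.sum_congr rfl fun j _ => ?_
      rw [norm_lam_rpow hp (hnz j), ← Complex.normSq_eq_norm_sq, ← Complex.mul_conj, cf, Pi.star_apply,
        Complex.star_def]
      ring
    rw [h2, h2, Complex.ofReal_cpow hNpos.le, hN] at h1
    show _ - _ = _
    rw [h1, star_star, sub_eq_zero]
    congr 1
    rw [star_sum]
    refine Finset.sum_congr rfl fun j _ => ?_
    simp [mul_comm]

end S5c

section S5d
variable {n : ℕ} {p : ℝ}

lemma transfer (hp : 0 < p) {H : (Fin n → ℂ) → ℂ} (hH : Differentiable ℂ H)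
    (h : ∀ w ∈ Bset n, H (fun j => Complex.log (w j) / p) = 0) (μ : Fin n → ℂ) : H μ = 0 := by
  have hpc : (p : ℂ) ≠ 0 := by exact_mod_cast hp.ne'
  set μ0 : Fin n → ℂ := fun j => Complex.log ((j.1 : ℂ) + 1) / p with hμ0
  have hj : ∀ j : Fin n, (p : ℂ) * μ0 j = Complex.log ((j.1 : ℂ) + 1) := by
    intro j; simp only [hμ0]; field_simp
  have hj0 : ∀ j : Fin n, (j.1 : ℂ) + 1 ≠ 0 := fun j => Nat.cast_add_one_ne_zero _
  refine identity_holo isOpen_univ isPreconnected_univ hH.differentiableOn (Set.mem_univ μ0) ?_ μ (Set.mem_univ _)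
  have h1 : ∀ᶠ μ in nhds μ0, (fun j => Complex.exp (p * μ j)) ∈ Bset n := by
    have hc : Continuous (fun μ : Fin n → ℂ => fun j => Complex.exp (p * μ j)) := by fun_prop
    refine hc.continuousAt.eventually_mem (Metric.isOpen_ball.mem_nhds ?_)
    simp only [hj, Complex.exp_log (hj0 _)]
    exact Metric.mem_ball_self (by norm_num)
  have h2 : ∀ᶠ μ in nhds μ0, ∀ j : Fin n, ((p : ℂ) * μ j).im ∈ Set.Ioo (-Real.pi) Real.pi := by
    refine Filter.eventually_all.2 fun j => ?_
    have hc : Continuous (fun μ : Fin n → ℂ => ((p : ℂ) * μ j).im) := by fun_prop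
    refine hc.continuousAt.eventually_mem (isOpen_Ioo.mem_nhds ?_)
    simp only [hj, Complex.log_im]
    have : ((j.1 : ℂ) + 1).arg = 0 := by
      rw [← Nat.cast_succ]; exact Complex.natCast_arg
    rw [this]
    exact ⟨by linarith [Real.pi_pos], Real.pi_pos⟩
  filter_upwards [h1, h2] with μ hμ1 hμ2
  have := h _ hμ1
  convert this using 2
  ext j
  rw [Complex.log_exp (hμ2 j).1 (hμ2 j).2.le]
  field_simp

lemma transfer_lam (hp : 0 < p) {F : (Fin n → ℂ) → ℂ} (hF : Differentiable ℂ F)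
    (h : ∀ w ∈ Bset n, F (lam p w) = 0) (l : Fin n → ℂ) : F l = 0 := by
  have h1 := transfer hp (H := fun μ => F (fun j => Complex.exp (μ j)))
    (hF.comp (differentiable_pi.2 fun j => by fun_prop)) h
  refine identity_holo isOpen_univ isPreconnected_univ hF.differentiableOn
    (Set.mem_univ (fun _ => (1 : ℂ))) ?_ l (Set.mem_univ _)
  have h2 : ∀ᶠ l in nhds (fun _ : Fin n => (1 : ℂ)), ∀ j, l j ≠ 0 := by
    refine Filter.eventually_all.2 fun j => ?_
    have hc : Continuous (fun l : Fin n → ℂ => l j) := by fun_prop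
    exact hc.continuousAt.eventually_ne one_ne_zero
  filter_upwards [h2] with l hl
  have := h1 (fun j => Complex.log (l j))
  simpa only [Complex.exp_log (hl _)] using this

lemma limit_lemma (hp : 0 < p) (hp1 : p ≠ 1) {f P : ℂ → ℂ} {M S : ℂ} (hf : DifferentiableAt ℂ f 0)
    (hP : ContinuousAt P 0) (hP0 : P 0 ≠ 0)
    (h : ∀ ε : ℝ, 0 < ε → ((ε ^ p : ℝ) : ℂ) * f ε = ε * P ε * (M * ((ε ^ p : ℝ) : ℂ) + S)) : S = 0 := by
  have tof : Filter.Tendsto (fun ε : ℝ => (ε : ℂ)) (nhdsWithin 0 (Set.Ioi 0)) (nhds 0) := by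
    have : Filter.Tendsto (fun ε : ℝ => (ε : ℂ)) (nhds 0) (nhds ((0 : ℝ) : ℂ)) :=
      Complex.continuous_ofReal.continuousAt
    simpa using this.mono_left nhdsWithin_le_nhds
  have tpow : ∀ q : ℝ, 0 < q → Filter.Tendsto (fun ε : ℝ => ((ε ^ q : ℝ) : ℂ)) (nhdsWithin 0 (Set.Ioi 0)) (nhds 0) := by
    intro q hq
    have h1 : ContinuousAt (fun ε : ℝ => ε ^ q) 0 := Real.continuousAt_rpow_const _ _ (Or.inr hq.le)
    have h2 := (Complex.continuous_ofReal.continuousAt.comp h1).tendsto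
    simp only [Function.comp_def, Real.zero_rpow hq.ne', Complex.ofReal_zero] at h2
    exact h2.mono_left nhdsWithin_le_nhds
  have tP : Filter.Tendsto (fun ε : ℝ => P ε * (M * ((ε ^ p : ℝ) : ℂ) + S)) (nhdsWithin 0 (Set.Ioi 0))
      (nhds (P 0 * (M * 0 + S))) :=
    (hP.tendsto.comp tof).mul (((tpow p hp).const_mul M).add_const S)
  rw [mul_zero, zero_add] at tP
  suffices hs : P 0 * S = 0 by simpa [hP0] using hs
  rcases lt_or_gt_of_ne hp1 with hlt | hgt
  · have hf0 : f 0 = 0 := by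
      have t1 : Filter.Tendsto (fun ε : ℝ => f ε) (nhdsWithin 0 (Set.Ioi 0)) (nhds (f 0)) :=
        hf.continuousAt.tendsto.comp tof
      have t2 := (tpow (1 - p) (by linarith)).mul tP
      rw [zero_mul] at t2
      refine tendsto_nhds_unique (t1.congr' ?_) t2
      filter_upwards [self_mem_nhdsWithin] with ε hε
      have hε' : (0 : ℝ) < ε := hε
      have e1 := h ε hε'
      have e2 : ((ε ^ p : ℝ) : ℂ) ≠ 0 := by exact_mod_cast (Real.rpow_pos_of_pos hε' p).ne'
      refine mul_left_cancel₀ e2 ?_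
      rw [e1, Real.rpow_sub hε', Real.rpow_one]
      push_cast
      field_simp
    have hd : ContinuousAt (dslope f 0) 0 := continuousAt_dslope_same.2 hf
    have t1 := (tpow p hp).mul (hd.tendsto.comp tof)
    rw [zero_mul] at t1
    refine (tendsto_nhds_unique (t1.congr' ?_) tP).symm
    filter_upwards [self_mem_nhdsWithin] with ε hε
    have hε' : (0 : ℝ) < ε := hε
    have hεc : (ε : ℂ) ≠ 0 := by exact_mod_cast hε'.ne'
    have e1 := h ε hε'
    have e3 := sub_smul_dslope f 0 (ε : ℂ)
    rw [hf0, sub_zero, sub_zero, smul_eq_mul] at e3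
    rw [← e3] at e1
    refine mul_left_cancel₀ hεc ?_
    simp only [Function.comp_apply]
    linear_combination e1
  · have t1 := (tpow (p - 1) (by linarith)).mul (hf.continuousAt.tendsto.comp tof)
    rw [zero_mul] at t1
    refine (tendsto_nhds_unique (t1.congr' ?_) tP).symm
    filter_upwards [self_mem_nhdsWithin] with ε hε
    have hε' : (0 : ℝ) < ε := hε
    have hεc : (ε : ℂ) ≠ 0 := by exact_mod_cast hε'.ne'
    have e1 := h ε hε'
    refine mul_left_cancel₀ hεc ?_
    rw [← mul_assoc (ε : ℂ) (P ε), ← e1, Real.rpow_sub hε', Real.rpow_one]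
    simp only [Function.comp_apply]
    push_cast
    field_simp

lemma Xm_pi_diff (hp : 0 < p) {c : ℝ} (hc : 0 < c) {X : (Fin n → ℂ) → (Fin n → ℂ)}
    (hX : DifferentiableOn ℂ X {z | rho p z < c}) (m : ℤ) (j : Fin n) :
    Differentiable ℂ (fun l => altPoly (Xm X m (piMap n l)) (l j)) := by
  have h1 : Differentiable ℂ (fun l => Xm X m (piMap n l)) := (Xm_diff hp hc hX m).comp differentiable_piMap
  exact differentiableOn_univ.1 (altPoly_diff h1.differentiableOn (by fun_prop))

lemma denom_diff (j : Fin n) :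
    Differentiable ℂ (fun l : Fin n → ℂ => l j * ∏ i ∈ univ.erase j, (l j - l i)) := by
  refine differentiableOn_univ.1 (DifferentiableOn.mul (by fun_prop)
    (differentiableOn_prod_holo _ fun i => by fun_prop))

lemma cf_eq (hp : 0 < p) {X : (Fin n → ℂ) → (Fin n → ℂ)} {m : ℤ} {w : Fin n → ℂ} (hw : w ∈ Bset n) (j : Fin n)
    {r : ℂ} (h : cf p X m w j = r) : w j * altPoly (Xm X m (piMap n (lam p w))) (lam p w j) =
      (lam p w j * ∏ i ∈ univ.erase j, (lam p w j - lam p w i)) * r := by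
  rw [← h, cf, aj]
  have h1 := lam_ne_zero (p := p) w j
  have h2 := prod_erase_ne_zero (lam_inj_B hp hw) j
  field_simp

lemma key_limit (hp : 0 < p) (hp1 : p ≠ 1) {c : ℝ} (hc : 0 < c) {X : (Fin n → ℂ) → (Fin n → ℂ)}
    (hX : DifferentiableOn ℂ X {z | rho p z < c}) (m : ℤ) (j : Fin n) {M : Fin n → ℂ} {C : ℂ}
    (h : ∀ w ∈ Bset n, cf p X m w j = ∑ k, M k * w k + C) (r : Fin n → ℝ) (hr : ∀ k, 0 < r k) :
    C + ∑ k ∈ univ.erase j, M k * ((r k ^ p : ℝ) : ℂ) = 0 := by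
  have hpc : (p : ℂ) ≠ 0 := by exact_mod_cast hp.ne'
  have hexp : Differentiable ℂ (fun μ : Fin n → ℂ => fun j => Complex.exp (μ j)) :=
    differentiable_pi.2 fun j => by fun_prop
  have hH : ∀ μ : Fin n → ℂ, Complex.exp (p * μ j) * altPoly (Xm X m (piMap n (fun i => Complex.exp (μ i)))) (Complex.exp (μ j))
      - (Complex.exp (μ j) * ∏ i ∈ univ.erase j, (Complex.exp (μ j) - Complex.exp (μ i))) *
        (∑ k, M k * Complex.exp (p * μ k) + C) = 0 := by
    refine transfer hp ?_ ?_
    · refine Differentiable.sub (Differentiable.mul (by fun_prop) ((Xm_pi_diff hp hc hX m j).comp hexp))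
        (Differentiable.mul ((denom_diff j).comp hexp) ?_)
      fun_prop
    · intro w hw
      have e1 : ∀ k, Complex.exp (p * (Complex.log (w k) / p)) = w k := by
        intro k
        rw [mul_div_cancel₀ _ hpc, Complex.exp_log (Bset_ne_zero hw k)]
      simp only [e1]
      rw [sub_eq_zero]
      exact cf_eq hp hw j (h w hw)
  have hup : ∀ ε : ℂ, HasDerivAt (fun ε : ℂ => Function.update (fun k => (r k : ℂ)) j ε) (Pi.single j 1) ε :=
    fun ε => hasDerivAt_update _ _ _
  have hupd : Differentiable ℂ (fun ε : ℂ => Function.update (fun k => (r k : ℂ)) j ε) :=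
    fun ε => (hup ε).differentiableAt
  refine limit_lemma hp hp1 (M := M j)
    (f := fun ε => altPoly (Xm X m (piMap n (Function.update (fun k => (r k : ℂ)) j ε))) ((Function.update (fun k => (r k : ℂ)) j ε) j))
    (P := fun ε => ∏ i ∈ univ.erase j, (ε - r i)) ?_ ?_ ?_ ?_
  · exact ((Xm_pi_diff hp hc hX m j).comp hupd) 0
  · fun_prop
  · refine Finset.prod_ne_zero_iff.2 fun i _ => ?_
    have := (hr i).ne'
    simpa using this
  · intro ε hε
    have e1 := hH (fun k => ((Real.log (Function.update r j ε k) : ℝ) : ℂ))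
    have hpos : ∀ k, 0 < Function.update r j ε k := by
      intro k
      by_cases hk : k = j
      · subst hk; simpa using hε
      · simpa [hk] using hr k
    have e2 : ∀ k, Complex.exp ((Real.log (Function.update r j ε k) : ℝ) : ℂ) = Function.update (fun k => (r k : ℂ)) j ε k := by
      intro k
      rw [← Complex.ofReal_exp, Real.exp_log (hpos k)]
      by_cases hk : k = j
      · subst hk; simp
      · simp [hk]
    have e3 : ∀ k, Complex.exp (p * ((Real.log (Function.update r j ε k) : ℝ) : ℂ)) = ((Function.update r j ε k ^ p : ℝ) : ℂ) := by
      intro k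
      rw [Real.rpow_def_of_pos (hpos k), ← Complex.ofReal_mul, ← Complex.ofReal_exp, mul_comm]
    simp only [e2, e3] at e1
    rw [← Finset.add_sum_erase univ _ (Finset.mem_univ j)] at e1
    have e4 : ∑ k ∈ univ.erase j, M k * ((Function.update r j ε k ^ p : ℝ) : ℂ) = ∑ k ∈ univ.erase j, M k * ((r k ^ p : ℝ) : ℂ) :=
      Finset.sum_congr rfl fun k hk => by rw [Function.update_of_ne (Finset.ne_of_mem_erase hk)]
    have e5 : ∏ i ∈ univ.erase j, (Function.update (fun k => (r k : ℂ)) j (ε : ℂ) j - Function.update (fun k => (r k : ℂ)) j (ε : ℂ) i) =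
       ∏ i ∈ univ.erase j, ((ε : ℂ) - r i) :=
      Finset.prod_congr rfl fun k hk => by rw [Function.update_of_ne (Finset.ne_of_mem_erase hk), Function.update_self]
    rw [e4, e5] at e1
    simp only [Function.update_self] at e1 ⊢
    linear_combination e1

end S5d

section S5e
variable {n : ℕ} {p : ℝ}

lemma Xm_zero_of_cf (hp : 0 < p) {c : ℝ} (hc : 0 < c) {X : (Fin n → ℂ) → (Fin n → ℂ)}
    (hX : DifferentiableOn ℂ X {z | rho p z < c}) {m : ℤ} (h : ∀ w ∈ Bset n, cf p X m w = 0)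
    (z : Fin n → ℂ) : Xm X m z = 0 := by
  obtain ⟨l, rfl⟩ := piMap_surjective z
  ext k
  refine transfer_lam hp (F := fun l => Xm X m (piMap n l) k) ?_ ?_ l
  · exact differentiable_pi.1 ((Xm_diff hp hc hX m).comp differentiable_piMap) k
  · intro w hw
    have : Xm X m (piMap n (lam p w)) = 0 := by
      refine altPoly_eq_zero (lam_inj_B hp hw) fun j => ?_
      have h1 := cf_eq hp hw j (congrFun (h w hw) j)
      have := Bset_ne_zero hw j
      simpa [this] using h1
    rw [this]; rfl

lemma Xm_zero (hn : 2 ≤ n) (hp : 0 < p) (hp1 : p ≠ 1) {c : ℝ} (hc : 1 < c) {X : (Fin n → ℂ) → (Fin n → ℂ)}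
    (hX : DifferentiableOn ℂ X {z | rho p z < c})
    (hγ : ∀ z, rho p z = 1 → ∃ γ : ℝ → (Fin n → ℂ), γ 0 = z ∧ (∀ θ, rho p (γ θ) = 1) ∧
        HasDerivAt γ (Complex.I • X z) 0) {m : ℤ} (hm : 0 < m) :
    (∀ z, Xm X m z = 0) ∧ (∀ z, Xm X (-m) z = 0) := by
  have hc0 : 0 < c := by linarith
  have hB := Bset_good hn
  have hpol := polarized hn hp hc hX hγ m
  have hd := diff_star_star hB.op (fun w hw => Bset_star hw) (cf_diff hp hc0 hX (-m))
  have hmr : (0 : ℝ) < m := by exact_mod_cast hm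
  have hs : (0 : ℝ) < m / p := div_pos hmr hp
  have key : ∀ u ∈ Bset n, star (cf p X (-m) (star u)) = 0 := by
    by_cases hs1 : (m : ℝ) / p = 1
    · rw [hs1, Complex.ofReal_one] at hpol
      obtain ⟨C, hC⟩ := alg_one hn hB hd hpol
      have hC' : ∀ w ∈ Bset n, cf p X (-m) w = star C := by
        intro w hw
        have := hC _ (Bset_star hw)
        rw [star_star] at this
        rw [← this, star_star]
      have hC0 : star C = 0 := by
        ext j
        have := key_limit hp hp1 hc0 hX (-m) j (M := 0) (C := star C j)
          (fun w hw => by rw [hC' w hw]; simp) (fun _ => 1) (fun _ => one_pos)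
        simpa using this
      intro u hu
      rw [hC' _ (Bset_star hu), hC0, star_zero]
    · refine alg_generic hn hB hd (s := (((m : ℝ) / p : ℝ) : ℂ)) ?_ ?_ ?_ hpol
      · exact_mod_cast hs.ne'
      · exact_mod_cast hs1
      · have : (m : ℝ) / p + 1 ≠ 0 := by positivity
        exact_mod_cast this
  constructor
  · refine Xm_zero_of_cf hp hc0 hX fun w hw => ?_
    refine alg_c_zero hB fun u hu => ?_
    rw [hpol w hw u hu, key u hu]; simp
  · refine Xm_zero_of_cf hp hc0 hX fun w hw => ?_
    have := key _ (Bset_star hw)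
    rw [star_star] at this
    exact star_eq_zero.1 this

lemma Xm_at_zero (hn : 2 ≤ n) (hp : 0 < p) (hp1 : p ≠ 1) {c : ℝ} (hc : 1 < c) {X : (Fin n → ℂ) → (Fin n → ℂ)}
    (hX : DifferentiableOn ℂ X {z | rho p z < c})
    (hγ : ∀ z, rho p z = 1 → ∃ γ : ℝ → (Fin n → ℂ), γ 0 = z ∧ (∀ θ, rho p (γ θ) = 1) ∧
        HasDerivAt γ (Complex.I • X z) 0) : ∃ M : ℂ, ∀ z, Xm X 0 z = M • Eul z := by
  have hc0 : 0 < c := by linarith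
  have hB := Bset_good hn
  have hpol := polarized hn hp hc hX hγ 0
  obtain ⟨M, hM⟩ := alg_zero (c := cf p X 0) (d := fun u => star (cf p X (-0) (star u))) (W := Bset n) hB.op hB.ne (by
    intro w hw u hu
    have := hpol w hw u hu
    simpa using this)
  have hoff : ∀ j k, k ≠ j → M j k = 0 := by
    intro j k hkj
    have h1 := fun r hr => key_limit hp hp1 hc0 hX 0 j (M := M j) (C := 0) (fun w hw => by rw [hM w hw, add_zero]) r hr
    have h2 := h1 (fun _ => 1) (fun _ => one_pos)
    have h3 := h1 (Function.update (fun _ => 1) k 2) (by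
      intro i
      by_cases hi : i = k
      · subst hi; simp
      · simp [hi])
    have hk : k ∈ univ.erase j := by simp [hkj]
    rw [← Finset.add_sum_erase _ _ hk] at h2 h3
    have e : ∑ i ∈ (univ.erase j).erase k, M j i * ((Function.update (fun _ => (1 : ℝ)) k 2 i ^ p : ℝ) : ℂ) =
        ∑ i ∈ (univ.erase j).erase k, M j i * (((1 : ℝ) ^ p : ℝ) : ℂ) :=
      Finset.sum_congr rfl fun i hi => by rw [Function.update_of_ne (Finset.ne_of_mem_erase hi)]
    rw [e, Function.update_self] at h3
    have h4 : M j k * (((2 : ℝ) ^ p - 1 : ℝ) : ℂ) = 0 := by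
      push_cast
      simp only [Real.one_rpow] at h2 h3
      push_cast at h2 h3
      linear_combination h3 - h2
    have h5 : (2 : ℝ) ^ p - 1 ≠ 0 := by
      have := Real.one_lt_rpow (by norm_num : (1 : ℝ) < 2) hp
      linarith
    exact (mul_eq_zero.1 h4).resolve_right (by exact_mod_cast h5)
  have hall : ∀ j l, altPoly (Xm X 0 (piMap n l)) (l j) = M j j * (l j * ∏ i ∈ univ.erase j, (l j - l i)) := by
    intro j l
    rw [← sub_eq_zero]
    refine transfer_lam hp (F := fun l => altPoly (Xm X 0 (piMap n l)) (l j) - M j j * (l j * ∏ i ∈ univ.erase j, (l j - l i))) ?_ ?_ l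
    · exact (Xm_pi_diff hp hc0 hX 0 j).sub ((denom_diff j).const_mul _)
    · intro w hw
      have h1 : cf p X 0 w j = M j j * w j := by
        rw [hM w hw, Finset.sum_eq_single j]
        · intro k _ hk
          rw [hoff j k hk, zero_mul]
        · simp
      have h2 := cf_eq hp hw j h1
      refine mul_left_cancel₀ (Bset_ne_zero hw j) ?_
      linear_combination h2
  let i0 : Fin n := ⟨0, by omega⟩
  have hdiag : ∀ j, M j j = M i0 i0 := by
    intro j
    let l : Fin n → ℂ := fun k => (k.1 : ℂ) + 1
    have hl : Function.Injective l := by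
      intro a b hab
      simp only [l, add_left_inj, Nat.cast_inj] at hab
      exact Fin.ext hab
    have hl0 : ∀ j, l j ≠ 0 := fun j => Nat.cast_add_one_ne_zero _
    have h1 := hall j l
    have h2 := hall i0 (l ∘ Equiv.swap i0 j)
    rw [piMap_comp_perm] at h2
    have e1 : (l ∘ Equiv.swap i0 j) i0 = l j := by simp
    have e2 : ∏ i ∈ univ.erase i0, ((l ∘ Equiv.swap i0 j) i0 - (l ∘ Equiv.swap i0 j) i) = ∏ i ∈ univ.erase j, (l j - l i) := by
      rw [e1]
      refine Finset.prod_equiv (Equiv.swap i0 j) ?_ ?_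
      · intro i
        simp only [Finset.mem_erase, Finset.mem_univ, and_true]
        rw [Ne, Ne, Equiv.swap_apply_eq_iff, Equiv.swap_apply_right]
      · intro i _
        rfl
    rw [e2, e1, h1] at h2
    exact mul_right_cancel₀ (mul_ne_zero (hl0 j) (prod_erase_ne_zero hl j)) h2
  refine ⟨M i0 i0, fun z => ?_⟩
  obtain ⟨l, rfl⟩ := piMap_surjective z
  ext k
  rw [← sub_eq_zero]
  refine transfer_lam hp (F := fun l => Xm X 0 (piMap n l) k - (M i0 i0 • Eul (piMap n l)) k) ?_ ?_ l
  · refine Differentiable.sub (differentiable_pi.1 ((Xm_diff hp hc0 hX 0).comp differentiable_piMap) k) ?_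
    have h1 : Differentiable ℂ (M i0 i0 • (Eul ∘ piMap n)) :=
      (differentiable_Eul.comp differentiable_piMap).const_smul _
    exact differentiable_pi.1 h1 k
  · intro w hw
    have : Xm X 0 (piMap n (lam p w)) - M i0 i0 • Eul (piMap n (lam p w)) = 0 := by
      refine altPoly_eq_zero (lam_inj_B hp hw) fun j => ?_
      rw [altPoly_sub, altPoly_smul, ← fderiv_piMap_self, altPoly_fderiv_piMap, hall, hdiag, sub_self]
    exact congrFun this k

lemma field_eq (hn : 2 ≤ n) (hp : 0 < p) (hp1 : p ≠ 1) {c : ℝ} (hc : 1 < c) {X : (Fin n → ℂ) → (Fin n → ℂ)}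
    (hX : DifferentiableOn ℂ X {z | rho p z < c})
    (hγ : ∀ z, rho p z = 1 → ∃ γ : ℝ → (Fin n → ℂ), γ 0 = z ∧ (∀ θ, rho p (γ θ) = 1) ∧
        HasDerivAt γ (Complex.I • X z) 0) : ∃ M : ℂ, ∀ z, rho p z < c → X z = M • Eul z := by
  obtain ⟨M, hM⟩ := Xm_at_zero hn hp hp1 hc hX hγ
  refine ⟨M, fun z hz => ?_⟩
  ext k
  have h1 := wt_hasSum hp (differentiableOn_pi.1 hX k) hz
  have h2 : ∀ m : ℕ, wt (fun z => X z k) m z = Xm X ((m : ℤ) - k.1 - 1) z k := by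
    intro m
    rw [Xm, ← wtZ_natCast]
    congr 1; ring
  have h3 : HasSum (fun m => wt (fun z => X z k) m z) (wt (fun z => X z k) (k.1 + 1) z) := by
    refine hasSum_single _ fun m hm => ?_
    rw [h2]
    rcases lt_trichotomy ((m : ℤ) - k.1 - 1) 0 with h | h | h
    · have := (Xm_zero hn hp hp1 hc hX hγ (m := -((m : ℤ) - k.1 - 1)) (by omega)).2 z
      rw [neg_neg] at this
      rw [this]; rfl
    · omega
    · rw [(Xm_zero hn hp hp1 hc hX hγ h).1 z]; rfl
  rw [h1.unique h3, h2, ← hM]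
  congr 2; push_cast; ring

/-- the main output of this part -/
lemma aut_euler (hn : 2 ≤ n) (hp : 0 < p) (hp1 : p ≠ 1) {φ ψ : (Fin n → ℂ) → (Fin n → ℂ)} (h : AutPair p φ ψ) :
    ∃ M : ℂ, ∀ z, rho p z < 1 → fderiv ℂ φ z (Eul z) = M • Eul (φ z) := by
  obtain ⟨c, X, hc, hX, hXφ, hγ⟩ := exists_field hp h
  obtain ⟨M, hM⟩ := field_eq hn hp hp1 hc hX hγ
  refine ⟨M, fun z hz => ?_⟩
  have h1 := hXφ _ (h.mφ z hz)
  rw [h.l z hz, hM _ (by linarith [h.mφ z hz])] at h1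
  exact h1.symm

end S5e

section S5f
variable {n : ℕ} {p : ℝ}

lemma euler_ode {U : Set ℂ} (hU : IsOpen U) (hc : IsPreconnected U) (h0 : (0 : ℂ) ∈ U) {g : ℂ → ℂ} {a : ℂ}
    (hg : DifferentiableOn ℂ g U) (h : ∀ ζ ∈ U, ζ * deriv g ζ = a * g ζ) :
    (∀ ζ ∈ U, g ζ = 0) ∨ ∃ N : ℕ, a = N ∧ ∃ C, ∀ ζ ∈ U, g ζ = ζ ^ N * C := by
  have han := hg.analyticOnNhd hU
  by_cases hz : ∀ᶠ ζ in nhds (0 : ℂ), g ζ = 0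
  · left
    exact han.eqOn_zero_of_preconnected_of_eventuallyEq_zero hc h0 hz
  right
  obtain ⟨N, k, hk, hk0, hgk⟩ := (AnalyticAt.exists_eventuallyEq_pow_smul_nonzero_iff (han 0 h0)).2 hz
  simp only [sub_zero, smul_eq_mul] at hgk
  have hkd : ∀ᶠ ζ in nhds (0 : ℂ), DifferentiableAt ℂ k ζ :=
    hk.eventually_analyticAt.mono fun ζ hζ => hζ.differentiableAt
  have e1 : ∀ᶠ ζ in nhdsWithin (0 : ℂ) {0}ᶜ, ((N : ℂ) - a) * k ζ + ζ * deriv k ζ = 0 := by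
    filter_upwards [(hgk.eventually_nhds).filter_mono nhdsWithin_le_nhds, hkd.filter_mono nhdsWithin_le_nhds,
      mem_nhdsWithin_of_mem_nhds (hU.mem_nhds h0), self_mem_nhdsWithin] with ζ h1 h2 h3 h4
    have hζ : ζ ≠ 0 := h4
    have d1 : HasDerivAt g (N * ζ ^ (N - 1) * k ζ + ζ ^ N * deriv k ζ) ζ := by
      refine HasDerivAt.congr_of_eventuallyEq ?_ h1
      exact (hasDerivAt_pow N ζ).mul h2.hasDerivAt
    have := h ζ h3
    rw [d1.deriv, h1.self_of_nhds] at this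
    have e : (N : ℂ) * ζ ^ (N - 1) * ζ = N * ζ ^ N := by
      rcases N with _ | N
      · simp
      · simp [pow_succ]; ring
    refine mul_left_cancel₀ (pow_ne_zero N hζ) ?_
    linear_combination this - e * k ζ
  have hcont : ContinuousAt (fun ζ => ((N : ℂ) - a) * k ζ + ζ * deriv k ζ) 0 :=
    (hk.continuousAt.const_mul _).add (continuousAt_id.mul hk.deriv.continuousAt)
  have e2 : ((N : ℂ) - a) * k 0 + 0 * deriv k 0 = 0 :=
    tendsto_nhds_unique ((hcont.tendsto.mono_left nhdsWithin_le_nhds).congr' e1) tendsto_const_nhds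
  have hN : a = N := by
    have : ((N : ℂ) - a) = 0 := by simpa [hk0] using e2
    exact (sub_eq_zero.1 this).symm
  refine ⟨N, hN, k 0, ?_⟩
  have e3 : ∀ᶠ ζ in nhdsWithin (0 : ℂ) {0}ᶜ, deriv k ζ = 0 := by
    filter_upwards [e1, self_mem_nhdsWithin] with ζ h1 h2
    have hζ : ζ ≠ 0 := h2
    simpa [hN, hζ] using h1
  have e4 : deriv k 0 = 0 :=
    tendsto_nhds_unique ((hk.deriv.continuousAt.tendsto.mono_left nhdsWithin_le_nhds).congr' e3) tendsto_const_nhds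
  have e5 : ∀ᶠ ζ in nhds (0 : ℂ), deriv k ζ = 0 := by
    rw [eventually_nhdsWithin_iff] at e3
    filter_upwards [e3] with ζ hζ
    by_cases h : ζ = 0
    · rw [h, e4]
    · exact hζ h
  obtain ⟨r, hr, hball⟩ := Metric.eventually_nhds_iff_ball.1 (e5.and hkd)
  have e6 : ∀ ζ ∈ Metric.ball (0 : ℂ) r, k ζ = k 0 := by
    intro ζ hζ
    refine (convex_ball (0 : ℂ) r).is_const_of_fderivWithin_eq_zero (𝕜 := ℂ)
      (fun x hx => (hball x hx).2.differentiableWithinAt) ?_ hζ (Metric.mem_ball_self hr)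
    intro x hx
    rw [fderivWithin_of_isOpen Metric.isOpen_ball hx]
    ext
    simp [(hball x hx).1]
  have e7 : ∀ᶠ ζ in nhds (0 : ℂ), g ζ - ζ ^ N * k 0 = 0 := by
    filter_upwards [hgk, Metric.ball_mem_nhds 0 hr] with ζ h1 h2
    rw [h1, e6 ζ h2, sub_self]
  intro ζ hζ
  have hd : DifferentiableOn ℂ (fun ζ => g ζ - ζ ^ N * k 0) U := hg.sub (by fun_prop)
  exact sub_eq_zero.1 ((hd.analyticOnNhd hU).eqOn_zero_of_preconnected_of_eventuallyEq_zero hc h0 e7 hζ)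

lemma hasDerivAt_Tm_all (z : Fin n → ℂ) (ζ : ℂ) :
    HasDerivAt (fun t => Tm t z) (fun k => ((k.1 : ℂ) + 1) * ζ ^ k.1 * z k) ζ := by
  refine hasDerivAt_pi.2 fun k => ?_
  have := (hasDerivAt_pow (k.1 + 1) ζ).mul_const (z k)
  simpa [Tm] using this

lemma exists_first_ne (hn : 2 ≤ n) (hp : 0 < p) (k : Fin n) : ∃ z : Fin n → ℂ, rho p z < 1 ∧ z k ≠ 0 := by
  obtain ⟨t, ht, h⟩ := exists_scale (n := n) hp one_pos (fun _ => 1)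
  refine ⟨_, h, ?_⟩
  simp [Tm, ht.ne']

lemma slice_formula (hp : 0 < p) {φ ψ : (Fin n → ℂ) → (Fin n → ℂ)} (h : AutPair p φ ψ) {M : ℂ}
    (hM : ∀ z, rho p z < 1 → fderiv ℂ φ z (Eul z) = M • Eul (φ z)) {z : Fin n → ℂ} (hz : rho p z < 1) (k : Fin n) :
    (φ z k = 0 ∧ ∀ ζ : ℂ, ‖ζ‖ ≤ 1 → φ (Tm ζ z) k = 0) ∨ ∃ N : ℕ, M * ((k.1 : ℂ) + 1) = N ∧
      ∀ ζ : ℂ, ‖ζ‖ ≤ 1 → φ (Tm ζ z) k = ζ ^ N * φ z k := by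
  set U : Set ℂ := {ζ | rho p (Tm ζ z) < 1} with hUdef
  have hU : IsOpen U := (isOpen_rho_lt hp 1).preimage (differentiable_Tm_left z).continuous
  have hmem : ∀ ζ : ℂ, ‖ζ‖ ≤ 1 → ζ ∈ U := fun ζ hζ => rho_Tm_lt hp hz hζ
  have hstar : StarConvex ℝ (0 : ℂ) U := by
    rw [starConvex_zero_iff]
    intro ζ hζ a ha0 ha1
    have : rho p (Tm (a : ℂ) (Tm ζ z)) < 1 := rho_Tm_lt hp hζ (by
      rw [Complex.norm_real, Real.norm_of_nonneg ha0]; exact ha1)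
    rw [Tm_mul] at this
    show rho p (Tm (a • ζ) z) < 1
    rw [Complex.real_smul]; exact this
  have hc : IsPreconnected U := (hstar.isPathConnected (hmem 0 (by simp))).isConnected.isPreconnected
  have hd : ∀ ζ ∈ U, HasDerivAt (fun ζ => φ (Tm ζ z)) (fderiv ℂ φ (Tm ζ z) (fun k => ((k.1 : ℂ) + 1) * ζ ^ k.1 * z k)) ζ := by
    intro ζ hζ
    exact (h.dφ.differentiableAt ((isOpen_rho_lt hp 1).mem_nhds hζ)).hasFDerivAt.comp_hasDerivAt ζ (hasDerivAt_Tm_all z ζ)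
  have hdk := fun ζ hζ => hasDerivAt_pi.1 (hd ζ hζ) k
  have hode : ∀ ζ ∈ U, ζ * deriv (fun ζ => φ (Tm ζ z) k) ζ = (M * ((k.1 : ℂ) + 1)) * φ (Tm ζ z) k := by
    intro ζ hζ
    rw [(hdk ζ hζ).deriv]
    have h1 := congrFun (hM _ hζ) k
    have h2 : Eul (Tm ζ z) = ζ • (fun k : Fin n => ((k.1 : ℂ) + 1) * ζ ^ k.1 * z k) := by
      ext i
      simp [Eul, Tm, pow_succ]; ring
    rw [h2, map_smul] at h1
    simp only [Pi.smul_apply, smul_eq_mul, Eul] at h1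
    rw [h1]; ring
  rcases euler_ode hU hc (hmem 0 (by simp)) (fun ζ hζ => (hdk ζ hζ).differentiableAt.differentiableWithinAt) hode with h1 | ⟨N, hN, C, hC⟩
  · left
    refine ⟨?_, fun ζ hζ => h1 ζ (hmem ζ hζ)⟩
    have := h1 1 (hmem 1 (by simp))
    simpa [Tm_one] using this
  · right
    refine ⟨N, hN, fun ζ hζ => ?_⟩
    have e1 := hC 1 (hmem 1 (by simp))
    simp only [Tm_one, one_pow, one_mul] at e1
    rw [hC ζ (hmem ζ hζ), e1]

lemma aut_equivariant (hn : 2 ≤ n) (hp : 0 < p) (hp1 : p ≠ 1) {φ ψ : (Fin n → ℂ) → (Fin n → ℂ)} (h : AutPair p φ ψ)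
    {z : Fin n → ℂ} (hz : rho p z < 1) {ζ : ℂ} (hζ : ‖ζ‖ ≤ 1) : φ (Tm ζ z) = Tm ζ (φ z) := by
  obtain ⟨M, hM⟩ := aut_euler hn hp hp1 h
  let i0 : Fin n := ⟨0, by omega⟩
  obtain ⟨y, hy, hy0⟩ := exists_first_ne hn hp i0
  obtain ⟨N, hN⟩ : ∃ N : ℕ, M = N := by
    rcases slice_formula hp h hM (h.mψ y hy) i0 with h1 | ⟨N, hN, -⟩
    · rw [h.r y hy] at h1
      exact absurd h1.1 hy0
    · exact ⟨N, by simpa [i0] using hN⟩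
  have key : ∀ z, rho p z < 1 → ∀ ζ : ℂ, ‖ζ‖ ≤ 1 → φ (Tm ζ z) = Tm (ζ ^ N) (φ z) := by
    intro z hz ζ hζ
    ext k
    rcases slice_formula hp h hM hz k with h1 | ⟨N', hN', h2⟩
    · rw [h1.2 ζ hζ]; simp [Tm, h1.1]
    · have : N' = N * (k.1 + 1) := by
        rw [hN] at hN'
        exact_mod_cast hN'.symm
      rw [h2 ζ hζ, this]; simp [Tm, pow_mul]
  have hN1 : N = 1 := by
    have hN0 : N ≠ 0 := by
      intro h0
      have e1 := key y hy 0 (by simp)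
      rw [h0, pow_zero, Tm_one] at e1
      have e2 := h.injOn (show rho p (Tm 0 y) < 1 from rho_Tm_lt hp hy (by simp)) hy e1
      have := congrFun e2 i0
      simp [Tm] at this
      exact hy0 this.symm
    have hprim := Complex.isPrimitiveRoot_exp N hN0
    set ω := Complex.exp (2 * Real.pi * Complex.I / N) with hω
    have hnorm : ‖ω‖ = 1 := hprim.norm'_eq_one hN0
    have e1 := key y hy ω hnorm.le
    rw [hprim.pow_eq_one, Tm_one] at e1
    have e2 := h.injOn (show rho p (Tm ω y) < 1 from rho_Tm_lt hp hy hnorm.le) hy e1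
    have e3 := congrFun e2 i0
    have e4 : ω = 1 := by simpa [Tm, i0, hy0] using e3
    exact Nat.dvd_one.1 (hprim.dvd_of_pow_eq_one 1 (by rw [e4, one_pow]))
  have := key z hz ζ hζ
  rwa [hN1, pow_one] at this

lemma rho_le_of_aut (hn : 2 ≤ n) (hp : 0 < p) (hp1 : p ≠ 1) {φ ψ : (Fin n → ℂ) → (Fin n → ℂ)} (h : AutPair p φ ψ)
    {z : Fin n → ℂ} (hz : rho p z < 1) : rho p z ≤ rho p (φ z) := by
  by_contra hlt
  push Not at hlt
  have hr : 0 < rho p z := (rho_nonneg p (φ z)).trans_lt hlt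
  set t : ℝ := (rho p z) ^ (1 / (2 * p)) with ht
  have ht0 : 0 < t := Real.rpow_pos_of_pos hr _
  have ht1 : t ≤ 1 := Real.rpow_le_one hr.le hz.le (by positivity)
  have htn : ‖(t : ℂ)‖ = t := by rw [Complex.norm_real, Real.norm_of_nonneg ht0.le]
  have htp : t ^ (2 * p) = rho p z := by
    rw [ht, ← Real.rpow_mul hr.le]
    have : 1 / (2 * p) * (2 * p) = 1 := by field_simp
    rw [this, Real.rpow_one]
  have htc : (t : ℂ) ≠ 0 := by exact_mod_cast ht0.ne'
  have hinv : ‖(t : ℂ)⁻¹‖ ^ (2 * p) = (rho p z)⁻¹ := by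
    rw [norm_inv, htn, Real.inv_rpow ht0.le, htp]
  have h1 : rho p (Tm (t : ℂ)⁻¹ (φ z)) < 1 := by
    rw [rho_Tm, hinv, inv_mul_lt_iff₀ hr, mul_one]; exact hlt
  have h2 := h.mψ _ h1
  have h3 := aut_equivariant hn hp hp1 h h2 (ζ := t) (by rw [htn]; exact ht1)
  rw [h.r _ h1, Tm_inv htc] at h3
  have h4 := h.injOn (show rho p _ < 1 from rho_Tm_lt hp h2 (by rw [htn]; exact ht1)) hz h3
  have h5 := congrArg (rho p) h4
  rw [rho_Tm, htn, htp] at h5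
  have h6 : rho p (ψ (Tm (t : ℂ)⁻¹ (φ z))) = 1 := mul_left_cancel₀ hr.ne' (by rw [h5, mul_one])
  linarith

lemma rho_aut (hn : 2 ≤ n) (hp : 0 < p) (hp1 : p ≠ 1) {φ ψ : (Fin n → ℂ) → (Fin n → ℂ)} (h : AutPair p φ ψ)
    {z : Fin n → ℂ} (hz : rho p z < 1) : rho p (φ z) = rho p z := by
  refine le_antisymm ?_ (rho_le_of_aut hn hp hp1 h hz)
  have := rho_le_of_aut hn hp hp1 h.symm (h.mφ z hz)
  rwa [h.l z hz] at this

lemma aut_first (hn : 2 ≤ n) (hp : 0 < p) (hp1 : p ≠ 1) {φ ψ : (Fin n → ℂ) → (Fin n → ℂ)} (h : AutPair p φ ψ) :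
    ∃ c : ℂ, ∀ z, rho p z < 1 → φ z ⟨0, by omega⟩ = c * z ⟨0, by omega⟩ := by
  set i0 : Fin n := ⟨0, by omega⟩ with hi0
  refine ⟨fderiv ℂ φ 0 (Pi.single i0 1) i0, fun z hz => ?_⟩
  have h0 : rho p (0 : Fin n → ℂ) < 1 := by rw [rho_zero hp]; exact one_pos
  have d1 := hasDerivAt_Tm_all z 0
  have e1 : (fun k : Fin n => ((k.1 : ℂ) + 1) * 0 ^ k.1 * z k) = z i0 • (Pi.single i0 1 : Fin n → ℂ) := by
    ext k
    by_cases hk : k = i0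
    · subst hk; simp [hi0]
    · have : k.1 ≠ 0 := fun h => hk (Fin.ext h)
      simp [hk, this]
  rw [e1] at d1
  have d2 : HasFDerivAt φ (fderiv ℂ φ 0) (Tm 0 z) := by
    rw [Tm_zero]
    exact (h.dφ.differentiableAt ((isOpen_rho_lt hp 1).mem_nhds h0)).hasFDerivAt
  have d3 := hasDerivAt_pi.1 (d2.comp_hasDerivAt (0 : ℂ) d1) i0
  have d4 : HasDerivAt (fun ζ : ℂ => ζ * φ z i0) (φ z i0) 0 := by
    simpa using (hasDerivAt_id (0 : ℂ)).mul_const (φ z i0)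
  have d5 : (fun ζ : ℂ => ζ * φ z i0) =ᶠ[nhds 0] fun ζ => (φ ∘ fun t => Tm t z) ζ i0 := by
    filter_upwards [Metric.ball_mem_nhds (0 : ℂ) one_pos] with ζ hζ
    have : ‖ζ‖ ≤ 1 := by simpa using (mem_ball_zero_iff.1 hζ).le
    simp only [Function.comp_apply]
    rw [aut_equivariant hn hp hp1 h hz this]
    simp [Tm, hi0]
  have := d4.unique (d3.congr_of_eventuallyEq d5)
  rw [this]
  simp [mul_comm]

end S5f

section S6a
variable {n : ℕ} {p : ℝ}

/-- componentwise exponential -/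
noncomputable def cexpv (b : Fin n → ℂ) : Fin n → ℂ := fun j => Complex.exp (b j)

lemma cexpv_diff : Differentiable ℂ (cexpv (n := n)) := by
  refine differentiable_pi.2 fun j => ?_
  unfold cexpv
  fun_prop

lemma exists_local_inverse_E {b : Fin n → ℂ} (hb : Function.Injective (cexpv b)) :
    ∃ (g : (Fin n → ℂ) → (Fin n → ℂ)) (V : Set (Fin n → ℂ)), IsOpen V ∧ piMap n (cexpv b) ∈ V ∧ DifferentiableOn ℂ g V ∧
      g (piMap n (cexpv b)) = b ∧ (∀ y ∈ V, piMap n (cexpv (g y)) = y) := by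
  have hd : Differentiable ℂ (fun b : Fin n → ℂ => piMap n (cexpv b)) :=
    differentiable_piMap.comp cexpv_diff
  have hinj : Function.Injective (fderiv ℂ (fun b : Fin n → ℂ => piMap n (cexpv b)) b) := by
    have h1 : fderiv ℂ (fun b : Fin n → ℂ => piMap n (cexpv b)) b =
        (fderiv ℂ (piMap n) (cexpv b)).comp (fderiv ℂ cexpv b) :=
      fderiv_comp b (differentiable_piMap _) (cexpv_diff b)
    have h2 : ∀ v, fderiv ℂ cexpv b v = fun j => Complex.exp (b j) * v j := by
      intro v
      have : HasFDerivAt (cexpv (n := n)) (ContinuousLinearMap.pi fun j => Complex.exp (b j) • ContinuousLinearMap.proj (R := ℂ) (φ := fun _ : Fin n => ℂ) j) b := by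
        refine hasFDerivAt_pi.2 fun j => ?_
        exact (hasFDerivAt_apply j b).cexp
      rw [this.fderiv]
      ext j; simp
    rw [h1]
    intro u v huv
    have h3 : fderiv ℂ cexpv b u = fderiv ℂ cexpv b v := fderiv_piMap_injective hb huv
    rw [h2, h2] at h3
    ext j
    have := congrFun h3 j
    exact mul_left_cancel₀ (Complex.exp_ne_zero _) this
  obtain ⟨g, V, h1, h2, h3, h4, h5, -⟩ := exists_local_inverse (F := fun b : Fin n → ℂ => piMap n (cexpv b)) isOpen_univ hd.differentiableOn (Set.mem_univ b) hinj
  exact ⟨g, V, h1, h2, h3, h4, h5⟩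

lemma exists_generic_near (l : Fin n → ℂ) {S : Set (Fin n → ℂ)} (hS : S ∈ nhds l) :
    ∃ m ∈ S, Function.Injective m ∧ ∀ j, m j ≠ 0 := by
  let f : ℝ → Fin n → ℂ := fun ε j => l j + ε * ((j.1 : ℂ) + 1)
  have hf : Continuous f := by
    refine continuous_pi fun j => ?_
    simp only [f]; fun_prop
  have h0 : f 0 = l := by ext j; simp [f]
  have h1 : ∀ᶠ ε in nhds (0 : ℝ), f ε ∈ S := hf.continuousAt.preimage_mem_nhds (by rw [h0]; exact hS)
  have hinf : Set.Infinite {ε : ℝ | f ε ∈ S} := infinite_of_mem_nhds 0 h1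
  have hfin : Set.Finite ((⋃ x : Fin n × Fin n, {ε : ℝ | x.1 ≠ x.2 ∧ f ε x.1 = f ε x.2}) ∪ ⋃ j : Fin n, {ε : ℝ | f ε j = 0}) := by
    refine (Set.finite_iUnion fun x => ?_).union (Set.finite_iUnion fun j => ?_)
    · refine Set.Subsingleton.finite ?_
      rintro a ⟨hx, ha⟩ b ⟨-, hb⟩
      have : ((a : ℂ) - b) * ((x.1.1 : ℂ) - x.2.1) = 0 := by
        simp only [f] at ha hb
        linear_combination ha - hb
      rcases mul_eq_zero.1 this with h | h
      · exact_mod_cast sub_eq_zero.1 h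
      · exact absurd (Fin.ext (by exact_mod_cast sub_eq_zero.1 h)) hx
    · refine Set.Subsingleton.finite ?_
      intro a ha b hb
      have : ((a : ℂ) - b) * ((j.1 : ℂ) + 1) = 0 := by
        have ha' : f a j = 0 := ha
        have hb' : f b j = 0 := hb
        simp only [f] at ha' hb'
        linear_combination ha' - hb'
      rcases mul_eq_zero.1 this with h | h
      · exact_mod_cast sub_eq_zero.1 h
      · exact absurd h (Nat.cast_add_one_ne_zero j.1)
  obtain ⟨ε, h1, h2⟩ := hinf.exists_notMem_finite hfin
  refine ⟨f ε, h1, ?_, ?_⟩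
  · intro i j hij
    by_contra hne
    exact h2 (Or.inl (Set.mem_iUnion.2 ⟨(i, j), hne, hij⟩))
  · intro j hj
    exact h2 (Or.inr (Set.mem_iUnion.2 ⟨j, hj⟩))

/-- The local lift -/
lemma exists_lift (hp : 0 < p) {φ ψ : (Fin n → ℂ) → (Fin n → ℂ)} (h : AutPair p φ ψ) :
    ∃ (U : Set (Fin n → ℂ)) (a : (Fin n → ℂ) → (Fin n → ℂ)), IsOpen U ∧ Convex ℝ U ∧ U.Nonempty ∧
      (∀ w ∈ U, (∀ j, w j ∈ Complex.slitPlane) ∧ rho p (piMap n (lam p w)) < 1) ∧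
      DifferentiableOn ℂ a U ∧ (∀ w ∈ U, φ (piMap n (lam p w)) = piMap n (cexpv (a w))) ∧
      ∀ c : ℂ, (∀ w ∈ U, φ (piMap n (lam p w)) = Tm c (piMap n (lam p w))) →
        ∀ z, rho p z < 1 → φ z = Tm c z := by
  -- base point
  obtain ⟨t, ht, hNt⟩ := exists_scale (n := n) hp one_pos (piMap n (fun j => (j.1 : ℂ) + 1))
  let b0 : Fin n → ℂ := fun j => ((Real.log (t * (j.1 + 1)) : ℝ) : ℂ)
  have hb0 : cexpv b0 = (t : ℂ) • fun j : Fin n => (j.1 : ℂ) + 1 := by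
    ext j
    have : (0:ℝ) < t * (j.1 + 1) := by positivity
    simp only [cexpv, b0, ← Complex.ofReal_exp, Real.exp_log this]
    simp
  have hinj0 : Function.Injective (cexpv b0) := by
    rw [hb0]
    intro i j hij
    have htc : (t : ℂ) ≠ 0 := by exact_mod_cast ht.ne'
    simp only [Pi.smul_apply, smul_eq_mul] at hij
    have := mul_left_cancel₀ htc hij
    exact Fin.ext (by exact_mod_cast add_right_cancel this)
  have hρ0 : rho p (piMap n (cexpv b0)) < 1 := by
    rw [hb0, piMap_smul]; exact hNt
  set y0 := piMap n (cexpv b0) with hy0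
  obtain ⟨g, V, hVo, hy0V, hgd, hgy0, hgV⟩ := exists_local_inverse_E hinj0
  rw [← hy0] at hy0V hgy0
  -- good set of b
  let I : Set (Fin n → ℂ) := {b | ∀ j, |(p * b j).im| < Real.pi / 2}
  have hIo : IsOpen I := by
    have : I = ⋂ j, {b : Fin n → ℂ | |((p : ℂ) * b j).im| < Real.pi / 2} := by ext; simp [I]
    rw [this]
    refine isOpen_iInter_of_finite fun j => ?_
    refine isOpen_lt ?_ continuous_const
    exact (Complex.continuous_im.comp (by fun_prop)).abs
  have hb0I : b0 ∈ I := by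
    intro j
    simp only [b0, ← Complex.ofReal_mul, Complex.ofReal_im, abs_zero]
    positivity
  have hlamI : ∀ b ∈ I, ∀ j, Complex.log (Complex.exp (p * b j)) = p * b j := by
    intro b hb j
    have := abs_lt.1 (hb j)
    exact Complex.log_exp (by linarith [Real.pi_pos]) (by linarith [Real.pi_pos])
  have hpc : (p : ℂ) ≠ 0 := by exact_mod_cast hp.ne'
  let W : (Fin n → ℂ) → (Fin n → ℂ) := fun b => cexpv ((p : ℂ) • b)
  have hWc : Continuous W := cexpv_diff.continuous.comp (continuous_const_smul (p : ℂ))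
  have hlamW : ∀ b ∈ I, lam p (W b) = cexpv b := by
    intro b hb
    ext j
    simp only [lam, W, cexpv, Pi.smul_apply, smul_eq_mul]
    rw [hlamI b hb j, mul_div_cancel_left₀ _ hpc]
  have hslit : ∀ b ∈ I, ∀ j, W b j ∈ Complex.slitPlane := by
    intro b hb j
    rw [Complex.mem_slitPlane_iff_arg]
    refine ⟨?_, Complex.exp_ne_zero _⟩
    have h1 := congrArg Complex.im (hlamI b hb j)
    rw [Complex.log_im] at h1
    show Complex.arg (Complex.exp (p * b j)) ≠ _
    rw [h1]
    have := abs_lt.1 (hb j)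
    intro h2
    linarith [Real.pi_pos]
  have hD := isOpen_rho_lt (n := n) hp 1
  -- neighbourhood upstairs of y0
  have hgc : ContinuousAt g y0 := (hgd.continuousOn.continuousAt (hVo.mem_nhds hy0V))
  let S : Set (Fin n → ℂ) := V ∩ g ⁻¹' I ∩ {z | rho p z < 1}
  have hSo : IsOpen S := (hgd.continuousOn.isOpen_inter_preimage hVo hIo).inter hD
  have hy0S : y0 ∈ S := ⟨⟨hy0V, by rw [Set.mem_preimage, hgy0]; exact hb0I⟩, hρ0⟩
  obtain ⟨μ, hμ⟩ := piMap_surjective (φ y0)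
  have hnear : {m : Fin n → ℂ | rho p (piMap n m) < 1 ∧ ψ (piMap n m) ∈ S} ∈ nhds μ := by
    have c1 : ∀ᶠ y in nhds (φ y0), rho p y < 1 := hD.mem_nhds (h.mφ _ hρ0)
    have c2 : ContinuousAt ψ (φ y0) := h.dψ.continuousOn.continuousAt (hD.mem_nhds (h.mφ _ hρ0))
    have c3 : ∀ᶠ y in nhds (φ y0), ψ y ∈ S := c2.eventually (by rw [h.l _ hρ0]; exact hSo.mem_nhds hy0S)
    have c4 : Filter.Tendsto (piMap n) (nhds μ) (nhds (φ y0)) := by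
      rw [← hμ]; exact continuous_piMap.continuousAt
    exact c4.eventually (c1.and c3)
  obtain ⟨m, ⟨hm1, hm2⟩, hminj, hm0⟩ := exists_generic_near μ hnear
  let a0 : Fin n → ℂ := fun j => Complex.log (m j)
  have ha0 : cexpv a0 = m := by ext j; exact Complex.exp_log (hm0 j)
  obtain ⟨g', V', hVo', hV', hgd', hgy', hgV'⟩ := exists_local_inverse_E (b := a0) (by rw [ha0]; exact hminj)
  rw [ha0] at hV' hgy'
  set y1 := ψ (piMap n m) with hy1
  have hφy1 : φ y1 = piMap n m := h.r _ hm1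
  set b1 := g y1 with hb1
  have hb1I : b1 ∈ I := hm2.1.2
  have hE1 : piMap n (cexpv b1) = y1 := hgV _ hm2.1.1
  have hw1 : lam p (W b1) = cexpv b1 := hlamW _ hb1I
  -- open set around W b1
  let Sl : Set (Fin n → ℂ) := {w | ∀ j, w j ∈ Complex.slitPlane}
  have hSlo : IsOpen Sl := by
    have : Sl = ⋂ j, {w : Fin n → ℂ | w j ∈ Complex.slitPlane} := by ext; simp [Sl]
    rw [this]
    exact isOpen_iInter_of_finite fun j => Complex.isOpen_slitPlane.preimage (continuous_apply j)
  have hlamd : DifferentiableOn ℂ (lam (n := n) p) Sl := lam_diff fun w hw => hw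
  have hpl : DifferentiableOn ℂ (fun w => piMap n (lam p w)) Sl :=
    differentiable_piMap.differentiableOn.comp hlamd (Set.mapsTo_univ _ _)
  let S2 : Set (Fin n → ℂ) := Sl ∩ (fun w => piMap n (lam p w)) ⁻¹' {z | rho p z < 1}
  have hS2o : IsOpen S2 := hpl.continuousOn.isOpen_inter_preimage hSlo hD
  have hφpl : DifferentiableOn ℂ (fun w => φ (piMap n (lam p w))) S2 :=
    h.dφ.comp (hpl.mono Set.inter_subset_left) fun w hw => hw.2
  let S3 : Set (Fin n → ℂ) := S2 ∩ (fun w => φ (piMap n (lam p w))) ⁻¹' V'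
  have hS3o : IsOpen S3 := hφpl.continuousOn.isOpen_inter_preimage hS2o hVo'
  have hW1 : W b1 ∈ S3 := by
    have e : piMap n (lam p (W b1)) = y1 := by rw [hw1, hE1]
    refine ⟨⟨hslit _ hb1I, ?_⟩, ?_⟩
    · show rho p (piMap n (lam p (W b1))) < 1
      rw [e]; exact hm2.2
    · show φ (piMap n (lam p (W b1))) ∈ V'
      rw [e, hφy1]; exact hV'
  obtain ⟨r, hr, hball⟩ := Metric.isOpen_iff.1 hS3o _ hW1
  refine ⟨Metric.ball (W b1) r, fun w => g' (φ (piMap n (lam p w))), Metric.isOpen_ball, convex_ball _ _,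
    ⟨_, Metric.mem_ball_self hr⟩, fun w hw => ⟨(hball hw).1.1, (hball hw).1.2⟩, ?_, ?_, ?_⟩
  · exact hgd'.comp (hφpl.mono fun w hw => (hball hw).1) fun w hw => (hball hw).2
  · intro w hw
    exact (hgV' _ (hball hw).2).symm
  · intro c hc z hz
    have hloc : ∀ᶠ y in nhds y1, φ y = Tm c y := by
      have c1 : ContinuousAt g y1 := hgd.continuousOn.continuousAt (hVo.mem_nhds hm2.1.1)
      have c2 : ∀ᶠ y in nhds y1, W (g y) ∈ Metric.ball (W b1) r :=
        (hWc.continuousAt.comp c1).eventually (Metric.ball_mem_nhds _ hr)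
      filter_upwards [c2, hSo.mem_nhds hm2] with y h1 h2
      have := hc _ h1
      rwa [hlamW _ h2.1.2, hgV _ h2.1.1] at this
    ext k
    have hd : DifferentiableOn ℂ (fun z => φ z k - Tm c z k) {z | rho p z < 1} :=
      (differentiableOn_pi.1 h.dφ k).sub (differentiableOn_pi.1 (differentiable_Tm_right c).differentiableOn k)
    refine sub_eq_zero.1 (identity_holo hD (isPreconnected_rho_lt hp one_pos) hd hm2.2 ?_ z hz)
    filter_upwards [hloc] with y hy
    rw [hy, sub_self]

end S6a

section S6b
variable {n : ℕ} {p : ℝ}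

/-- norm preserving holomorphic maps are unitary -/
lemma exists_unitary {U : Set (Fin n → ℂ)} (hU : IsOpen U) (hc : Convex ℝ U) (hne : U.Nonempty)
    {L : (Fin n → ℂ) → (Fin n → ℂ)} (hL : DifferentiableOn ℂ L U)
    (h : ∀ w ∈ U, ∑ j, L w j * star (L w j) = ∑ j, w j * star (w j)) :
    ∃ A : Matrix (Fin n) (Fin n) ℂ, A.conjTranspose * A = 1 ∧ ∀ w ∈ U, L w = A.mulVec w := by
  have hpol : ∀ w ∈ U, ∀ u ∈ U, ∑ j, L w j * star (L u j) = ∑ j, w j * star (u j) := by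
    intro w hw u hu
    have hstar : DifferentiableOn ℂ (fun v : Fin n → ℂ => fun j => star (L (star v) j)) {v | star v ∈ U} := by
      intro v hv
      have hdL : DifferentiableAt ℂ L (star v) := hL.differentiableAt (hU.mem_nhds hv)
      have := hdL.star_star
      rw [star_star] at this
      exact this.differentiableWithinAt
    have := polarization (G := fun w v => ∑ j, L w j * star (L (star v) j) - ∑ j, w j * v j) hU hc (by
      refine DifferentiableOn.sub ?_ ?_
      · refine DifferentiableOn.fun_sum fun j _ => ?_
        refine DifferentiableOn.mul ?_ ?_
        · exact (differentiableOn_pi.1 hL j).comp differentiable_fst.differentiableOn fun x hx => hx.1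
        · exact (differentiableOn_pi.1 hstar j).comp differentiable_snd.differentiableOn fun x hx => hx.2
      · fun_prop) (by
      intro w hw
      simp only [star_star, Pi.star_apply]
      rw [h w hw, sub_self]) hw hu
    simp only [star_star, Pi.star_apply] at this
    exact sub_eq_zero.1 this
  obtain ⟨w0, hw0⟩ := hne
  choose δ hδ0 hδ using fun j => exists_step hU hw0 j
  let E : Fin n → (Fin n → ℂ) := fun k => w0 + δ k • Pi.single k 1
  have hdiff : ∀ w : Fin n → ℂ, ∀ k, ∑ j, w j * star (E k j) - ∑ j, w j * star (w0 j) = w k * star (δ k) := by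
    intro w k
    rw [← Finset.sum_sub_distrib, Finset.sum_eq_single k]
    · simp [E]; ring
    · intro j _ hj
      simp [E, hj]
    · simp
  let P : Matrix (Fin n) (Fin n) ℂ := fun k j => (star (δ k))⁻¹ * (star (L (E k) j) - star (L w0 j))
  have hPL : ∀ w ∈ U, P.mulVec (L w) = w := by
    intro w hw
    ext k
    have e1 := hpol w hw _ (hδ k)
    have e2 := hpol w hw _ hw0
    have e3 := hdiff w k
    have hs : star (δ k) ≠ 0 := star_ne_zero.2 (hδ0 k)
    simp only [Matrix.mulVec, dotProduct, P]
    have : ∑ j, (star (δ k))⁻¹ * (star (L (E k) j) - star (L w0 j)) * L w j =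
        (star (δ k))⁻¹ * (∑ j, L w j * star (L (E k) j) - ∑ j, L w j * star (L w0 j)) := by
      rw [← Finset.sum_sub_distrib, Finset.mul_sum]
      exact Finset.sum_congr rfl fun j _ => by ring
    rw [this, e2]
    have e1' : ∑ j, L w j * star (L (E k) j) = ∑ j, w j * star (E k j) := e1
    rw [e1', e3]
    field_simp
  let Q : Matrix (Fin n) (Fin n) ℂ := fun j k => (δ k)⁻¹ * (L (E k) j - L w0 j)
  have hPQ : P * Q = 1 := by
    ext i k
    have e1 := congrFun (hPL _ (hδ k)) i
    have e2 := congrFun (hPL _ hw0) i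
    simp only [Matrix.mulVec, dotProduct] at e1 e2
    rw [Matrix.mul_apply]
    have : ∑ j, P i j * Q j k = (δ k)⁻¹ * (∑ j, P i j * L (E k) j - ∑ j, P i j * L w0 j) := by
      rw [← Finset.sum_sub_distrib, Finset.mul_sum]
      exact Finset.sum_congr rfl fun j _ => by simp only [Q]; ring
    rw [this, e2]
    have e1' : ∑ j, P i j * L (E k) j = E k i := e1
    rw [e1']
    by_cases hik : i = k
    · subst hik; simp [E, hδ0]
    · simp [E, hik]
  have hQP : Q * P = 1 := mul_eq_one_comm.1 hPQ
  have hLQ : ∀ w ∈ U, L w = Q.mulVec w := by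
    intro w hw
    conv_rhs => rw [← hPL w hw]
    rw [Matrix.mulVec_mulVec, hQP, Matrix.one_mulVec]
  refine ⟨Q, ?_, hLQ⟩
  have hQ : Q.conjTranspose = P := by
    have : Q.conjTranspose * 1 = P := by
      ext k j
      rw [mul_one, Matrix.conjTranspose_apply]
      simp [Q, P]
    simpa using this
  rw [hQ, hPQ]

/-- monomial unitary matrices -/
lemma exists_perm_of_monomial {A : Matrix (Fin n) (Fin n) ℂ} (hA : A.conjTranspose * A = 1)
    (hm : ∀ j k l, k ≠ l → A j k ≠ 0 → A j l = 0) :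
    ∃ σ : Equiv.Perm (Fin n), (∀ j k, k ≠ σ j → A j k = 0) ∧ ∀ j, A j (σ j) * star (A j (σ j)) = 1 := by
  have hA' : A * A.conjTranspose = 1 := mul_eq_one_comm.1 hA
  have hex : ∀ j, ∃ k, A j k ≠ 0 := by
    intro j
    by_contra hcon
    push Not at hcon
    have := congrFun (congrFun hA' j) j
    simp [Matrix.mul_apply, hcon] at this
  choose σ hσ using hex
  have hz : ∀ j k, k ≠ σ j → A j k = 0 := fun j k hk => hm j (σ j) k hk.symm (hσ j)
  have hone : ∀ j, A j (σ j) * star (A j (σ j)) = 1 := by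
    intro j
    have := congrFun (congrFun hA' j) j
    rw [Matrix.mul_apply, Finset.sum_eq_single (σ j)] at this
    · simpa [Matrix.conjTranspose_apply] using this
    · intro k _ hk
      rw [hz j k hk, zero_mul]
    · simp
  have hinj : Function.Injective σ := by
    intro i j hij
    by_contra hne
    have := congrFun (congrFun hA' i) j
    rw [Matrix.mul_apply, Finset.sum_eq_single (σ i)] at this
    · rw [Matrix.conjTranspose_apply, Matrix.one_apply_ne hne] at this
      rcases mul_eq_zero.1 this with h | h
      · exact hσ i h
      · rw [star_eq_zero, hij] at h
        exact hσ j h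
    · intro k _ hk
      rw [hz i k hk, zero_mul]
    · simp
  exact ⟨Equiv.ofBijective σ (Finite.injective_iff_bijective.1 hinj), hz, hone⟩

end S6b

section S6c
variable {n : ℕ} {p : ℝ}

lemma hasDerivAt_exp_lift (hp : 0 < p) {U : Set (Fin n → ℂ)} (hU : IsOpen U) {a : (Fin n → ℂ) → (Fin n → ℂ)}
    (ha : DifferentiableOn ℂ a U) {A : Matrix (Fin n) (Fin n) ℂ}
    (hA : ∀ w ∈ U, ∀ j, Complex.exp (p * a w j) = A.mulVec w j) {w : Fin n → ℂ} (hw : w ∈ U) (s : ℂ) (j l : Fin n) :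
    HasDerivAt (fun t : ℂ => Complex.exp (s * a (w + t • Pi.single l 1) j))
      (s / p * (A j l * Complex.exp ((s - p) * a w j))) 0 := by
  have hpc : (p : ℂ) ≠ 0 := by exact_mod_cast hp.ne'
  have hline : HasDerivAt (fun t : ℂ => w + t • (Pi.single l 1 : Fin n → ℂ)) (Pi.single l 1) 0 := by
    simpa using ((hasDerivAt_id (0 : ℂ)).smul_const (Pi.single l 1 : Fin n → ℂ)).const_add w
  have h0 : w + (0 : ℂ) • (Pi.single l 1 : Fin n → ℂ) = w := by simp
  have hd : HasFDerivAt a (fderiv ℂ a w) (w + (0 : ℂ) • (Pi.single l 1 : Fin n → ℂ)) := by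
    rw [h0]; exact (ha.differentiableAt (hU.mem_nhds hw)).hasFDerivAt
  have h1 := hasDerivAt_pi.1 (hd.comp_hasDerivAt (0 : ℂ) hline) j
  set D := fderiv ℂ a w (Pi.single l 1) j with hD
  have hev : ∀ᶠ t : ℂ in nhds 0, w + t • (Pi.single l 1 : Fin n → ℂ) ∈ U :=
    hline.continuousAt.eventually (by simpa using hU.mem_nhds hw)
  have h2 : HasDerivAt (fun t : ℂ => A.mulVec (w + t • Pi.single l 1) j) (A j l) 0 := by
    have e : (fun t : ℂ => A.mulVec (w + t • Pi.single l 1) j) = fun t => A.mulVec w j + t * A j l := by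
      ext t
      rw [Matrix.mulVec_add, Matrix.mulVec_smul]
      simp
    rw [e]
    simpa using ((hasDerivAt_id (0 : ℂ)).mul_const (A j l)).const_add (A.mulVec w j)
  have h3 : HasDerivAt (fun t : ℂ => Complex.exp (p * a (w + t • Pi.single l 1) j)) (A j l) 0 := by
    refine h2.congr_of_eventuallyEq ?_
    filter_upwards [hev] with t ht
    exact hA _ ht j
  have h4 : HasDerivAt (fun t : ℂ => Complex.exp (p * a (w + t • Pi.single l 1) j))
      (Complex.exp (p * a w j) * (p * D)) 0 := by
    have := (h1.const_mul (p : ℂ)).cexp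
    simpa using this
  have h5 := h4.unique h3
  have h6 : HasDerivAt (fun t : ℂ => Complex.exp (s * a (w + t • Pi.single l 1) j))
      (Complex.exp (s * a w j) * (s * D)) 0 := by
    have := (h1.const_mul s).cexp
    simpa using this
  convert h6 using 1
  rw [← h5]
  have : Complex.exp (s * a w j) = Complex.exp ((s - p) * a w j) * Complex.exp (p * a w j) := by
    rw [← Complex.exp_add]; ring_nf
  rw [this]
  field_simp

lemma diff_identity (hp : 0 < p) {U : Set (Fin n → ℂ)} (hU : IsOpen U) {a b : (Fin n → ℂ) → (Fin n → ℂ)}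
    (ha : DifferentiableOn ℂ a U) (hb : DifferentiableOn ℂ b U) {A : Matrix (Fin n) (Fin n) ℂ}
    (hA : ∀ w ∈ U, ∀ j, Complex.exp (p * a w j) = A.mulVec w j)
    (hB : ∀ w ∈ U, ∀ j, Complex.exp (p * b w j) = w j) {s : ℂ} (hs : s ≠ 0) {α β : Fin n → ℂ}
    (h : ∀ w ∈ U, ∑ j, α j * Complex.exp (s * a w j) = ∑ j, β j * Complex.exp (s * b w j)) (l : Fin n) :
    ∀ w ∈ U, ∑ j, α j * A j l * Complex.exp ((s - p) * a w j) = β l * Complex.exp ((s - p) * b w l) := by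
  intro w hw
  have hpc : (p : ℂ) ≠ 0 := by exact_mod_cast hp.ne'
  have h1 := HasDerivAt.fun_sum (u := Finset.univ) fun j _ => (hasDerivAt_exp_lift hp hU ha hA hw s j l).const_mul (α j)
  have h2 := HasDerivAt.fun_sum (u := Finset.univ) fun j _ =>
    (hasDerivAt_exp_lift (A := 1) hp hU hb (by simpa using hB) hw s j l).const_mul (β j)
  have hev : ∀ᶠ t : ℂ in nhds 0, w + t • (Pi.single l 1 : Fin n → ℂ) ∈ U := by
    have hc : Continuous fun t : ℂ => w + t • (Pi.single l 1 : Fin n → ℂ) := by fun_prop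
    exact hc.continuousAt.eventually (by simpa using hU.mem_nhds hw)
  have h3 := (h1.congr_of_eventuallyEq (hev.mono fun t ht => (h _ ht).symm)).unique h2
  have h4 : ∑ i, β i * (s / (p : ℂ) * ((1 : Matrix (Fin n) (Fin n) ℂ) i l * Complex.exp ((s - p) * b w i))) =
      β l * (s / (p : ℂ) * ((1 : Matrix (Fin n) (Fin n) ℂ) l l * Complex.exp ((s - p) * b w l))) :=
    Finset.sum_eq_single l (by
      intro j _ hj
      simp [Matrix.one_apply_ne hj]) (by simp)
  rw [h4] at h3
  have hsp : s / p ≠ 0 := div_ne_zero hs hpc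
  refine mul_left_cancel₀ hsp ?_
  rw [Finset.mul_sum]
  rw [Matrix.one_apply_eq, one_mul] at h3
  calc _ = ∑ j, α j * (s / p * (A j l * Complex.exp ((s - p) * a w j))) := by
        refine Finset.sum_congr rfl fun j _ => by ring
    _ = _ := by rw [h3]; ring

lemma second_identity (hp : 0 < p) (hp1 : p ≠ 1) {U : Set (Fin n → ℂ)} (hU : IsOpen U) {a b : (Fin n → ℂ) → (Fin n → ℂ)}
    (ha : DifferentiableOn ℂ a U) (hb : DifferentiableOn ℂ b U) {A : Matrix (Fin n) (Fin n) ℂ}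
    (hu : A.conjTranspose * A = 1)
    (hA : ∀ w ∈ U, ∀ j, Complex.exp (p * a w j) = A.mulVec w j)
    (hB : ∀ w ∈ U, ∀ j, Complex.exp (p * b w j) = w j) {c : ℂ}
    (h : ∀ w ∈ U, ∑ j, Complex.exp (a w j) = c * ∑ j, Complex.exp (b w j)) :
    ∀ w ∈ U, ∀ j k, A j k * Complex.exp ((1 - 2 * p) * a w j) = c * star (A j k) * Complex.exp ((1 - 2 * p) * b w k) := by
  have hp1' : (1 : ℂ) - p ≠ 0 := sub_ne_zero.2 (by exact_mod_cast hp1.symm)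
  have e1 := fun l => diff_identity hp hU ha hb hA hB (s := 1) one_ne_zero (α := fun _ => 1) (β := fun _ => c)
    (by simpa [Finset.mul_sum] using h) l
  have e2 : ∀ k l, ∀ w ∈ U, ∑ j, A j k * A j l * Complex.exp ((1 - p - p) * a w j) =
      (Pi.single k c : Fin n → ℂ) l * Complex.exp ((1 - p - p) * b w l) := by
    intro k l
    refine diff_identity hp hU ha hb hA hB hp1' (α := fun j => A j k) (β := Pi.single k c) ?_ l
    intro w hw
    have := e1 k w hw
    have e0 : ∑ j, (Pi.single k c : Fin n → ℂ) j * Complex.exp ((1 - p) * b w j) = c * Complex.exp ((1 - p) * b w k) := by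
      rw [Finset.sum_eq_single k (by intro j _ hj; simp [hj]) (by simp)]
      simp
    rw [e0]
    simpa using this
  intro w hw j k
  have hu' : A * A.conjTranspose = 1 := mul_eq_one_comm.1 hu
  have e3 : (1 : ℂ) - 2 * p = 1 - p - p := by ring
  rw [e3]
  -- sum over l of star (A j l) * e2 k l
  have e4 : ∑ l, star (A j l) * ∑ i, A i k * A i l * Complex.exp ((1 - p - p) * a w i) =
      ∑ l, star (A j l) * ((Pi.single k c : Fin n → ℂ) l * Complex.exp ((1 - p - p) * b w l)) :=
    Finset.sum_congr rfl fun l _ => by rw [e2 k l w hw]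
  rw [Finset.sum_eq_single (s := Finset.univ) (f := fun l => star (A j l) * ((Pi.single k c : Fin n → ℂ) l * Complex.exp ((1 - p - p) * b w l))) k
    (by intro l _ hl; simp [hl]) (by simp)] at e4
  have e5 : ∑ l, star (A j l) * ∑ i, A i k * A i l * Complex.exp ((1 - p - p) * a w i) =
      ∑ i, A i k * Complex.exp ((1 - p - p) * a w i) * ∑ l, A i l * star (A j l) := by
    simp only [Finset.mul_sum]
    rw [Finset.sum_comm]
    exact Finset.sum_congr rfl fun i _ => Finset.sum_congr rfl fun l _ => by ring
  have e6 : ∀ i, ∑ l, A i l * star (A j l) = (1 : Matrix (Fin n) (Fin n) ℂ) i j := by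
    intro i
    rw [← hu', Matrix.mul_apply]
    rfl
  rw [e5] at e4
  simp only [e6] at e4
  rw [Finset.sum_eq_single j (by intro i _ hi; simp [Matrix.one_apply_ne hi]) (by simp)] at e4
  simp only [Matrix.one_apply_eq, mul_one, Pi.single_eq_same] at e4
  rw [e4]; ring

lemma monomial_of_ne_half (hp : 0 < p) (hp2 : p ≠ 1 / 2) {U : Set (Fin n → ℂ)} (hU : IsOpen U) (hne : U.Nonempty)
    {a b : (Fin n → ℂ) → (Fin n → ℂ)}
    (ha : DifferentiableOn ℂ a U) (hb : DifferentiableOn ℂ b U) {A : Matrix (Fin n) (Fin n) ℂ}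
    (hA : ∀ w ∈ U, ∀ j, Complex.exp (p * a w j) = A.mulVec w j)
    (hB : ∀ w ∈ U, ∀ j, Complex.exp (p * b w j) = w j) {c : ℂ}
    (h : ∀ w ∈ U, ∀ j k, A j k * Complex.exp ((1 - 2 * p) * a w j) = c * star (A j k) * Complex.exp ((1 - 2 * p) * b w k)) :
    ∀ j k l, k ≠ l → A j k ≠ 0 → A j l = 0 := by
  intro j k l hkl hjk
  have hs : (1 : ℂ) - 2 * p ≠ 0 := by
    intro h0
    apply hp2
    have : (1 : ℝ) - 2 * p = 0 := by exact_mod_cast h0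
    linarith
  obtain ⟨w, hw⟩ := hne
  have := diff_identity hp hU ha hb hA hB hs (α := Pi.single j (A j k)) (β := Pi.single k (c * star (A j k))) (by
    intro w hw
    have e1 : ∑ i, (Pi.single j (A j k) : Fin n → ℂ) i * Complex.exp ((1 - 2 * p) * a w i) =
        A j k * Complex.exp ((1 - 2 * p) * a w j) := by
      rw [Finset.sum_eq_single j (by intro i _ hi; simp [hi]) (by simp)]
      simp
    have e2 : ∑ i, (Pi.single k (c * star (A j k)) : Fin n → ℂ) i * Complex.exp ((1 - 2 * p) * b w i) =
        c * star (A j k) * Complex.exp ((1 - 2 * p) * b w k) := by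
      rw [Finset.sum_eq_single k (by intro i _ hi; simp [hi]) (by simp)]
      simp
    rw [e1, e2]
    exact h w hw j k) l w hw
  rw [Finset.sum_eq_single j (by intro i _ hi; simp [hi]) (by simp)] at this
  simpa [hkl.symm, hjk, Complex.exp_ne_zero] using this

end S6c

section S6d
variable {n : ℕ}

/-- componentwise square -/
def sqv (w : Fin n → ℂ) : Fin n → ℂ := fun j => w j ^ 2

lemma sqv_diff : Differentiable ℂ (sqv (n := n)) := by
  refine differentiable_pi.2 fun j => ?_
  unfold sqv
  fun_prop

lemma Nfun_sqv (w : Fin n → ℂ) : Nfun (1 / 2) (sqv w) = Nfun 1 w := by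
  unfold Nfun sqv
  refine Finset.sum_congr rfl fun j _ => ?_
  rw [norm_pow]
  norm_num

lemma half_extend {φ ψ : (Fin n → ℂ) → (Fin n → ℂ)} (h : AutPair (1 / 2) φ ψ)
    {A : Matrix (Fin n) (Fin n) ℂ} {U : Set (Fin n → ℂ)} (hU : IsOpen U) (hne : U.Nonempty)
    (hUr : ∀ w ∈ U, rho (1 / 2) (piMap n (sqv w)) < 1)
    (hφ : ∀ w ∈ U, φ (piMap n (sqv w)) = piMap n (sqv (A.mulVec w))) :
    ∀ w, rho (1 / 2) (piMap n (sqv w)) < 1 → φ (piMap n (sqv w)) = piMap n (sqv (A.mulVec w)) := by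
  have hset : {w : Fin n → ℂ | rho (1 / 2) (piMap n (sqv w)) < 1} = {w | Nfun 1 w < 1} := by
    ext w
    show rho (1 / 2) (piMap n (sqv w)) < 1 ↔ Nfun 1 w < 1
    rw [rho_piMap, Nfun_sqv]
  intro w hw
  ext k
  have hps : Differentiable ℂ fun w : Fin n → ℂ => piMap n (sqv w) := differentiable_piMap.comp sqv_diff
  have hAd : Differentiable ℂ fun w : Fin n → ℂ => A.mulVec w := by
    refine differentiable_pi.2 fun j => ?_
    simp only [Matrix.mulVec, dotProduct]
    fun_prop
  have hd : DifferentiableOn ℂ (fun w => φ (piMap n (sqv w)) k - piMap n (sqv (A.mulVec w)) k)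
      {w : Fin n → ℂ | rho (1 / 2) (piMap n (sqv w)) < 1} := by
    refine DifferentiableOn.sub ?_ ?_
    · exact differentiableOn_pi.1 (h.dφ.comp hps.differentiableOn fun w hw => hw) k
    · exact (differentiable_pi.1 (hps.comp hAd) k).differentiableOn
  obtain ⟨w1, hw1⟩ := hne
  refine sub_eq_zero.1 (identity_holo (f := fun w => φ (piMap n (sqv w)) k - piMap n (sqv (A.mulVec w)) k) (z0 := w1)
    ((isOpen_rho_lt (by norm_num) 1).preimage hps.continuous) ?_ hd (hUr w1 hw1) ?_ w hw)
  · show IsPreconnected {w : Fin n → ℂ | rho (1 / 2) (piMap n (sqv w)) < 1}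
    rw [hset]
    exact isPreconnected_Nfun_lt one_pos one_pos
  · filter_upwards [hU.mem_nhds hw1] with v hv
    rw [hφ v hv, sub_self]

lemma half_rows {φ : (Fin n → ℂ) → (Fin n → ℂ)} {A : Matrix (Fin n) (Fin n) ℂ}
    (hφ : ∀ w, rho (1 / 2) (piMap n (sqv w)) < 1 → φ (piMap n (sqv w)) = piMap n (sqv (A.mulVec w)))
    (g : (Fin n → ℂ) →ₗ[ℂ] (Fin n → ℂ)) (hg : ∀ w, piMap n (sqv (g w)) = piMap n (sqv w)) (j : Fin n) :
    ∃ i, ∃ ε : ℂ, (ε = 1 ∨ ε = -1) ∧ ∀ w, A.mulVec (g w) j = ε * A.mulVec w i := by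
  -- linear functionals
  let R : Fin n → (Fin n → ℂ) →ₗ[ℂ] ℂ := fun i => (LinearMap.proj i).comp A.mulVecLin
  let Sg : Bool → ℂ := fun b => if b then 1 else -1
  let S : Fin n × Bool → Submodule ℂ (Fin n → ℂ) := fun x => LinearMap.ker ((R j).comp g - Sg x.2 • R x.1)
  have hball : ∀ w, rho (1 / 2) (piMap n (sqv w)) < 1 → ∃ x, w ∈ S x := by
    intro w hw
    have h1 := hφ w hw
    have h2 := hφ (g w) (by rw [hg]; exact hw)
    rw [hg, h1] at h2
    have h3 := piMap_eq_multiset h2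
    have h4 : sqv (A.mulVec (g w)) j ∈ Multiset.map (sqv (A.mulVec w)) univ.val := by
      rw [h3]
      exact Multiset.mem_map_of_mem _ (Finset.mem_univ j)
    obtain ⟨i, -, hi⟩ := Multiset.mem_map.1 h4
    rcases sq_eq_sq_iff_eq_or_eq_neg.1 hi with h5 | h5
    · refine ⟨(i, true), ?_⟩
      rw [LinearMap.mem_ker]
      simp [R, Sg, h5]
    · refine ⟨(i, false), ?_⟩
      rw [LinearMap.mem_ker]
      simp [R, Sg, h5]
  have hcov : ⋃ x, (S x : Set (Fin n → ℂ)) = Set.univ := by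
    refine Set.eq_univ_of_forall fun w => ?_
    obtain ⟨t, ht, hr⟩ := exists_scale (n := n) (p := 1 / 2) (by norm_num) one_pos (piMap n (sqv w))
    set s : ℝ := Real.sqrt t
    have hs : 0 < s := Real.sqrt_pos.2 ht
    have hsq : (s : ℂ) ^ 2 = t := by
      rw [← Complex.ofReal_pow, Real.sq_sqrt ht.le]
    have e1 : sqv ((s : ℂ) • w) = (t : ℂ) • sqv w := by
      ext k
      simp [sqv, mul_pow, hsq]
    obtain ⟨x, hx⟩ := hball ((s : ℂ) • w) (by rw [e1, piMap_smul]; exact hr)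
    have hsc : (s : ℂ) ≠ 0 := by exact_mod_cast hs.ne'
    exact Set.mem_iUnion.2 ⟨x, ((S x).smul_mem_iff hsc).1 hx⟩
  obtain ⟨⟨i, b⟩, hx⟩ := Subspace.exists_eq_top_of_iUnion_eq_univ hcov
  refine ⟨i, Sg b, ?_, fun w => ?_⟩
  · cases b <;> simp [Sg]
  · have : w ∈ S (i, b) := by rw [hx]; trivial
    rw [LinearMap.mem_ker] at this
    simpa [R, sub_eq_zero] using this

lemma half_inner {φ : (Fin n → ℂ) → (Fin n → ℂ)} {A : Matrix (Fin n) (Fin n) ℂ} (hu : A.conjTranspose * A = 1)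
    (hφ : ∀ w, rho (1 / 2) (piMap n (sqv w)) < 1 → φ (piMap n (sqv w)) = piMap n (sqv (A.mulVec w)))
    (g : (Fin n → ℂ) →ₗ[ℂ] (Fin n → ℂ)) (hg : ∀ w, piMap n (sqv (g w)) = piMap n (sqv w)) (j : Fin n) :
    ∃ ε : ℂ, (ε = 0 ∨ ε = 1 ∨ ε = -1) ∧ ∑ k, A.mulVec (g (Pi.single k 1)) j * star (A j k) = ε := by
  obtain ⟨i, ε, hε, h⟩ := half_rows hφ g hg j
  have hu' : A * A.conjTranspose = 1 := mul_eq_one_comm.1 hu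
  have h1 : ∑ k, A.mulVec (g (Pi.single k 1)) j * star (A j k) = ε * (1 : Matrix (Fin n) (Fin n) ℂ) i j := by
    rw [← hu', Matrix.mul_apply, Finset.mul_sum]
    refine Finset.sum_congr rfl fun k _ => ?_
    rw [h, Matrix.conjTranspose_apply]
    simp [mul_assoc]
  refine ⟨_, ?_, h1⟩
  by_cases hij : i = j
  · subst hij
    right
    simpa using hε
  · left
    simp [Matrix.one_apply_ne hij]

lemma half_monomial (hn : 3 ≤ n) {φ : (Fin n → ℂ) → (Fin n → ℂ)} {A : Matrix (Fin n) (Fin n) ℂ} (hu : A.conjTranspose * A = 1)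
    (hφ : ∀ w, rho (1 / 2) (piMap n (sqv w)) < 1 → φ (piMap n (sqv w)) = piMap n (sqv (A.mulVec w))) :
    ∀ j k l, k ≠ l → A j k ≠ 0 → A j l = 0 := by
  intro j
  have hu' : A * A.conjTranspose = 1 := mul_eq_one_comm.1 hu
  let x : Fin n → ℝ := fun k => ‖A j k‖ ^ 2
  have hx : ∀ k, A j k * star (A j k) = (x k : ℂ) := by
    intro k
    rw [Complex.star_def, Complex.mul_conj, Complex.normSq_eq_norm_sq]
  have hx0 : ∀ k, 0 ≤ x k := fun k => sq_nonneg _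
  have hxA : ∀ k, x k = 0 ↔ A j k = 0 := by
    intro k; simp [x]
  have hsum : ∑ k, x k = 1 := by
    have := congrFun (congrFun hu' j) j
    rw [Matrix.mul_apply] at this
    simp only [Matrix.conjTranspose_apply, hx, Matrix.one_apply_eq] at this
    exact_mod_cast this
  -- flips
  have hflip : ∀ k, x k = 0 ∨ x k = 1 / 2 ∨ x k = 1 := by
    intro k
    let g : (Fin n → ℂ) →ₗ[ℂ] (Fin n → ℂ) := LinearMap.pi fun q => (if q = k then (-1 : ℂ) else 1) • LinearMap.proj q
    have hgq : ∀ w q, g w q = (if q = k then (-1 : ℂ) else 1) * w q := fun w q => rfl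
    obtain ⟨ε, hε, h⟩ := half_inner hu hφ g (by
      intro w
      congr 1
      ext q
      simp only [sqv, hgq]
      split_ifs <;> simp) j
    have e1 : ∀ q, A.mulVec (g (Pi.single q 1)) j = (if q = k then (-1 : ℂ) else 1) * A j q := by
      intro q
      have : g (Pi.single q 1) = (if q = k then (-1 : ℂ) else 1) • Pi.single q 1 := by
        ext r
        rw [hgq]
        by_cases hr : r = q
        · subst hr; simp
        · simp [hr]
      rw [this, Matrix.mulVec_smul]
      simp
    have e2 : ∑ q, A.mulVec (g (Pi.single q 1)) j * star (A j q) = ((1 - 2 * x k : ℝ) : ℂ) := by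
      have e3 : ∀ q, A.mulVec (g (Pi.single q 1)) j * star (A j q) = (x q : ℂ) - if q = k then 2 * (x q : ℂ) else 0 := by
        intro q
        rw [e1, mul_assoc, hx]
        split_ifs <;> ring
      rw [Finset.sum_congr rfl fun q _ => e3 q, Finset.sum_sub_distrib, Finset.sum_ite_eq' , if_pos (Finset.mem_univ k),
        ← Complex.ofReal_sum, hsum]
      push_cast; ring
    rw [e2] at h
    rcases hε with h0 | h0 | h0
    · right; left
      rw [h0] at h
      have : 1 - 2 * x k = 0 := by exact_mod_cast h
      linarith
    · left
      rw [h0] at h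
      have : 1 - 2 * x k = 1 := by exact_mod_cast h
      linarith
    · right; right
      rw [h0] at h
      have : 1 - 2 * x k = -1 := by exact_mod_cast h
      linarith
  intro k l hkl hk
  by_contra hl
  have hkp : 0 < x k := lt_of_le_of_ne (hx0 k) fun h => hk ((hxA k).1 h.symm)
  have hlp : 0 < x l := lt_of_le_of_ne (hx0 l) fun h => hl ((hxA l).1 h.symm)
  have hsub : ∀ m, m ≠ k → m ≠ l → x k + x l + x m ≤ 1 := by
    intro m hmk hml
    rw [← hsum]
    have : ∑ q ∈ ({k, l, m} : Finset (Fin n)), x q ≤ ∑ q, x q :=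
      Finset.sum_le_univ_sum_of_nonneg hx0
    rw [Finset.sum_insert (by simp [hkl, hmk.symm]), Finset.sum_insert (by simp [hml.symm]), Finset.sum_singleton] at this
    linarith
  have hk2 : 1 / 2 ≤ x k := by rcases hflip k with h | h | h <;> linarith
  have hl2 : 1 / 2 ≤ x l := by rcases hflip l with h | h | h <;> linarith
  obtain ⟨m, hm⟩ : ∃ m : Fin n, m ∉ ({k, l} : Finset (Fin n)) := by
    by_contra hcon
    push Not at hcon
    have h1 : (Finset.univ : Finset (Fin n)) ⊆ {k, l} := fun q _ => hcon q
    have h2 := (Finset.card_le_card h1).trans Finset.card_le_two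
    simp at h2
    omega
  have hmk : m ≠ k := by rintro rfl; simp at hm
  have hml : m ≠ l := by rintro rfl; simp at hm
  have hz : ∀ q, q ≠ k → q ≠ l → A j q = 0 := by
    intro q h1 h2
    rw [← hxA]
    linarith [hsub q h1 h2, hx0 q]
  have hxl : x l = 1 / 2 := by linarith [hsub m hmk hml, hx0 m]
  let τ := Equiv.swap k m
  let g : (Fin n → ℂ) →ₗ[ℂ] (Fin n → ℂ) := LinearMap.funLeft ℂ ℂ τ
  obtain ⟨ε, hε, h⟩ := half_inner hu hφ g (by
    intro w
    exact piMap_comp_perm (sqv w) τ) j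
  have e1 : ∀ q, A.mulVec (g (Pi.single q 1)) j = A j (τ q) := by
    intro q
    have : g (Pi.single q 1) = Pi.single (τ q) 1 := by
      ext r
      simp only [g, LinearMap.funLeft_apply]
      by_cases hr : r = τ q
      · subst hr; simp [τ]
      · have : τ r ≠ q := by
          intro h0; apply hr; rw [← h0]; simp [τ]
        simp [hr, this]
    rw [this]; simp
  have e2 : ∑ q, A.mulVec (g (Pi.single q 1)) j * star (A j q) = (x l : ℂ) := by
    rw [Finset.sum_eq_single l]
    · rw [e1]
      have : τ l = l := Equiv.swap_apply_of_ne_of_ne hkl.symm hml.symm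
      rw [this, hx]
    · intro q _ hq
      by_cases hqk : q = k
      · rw [e1, hqk]
        have : τ k = m := Equiv.swap_apply_left k m
        rw [this, hz m hmk hml, zero_mul]
      · rw [hz q hqk hq]; simp
    · simp
  rw [e2, hxl] at h
  rcases hε with h0 | h0 | h0 <;> rw [h0] at h <;> norm_num at h

end S6d

section S6e
variable {n : ℕ} {p : ℝ}

/-- componentwise logarithm divided by `p` -/
noncomputable def blog (p : ℝ) (w : Fin n → ℂ) : Fin n → ℂ := fun j => Complex.log (w j) / p

lemma exists_rotation (hn : 2 ≤ n) (hp : 0 < p) (hp1 : p ≠ 1) (hpn : ¬(p = 1 / 2 ∧ n = 2))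
    {φ ψ : (Fin n → ℂ) → (Fin n → ℂ)} (h : AutPair p φ ψ) :
    ∃ c : ℂ, ‖c‖ = 1 ∧ ∀ z, rho p z < 1 → φ z = Tm c z := by
  have hpc : (p : ℂ) ≠ 0 := by exact_mod_cast hp.ne'
  obtain ⟨c, hc⟩ := aut_first hn hp hp1 h
  obtain ⟨U, a, hU, hconv, hne, hUs, ha, hlift, hext⟩ := exists_lift hp h
  have hw0 : ∀ w ∈ U, ∀ j, w j ≠ 0 := fun w hw j => Complex.slitPlane_ne_zero ((hUs w hw).1 j)
  -- the logarithm of the source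
  have hb : DifferentiableOn ℂ (blog (n := n) p) U := by
    refine differentiableOn_pi.2 fun j => ?_
    intro w hw
    have h1 : DifferentiableAt ℂ (fun w : Fin n → ℂ => w j) w := by fun_prop
    exact ((h1.clog ((hUs w hw).1 j)).mul_const ((p : ℂ)⁻¹)).differentiableWithinAt
  have hB : ∀ w ∈ U, ∀ j, Complex.exp (p * blog p w j) = w j := by
    intro w hw j
    rw [blog, mul_div_cancel₀ _ hpc, Complex.exp_log (hw0 w hw j)]
  have hlam : ∀ w, lam (n := n) p w = cexpv (blog p w) := fun w => rfl
  -- unitary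
  let L : (Fin n → ℂ) → (Fin n → ℂ) := fun w j => Complex.exp (p * a w j)
  have hLd : DifferentiableOn ℂ L U := by
    refine differentiableOn_pi.2 fun j => ?_
    exact ((differentiableOn_pi.1 ha j).const_mul (p : ℂ)).cexp
  have hLn : ∀ w ∈ U, ∑ j, L w j * star (L w j) = ∑ j, w j * star (w j) := by
    intro w hw
    have h1 := rho_aut hn hp hp1 h (hUs w hw).2
    rw [hlift w hw, rho_piMap, rho_piMap] at h1
    have h2 : ∀ z : ℂ, z * star z = ((‖z‖ ^ 2 : ℝ) : ℂ) := by
      intro z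
      rw [Complex.star_def, Complex.mul_conj, Complex.normSq_eq_norm_sq]
    simp only [h2]
    rw [← Complex.ofReal_sum, ← Complex.ofReal_sum]
    congr 1
    have h3 : Nfun p (lam p w) = ∑ j, ‖w j‖ ^ 2 :=
      Finset.sum_congr rfl fun j _ => norm_lam_rpow hp (hw0 w hw j)
    rw [← h3, ← h1]
    refine Finset.sum_congr rfl fun j _ => ?_
    simp only [L, cexpv, Complex.norm_exp]
    rw [← Real.exp_mul, ← Real.exp_nat_mul]
    congr 1
    simp
    ring
  obtain ⟨A, hu, hAL⟩ := exists_unitary hU hconv hne hLd hLn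
  have hA : ∀ w ∈ U, ∀ j, Complex.exp (p * a w j) = A.mulVec w j := fun w hw j => congrFun (hAL w hw) j
  -- first coordinate
  have hpi0 : ∀ l : Fin n → ℂ, piMap n l ⟨0, by omega⟩ = ∑ j, l j := by
    intro l
    simp [piMap, Finset.powersetCard_one]
  have hsum : ∀ w ∈ U, ∑ j, Complex.exp (a w j) = c * ∑ j, Complex.exp (blog p w j) := by
    intro w hw
    have h1 := hc _ (hUs w hw).2
    rw [hlift w hw, hpi0, hpi0] at h1
    exact h1
  have h2 := second_identity hp hp1 hU ha hb hu hA hB hsum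
  -- monomial
  have hmono : ∀ j k l, k ≠ l → A j k ≠ 0 → A j l = 0 := by
    by_cases hp2 : p = 1 / 2
    · have hn3 : 3 ≤ n := by
        have : n ≠ 2 := fun h0 => hpn ⟨hp2, h0⟩
        omega
      subst hp2
      have hsq : ∀ w ∈ U, lam (1 / 2) w = sqv w := by
        intro w hw
        ext j
        have := hB w hw j
        rw [sqv, ← this, ← Complex.exp_nat_mul, hlam]
        simp [cexpv]
      have hsq' : ∀ w ∈ U, cexpv (a w) = sqv (A.mulVec w) := by
        intro w hw
        ext j
        rw [sqv, ← hA w hw j, ← Complex.exp_nat_mul]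
        simp [cexpv]
      refine half_monomial hn3 hu (half_extend (A := A) h hU hne ?_ ?_)
      · intro w hw
        rw [← hsq w hw]; exact (hUs w hw).2
      · intro w hw
        rw [← hsq w hw, ← hsq' w hw]; exact hlift w hw
    · exact monomial_of_ne_half hp hp2 hU hne ha hb hA hB h2
  obtain ⟨σ, hσ0, hσ1⟩ := exists_perm_of_monomial hu hmono
  have hY : ∀ w ∈ U, cexpv (a w) = (c • lam p w) ∘ σ := by
    intro w hw
    ext j
    have e1 : Complex.exp (p * a w j) = A j (σ j) * w (σ j) := by
      rw [hA w hw j, Matrix.mulVec, dotProduct, Finset.sum_eq_single (σ j)]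
      · intro k _ hk
        rw [hσ0 j k hk, zero_mul]
      · simp
    have e2 := h2 w hw j (σ j)
    have e3 : Complex.exp (a w j) = Complex.exp ((1 - 2 * p) * a w j) * Complex.exp (p * a w j) ^ 2 := by
      rw [← Complex.exp_nat_mul, ← Complex.exp_add]; congr 1; push_cast; ring
    have e4 : Complex.exp (blog p w (σ j)) = Complex.exp ((1 - 2 * p) * blog p w (σ j)) * w (σ j) ^ 2 := by
      have : w (σ j) ^ 2 = Complex.exp (p * blog p w (σ j)) ^ 2 := by rw [hB w hw (σ j)]
      rw [this, ← Complex.exp_nat_mul, ← Complex.exp_add]; congr 1; push_cast; ring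
    have e5 := hσ1 j
    show Complex.exp (a w j) = c * Complex.exp (blog p w (σ j))
    rw [e3, e4, e1]
    linear_combination (A j (σ j) * w (σ j) ^ 2) * e2 + c * Complex.exp ((1 - 2 * p) * blog p w (σ j)) * w (σ j) ^ 2 * e5
  have hrot := hext c (by
    intro w hw
    rw [hlift w hw, hY w hw, piMap_comp_perm, piMap_smul])
  refine ⟨c, ?_, hrot⟩
  obtain ⟨w, hw⟩ := hne
  have h3 := rho_aut hn hp hp1 h (hUs w hw).2
  rw [hrot _ (hUs w hw).2, rho_Tm] at h3
  have hpos : 0 < rho p (piMap n (lam p w)) := by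
    rw [rho_piMap]
    refine Finset.sum_pos (fun j _ => ?_) ⟨⟨0, by omega⟩, Finset.mem_univ _⟩
    exact Real.rpow_pos_of_pos (norm_pos_iff.2 (lam_ne_zero w j)) _
  have h4 : ‖c‖ ^ (2 * p) = 1 := mul_right_cancel₀ hpos.ne' (by rw [h3, one_mul])
  have h5 : (‖c‖ ^ (2 * p)) ^ (2 * p)⁻¹ = ‖c‖ := Real.rpow_rpow_inv (norm_nonneg _) (by positivity)
  rw [← h5, h4, Real.one_rpow]

end S6e

/-- For `p ≠ 1` and `(p, n) ≠ (1/2, 2)`, the automorphisms of `𝔼_{p,n}` are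
exactly the maps `φ_I(z) = (ζ z₁, ζ² z₂, …, ζⁿ z_n)` with `ζ ∈ 𝕋`. -/
theorem automorphisms_of_symEllipsoid (n : ℕ) (hn : 2 ≤ n) (p : ℝ) (hp : 0 < p)
    (hp1 : p ≠ 1) (hpn : ¬(p = 1 / 2 ∧ n = 2))
    (φ : (Fin n → ℂ) → (Fin n → ℂ)) :
    IsAutomorphismOf φ (symEllipsoid p n) ↔
      ∃ ζ : ℂ, ‖ζ‖ = 1 ∧
        ∀ z ∈ symEllipsoid p n, φ z = fun k : Fin n => ζ ^ (k.1 + 1) * z k := by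
  rw [symEllipsoid_eq]
  constructor
  · rintro ⟨hd, hbij, ψ, hψd, hinv⟩
    have hpair : AutPair p φ ψ := by
      refine ⟨hd, hψd, fun z hz => hbij.mapsTo hz, ?_, fun z hz => hinv.1 hz, fun z hz => hinv.2 hz⟩
      intro z hz
      obtain ⟨y, hy, rfl⟩ := hbij.surjOn (show z ∈ {z | rho p z < 1} from hz)
      rw [hinv.1 hy]; exact hy
    obtain ⟨c, hc, h⟩ := exists_rotation hn hp hp1 hpn hpair
    exact ⟨c, hc, fun z hz => h z hz⟩
  · rintro ⟨ζ, hζ, h⟩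
    have h' : ∀ z ∈ {z : Fin n → ℂ | rho p z < 1}, φ z = Tm ζ z := fun z hz => h z hz
    have hζ0 : ζ ≠ 0 := by
      rintro rfl
      simp at hζ
    have hζi : ‖ζ⁻¹‖ = 1 := by rw [norm_inv, hζ, inv_one]
    have hm : ∀ η : ℂ, ‖η‖ = 1 → ∀ z : Fin n → ℂ, rho p z < 1 → rho p (Tm η z) < 1 := fun η hη z hz => by
      rw [rho_Tm_of_norm_one p hη]; exact hz
    have hl : ∀ z : Fin n → ℂ, Tm ζ⁻¹ (Tm ζ z) = z := fun z => by
      rw [Tm_mul, inv_mul_cancel₀ hζ0, Tm_one]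
    have hi : Set.InvOn (Tm ζ⁻¹) φ {z : Fin n → ℂ | rho p z < 1} {z | rho p z < 1} := by
      refine ⟨fun z hz => ?_, fun z hz => ?_⟩
      · rw [h' z hz, hl]
      · rw [h' _ (hm _ hζi z hz), Tm_inv hζ0]
    refine ⟨(differentiable_Tm_right ζ).differentiableOn.congr h', hi.bijOn ?_ ?_, Tm ζ⁻¹, (differentiable_Tm_right _).differentiableOn, hi⟩
    · intro z hz
      rw [h' z hz]; exact hm ζ hζ z hz
    · intro z hz
      exact hm _ hζi z hz
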